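/- arXiv:2503.14176 — 2 statements merged into one kernel-verified Lean document; each statement's English description precedes it below -/
import Mathlib

section
/- Let 1 ≤ a < b be fixed real algebraic numbers such that a/b is irrational, and let c₄ = c₄(a,b) > 0 be the constant from the mean-square asymptotic for Δ_{a,b}. Then there exists a sufficiently large constant c₅ = c₅(a,b) > 0 such that for every sufficiently large T, the function Δ_{a,b}(x) changes sign at least once in the interval [T, T + c₅ T exp{ −c₄ (log T)^{1/2} (log log T)^{−1/2} }]; that is, there exist points x₁, x₂ in this interval with Δ_{a,b}(x₁) > 0 > Δ_{a,b}(x₂) or Δ_{a,b}(x₁) < 0 < Δ_{a,b}(x₂) (equivalently, Δ_{a,b} does not keep a fixed sign on the interval). -/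
open Real MeasureTheory

/-- The lattice point counting function `D_{a,b}(x) = #{(h,r) ∈ ℤ⁺×ℤ⁺ : h^a r^b ≤ x}`. -/
noncomputable def latticeCount (a b x : ℝ) : ℝ :=
  (Set.ncard {p : ℕ × ℕ | 0 < p.1 ∧ 0 < p.2 ∧ (p.1 : ℝ) ^ a * (p.2 : ℝ) ^ b ≤ x} : ℝ)

/-- The error term `Δ_{a,b}(x) = D_{a,b}(x) - ζ(b/a) x^{1/a} - ζ(a/b) x^{1/b}`. -/
noncomputable def DeltaErr (a b x : ℝ) : ℝ :=
  latticeCount a b x - (riemannZeta ((b / a : ℝ) : ℂ)).re * x ^ (1 / a)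
    - (riemannZeta ((a / b : ℝ) : ℂ)).re * x ^ (1 / b)

/-- The entire function `(s-1) ζ(s)`. -/
noncomputable def Zent : ℂ → ℂ := Function.update (fun s ↦ (s - 1) * riemannZeta s) 1 1

lemma Zent_one : Zent 1 = 1 := by simp [Zent]

lemma Zent_ne {s : ℂ} (hs : s ≠ 1) : Zent s = (s - 1) * riemannZeta s := by simp [Zent, hs]

lemma Zent_diff : Differentiable ℂ Zent := by
  intro s
  have h1 : DifferentiableOn ℂ Zent (Set.univ \ {1}) := by
    intro t ht
    have ht1 : t ≠ 1 := by simpa using ht.2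
    have : DifferentiableAt ℂ (fun s ↦ (s - 1) * riemannZeta s) t :=
      (by fun_prop : DifferentiableAt ℂ (fun s : ℂ ↦ s - 1) t).mul (differentiableAt_riemannZeta ht1)
    refine (this.congr_of_eventuallyEq ?_).differentiableWithinAt
    filter_upwards [isOpen_ne.mem_nhds ht1] with u hu using Zent_ne hu
  have h2 : ContinuousAt Zent 1 := by
    simpa only [Zent, continuousAt_update_same] using riemannZeta_residue_one
  have := (Complex.differentiableOn_compl_singleton_and_continuousAt_iff (c := 1)
    (f := Zent) Filter.univ_mem).1 ⟨h1, h2⟩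
  exact (this s trivial).differentiableAt Filter.univ_mem

noncomputable def eterm (s : ℂ) (n : ℕ) : ℂ :=
  (s - 1) * ((((n:ℝ) + 1 : ℝ) : ℂ) ^ (-s) + (((n:ℝ) + 2 : ℝ) : ℂ) ^ (-s)) / 2
    - ((((n:ℝ) + 1 : ℝ) : ℂ) ^ (1 - s) - (((n:ℝ) + 2 : ℝ) : ℂ) ^ (1 - s))

lemma hasDerivAt_rcpow (c : ℂ) {x : ℝ} (hx : 0 < x) :
    HasDerivAt (fun y : ℝ => (y : ℂ) ^ c) (c * (x : ℂ) ^ (c - 1)) x := by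
  have h : HasDerivAt (fun z : ℂ => z ^ c) (c * (x : ℂ) ^ (c - 1) * 1) (x : ℂ) :=
    (hasDerivAt_id (x : ℂ)).cpow_const (Or.inl (by simpa using hx))
  simpa using h.comp_ofReal

lemma eterm_bound (s : ℂ) (hs : -3/4 ≤ s.re) (n : ℕ) :
    ‖eterm s n‖ ≤ ‖s - 1‖ * ‖s‖ * ‖s + 1‖ * ((n:ℝ) + 1) ^ (-(5:ℝ)/4) := by
  set m : ℝ := (n:ℝ) + 1 with hm
  have hm1 : 1 ≤ m := by simp [hm]
  set K : ℝ := m ^ (-(5:ℝ)/4) with hK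
  have hK0 : 0 ≤ K := by positivity
  let G : ℝ → ℂ := fun x => (m : ℂ) ^ (-s) - (x : ℂ) ^ (-s) - s * (((x - m : ℝ) : ℂ) * (x : ℂ) ^ (-s - 1))
  have hG' : ∀ x : ℝ, 0 < x → HasDerivAt G (s * (s + 1) * ((x - m : ℝ) : ℂ) * (x : ℂ) ^ (-s - 2)) x := by
    intro x hx
    have h1 := hasDerivAt_rcpow (-s) hx
    have h2 := hasDerivAt_rcpow (-s - 1) hx
    have h3 : HasDerivAt (fun y : ℝ => ((y - m : ℝ) : ℂ)) 1 x := by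
      simpa using ((hasDerivAt_id x).sub_const m).ofReal_comp
    have h4 := (h1.const_sub ((m : ℂ) ^ (-s))).sub ((h3.mul h2).const_mul s)
    refine h4.congr_deriv ?_
    rw [show -s - 1 - 1 = -s - 2 by ring]
    ring
  have hGb : ∀ x ∈ Set.Icc m (m + 1), ‖G x‖ ≤ ‖s‖ * ‖s + 1‖ * K := by
    intro x hx
    have hb : ∀ y ∈ Set.Ico m (m + 1), ‖s * (s + 1) * ((y - m : ℝ) : ℂ) * (y : ℂ) ^ (-s - 2)‖
        ≤ ‖s‖ * ‖s + 1‖ * K := by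
      intro y hy
      have hy0 : 0 < y := by linarith [hy.1]
      rw [norm_mul, norm_mul, norm_mul, Complex.norm_cpow_eq_rpow_re_of_pos hy0, Complex.norm_real,
        Real.norm_eq_abs, abs_of_nonneg (by linarith [hy.1])]
      have e1 : y ^ (-s - 2).re ≤ K := by
        calc y ^ (-s - 2).re ≤ y ^ (-(5:ℝ)/4) := by
              apply Real.rpow_le_rpow_of_exponent_le (by linarith [hy.1])
              simp; linarith
          _ ≤ K := Real.rpow_le_rpow_of_nonpos (by linarith) hy.1 (by norm_num)
      have e2 : 0 ≤ y ^ (-s - 2).re := by positivity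
      have e3 : (y - m) * y ^ (-s - 2).re ≤ 1 * K := by
        apply mul_le_mul _ e1 e2 (by norm_num)
        linarith [hy.2]
      calc _ = ‖s‖ * ‖s + 1‖ * ((y - m) * y ^ (-s - 2).re) := by ring
        _ ≤ _ := by rw [one_mul] at e3; gcongr
    have := norm_image_sub_le_of_norm_deriv_le_segment'
      (fun y hy => (hG' y (by linarith [hy.1])).hasDerivWithinAt) hb x hx
    have hGm : G m = 0 := by simp [G]
    rw [hGm, sub_zero] at this
    refine this.trans ?_
    have : x - m ≤ 1 := by linarith [hx.2]
    calc _ ≤ ‖s‖ * ‖s + 1‖ * K * 1 := by gcongr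
      _ = _ := by ring
  let F : ℝ → ℂ := fun x => (s - 1) * (((x - m : ℝ) : ℂ) * ((m : ℂ) ^ (-s) + (x : ℂ) ^ (-s))) / 2
    - ((m : ℂ) ^ (1 - s) - (x : ℂ) ^ (1 - s))
  have hF' : ∀ x : ℝ, 0 < x → HasDerivAt F ((s - 1) / 2 * G x) x := by
    intro x hx
    have h1 := hasDerivAt_rcpow (-s) hx
    have h2 := hasDerivAt_rcpow (1 - s) hx
    have h3 : HasDerivAt (fun y : ℝ => ((y - m : ℝ) : ℂ)) 1 x := by
      simpa using ((hasDerivAt_id x).sub_const m).ofReal_comp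
    have h4 := (((h3.mul (h1.const_add ((m : ℂ) ^ (-s)))).const_mul (s - 1)).div_const 2).sub
      (h2.const_sub ((m : ℂ) ^ (1 - s)))
    refine h4.congr_deriv ?_
    rw [show 1 - s - 1 = -s by ring]
    simp only [G]
    ring
  have hb : ∀ y ∈ Set.Ico m (m + 1), ‖(s - 1) / 2 * G y‖ ≤ ‖s - 1‖ * (‖s‖ * ‖s + 1‖ * K) := by
    intro y hy
    rw [norm_mul]
    apply mul_le_mul _ (hGb y ⟨hy.1, hy.2.le⟩) (norm_nonneg _) (norm_nonneg _)
    rw [norm_div]; simp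
  have := norm_image_sub_le_of_norm_deriv_le_segment'
      (fun y hy => (hF' y (by linarith [hy.1])).hasDerivWithinAt) hb (m + 1) ⟨by linarith, le_rfl⟩
  have hFm : F m = 0 := by simp [F]
  have hFe : F (m + 1) = eterm s n := by
    simp only [F, eterm, hm]
    rw [show (n:ℝ) + 1 + 1 - (n + 1) = 1 by ring, show (n:ℝ) + 1 + 1 = n + 2 by ring]
    simp
  rw [hFm, sub_zero, hFe] at this
  refine this.trans (le_of_eq ?_)
  ring

lemma summable_K : Summable (fun n : ℕ => ((n:ℝ) + 1) ^ (-(5:ℝ)/4)) := by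
  have h : Summable (fun n : ℕ => (n:ℝ) ^ (-(5:ℝ)/4)) := Real.summable_nat_rpow.2 (by norm_num)
  simpa using (summable_nat_add_iff 1).2 h

lemma Zent_eq_of_one_lt {s : ℂ} (hs : 1 < s.re) :
    Zent s = 1 + (s - 1) / 2 + ∑' n, eterm s n := by
  have hs1 : s ≠ 1 := by rintro rfl; simp at hs
  have hsum : Summable (eterm s) := by
    refine Summable.of_norm_bounded (summable_K.mul_left _) (eterm_bound s (by linarith))
  have hz : HasSum (fun n : ℕ => (((n:ℝ) + 1 : ℝ) : ℂ) ^ (-s)) (riemannZeta s) := by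
    have hsm : Summable (fun n : ℕ => (((n:ℝ) + 1 : ℝ) : ℂ) ^ (-s)) := by
      have := (summable_nat_add_iff 1).2 (Complex.summable_one_div_nat_cpow.2 hs)
      refine this.congr fun n => ?_
      rw [Complex.cpow_neg]; push_cast; simp
    have := hsm.hasSum
    rw [zeta_eq_tsum_one_div_nat_add_one_cpow hs]
    convert this using 3 with n
    rw [Complex.cpow_neg]; push_cast; simp
  have hz2 : HasSum (fun n : ℕ => (((n:ℝ) + 2 : ℝ) : ℂ) ^ (-s)) (riemannZeta s - 1) := by
    have := (hasSum_nat_add_iff' 1).2 hz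
    simp only [Finset.sum_range_one] at this
    have e1 : (((0:ℕ):ℝ) + 1 : ℝ) = 1 := by norm_num
    rw [e1, Complex.ofReal_one, Complex.one_cpow] at this
    have e2 : (fun n : ℕ => (((n:ℝ) + 2 : ℝ) : ℂ) ^ (-s)) =
        fun n : ℕ => ((((n + 1 : ℕ):ℝ) + 1 : ℝ) : ℂ) ^ (-s) := by
      funext n
      rw [show (((n + 1 : ℕ):ℝ) + 1 : ℝ) = n + 2 by push_cast; ring]
    rw [e2]
    exact this
  have ht : Filter.Tendsto (fun N : ℕ => ∑ n ∈ Finset.range N,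
      ((((n:ℝ) + 1 : ℝ) : ℂ) ^ (1 - s) - (((n:ℝ) + 2 : ℝ) : ℂ) ^ (1 - s))) Filter.atTop (nhds 1) := by
    have e : ∀ N : ℕ, ∑ n ∈ Finset.range N,
      ((((n:ℝ) + 1 : ℝ) : ℂ) ^ (1 - s) - (((n:ℝ) + 2 : ℝ) : ℂ) ^ (1 - s))
        = 1 - (((N:ℝ) + 1 : ℝ) : ℂ) ^ (1 - s) := by
      intro N
      induction N with
      | zero => simp
      | succ k ih =>
        rw [Finset.sum_range_succ, ih]; push_cast
        rw [show (k:ℂ) + 1 + 1 = k + 2 by ring]; ring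
    simp_rw [e]
    have : Filter.Tendsto (fun N : ℕ => (((N:ℝ) + 1 : ℝ) : ℂ) ^ (1 - s)) Filter.atTop (nhds 0) := by
      rw [tendsto_zero_iff_norm_tendsto_zero]
      have e2 : ∀ N : ℕ, ‖(((N:ℝ) + 1 : ℝ) : ℂ) ^ (1 - s)‖ = ((N:ℝ) + 1) ^ (-(s.re - 1)) := by
        intro N
        rw [Complex.norm_cpow_eq_rpow_re_of_pos (by positivity)]; simp
      simp_rw [e2]
      exact (tendsto_rpow_neg_atTop (by linarith)).comp
        (Filter.tendsto_atTop_add_const_right _ _ tendsto_natCast_atTop_atTop)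
    simpa using this.const_sub 1
  have h1 := ((((hz.add hz2).mul_left (s - 1)).div_const 2).tendsto_sum_nat).sub ht
  have h2 := hsum.hasSum.tendsto_sum_nat
  have h3 := tendsto_nhds_unique (h2.congr (fun N => by
    rw [← Finset.sum_sub_distrib]; rfl)) h1
  rw [h3, Zent_ne hs1]; ring

lemma eterm_diff (n : ℕ) : Differentiable ℂ (fun s => eterm s n) := by
  have h : ∀ m : ℝ, 0 < m → Differentiable ℂ (fun s : ℂ => (m : ℂ) ^ s) := by
    intro m hm
    have : (m : ℂ) ≠ 0 := by exact_mod_cast hm.ne'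
    intro s
    exact (differentiableAt_id).const_cpow (Or.inl this)
  have h1 := h ((n:ℝ) + 1) (by positivity)
  have h2 := h ((n:ℝ) + 2) (by positivity)
  unfold eterm
  have a1 : Differentiable ℂ (fun s : ℂ => (((n:ℝ) + 1 : ℝ) : ℂ) ^ (-s)) := h1.comp differentiable_neg
  have a2 : Differentiable ℂ (fun s : ℂ => (((n:ℝ) + 2 : ℝ) : ℂ) ^ (-s)) := h2.comp differentiable_neg
  have d : Differentiable ℂ (fun s : ℂ => 1 - s) := by fun_prop
  have a3 : Differentiable ℂ (fun s : ℂ => (((n:ℝ) + 1 : ℝ) : ℂ) ^ (1-s)) := h1.comp d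
  have a4 : Differentiable ℂ (fun s : ℂ => (((n:ℝ) + 2 : ℝ) : ℂ) ^ (1-s)) := h2.comp d
  fun_prop

lemma Zent_eq {s : ℂ} (hs : -3/4 < s.re) :
    Zent s = 1 + (s - 1) / 2 + ∑' n, eterm s n := by
  set R : ℝ := ‖s‖ + 3
  set U : Set ℂ := {z : ℂ | -3/4 < z.re} ∩ Metric.ball 0 R with hU
  have hUo : IsOpen U := (isOpen_lt continuous_const Complex.continuous_re).inter Metric.isOpen_ball
  have hUc : IsPreconnected U :=
    ((convex_halfSpace_re_gt _).inter (convex_ball _ _)).isPreconnected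
  have hd : DifferentiableOn ℂ (fun z => 1 + (z - 1) / 2 + ∑' n, eterm z n) U := by
    have : DifferentiableOn ℂ (fun z => ∑' n, eterm z n) U := by
      refine Complex.differentiableOn_tsum_of_summable_norm
        (u := fun n : ℕ => (R + 1) * R * (R + 1) * ((n:ℝ) + 1) ^ (-(5:ℝ)/4)) (summable_K.mul_left _)
        (fun n => (eterm_diff n).differentiableOn) hUo ?_
      intro n z hz
      refine (eterm_bound z hz.1.le n).trans ?_
      have h1 : ‖z‖ ≤ R := by simpa using (Metric.mem_ball.1 hz.2).le
      have h2 : ‖z - 1‖ ≤ R + 1 := (norm_sub_le _ _).trans (by simpa using h1)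
      have h3 : ‖z + 1‖ ≤ R + 1 := (norm_add_le _ _).trans (by simpa using h1)
      have h4 : 0 ≤ R := (norm_nonneg _).trans h1
      gcongr
    fun_prop
  have h2 : (2 : ℂ) ∈ U := by
    refine ⟨by simp; norm_num, ?_⟩
    simp [R]; linarith [norm_nonneg s]
  have := AnalyticOnNhd.eqOn_of_preconnected_of_eventuallyEq
    (Zent_diff.differentiableOn.analyticOnNhd hUo) (hd.analyticOnNhd hUo) hUc h2 (by
      have : {z : ℂ | 1 < z.re} ∈ nhds (2:ℂ) :=
        (isOpen_lt continuous_const Complex.continuous_re).mem_nhds (by simp)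
      filter_upwards [this] with z hz using Zent_eq_of_one_lt hz)
  exact this ⟨hs, by simp [R]⟩

lemma Zent_bound : ∃ C : ℝ, 0 < C ∧ ∀ s : ℂ, -1/2 ≤ s.re → ‖Zent s‖ ≤ C * (1 + ‖s‖) ^ 3 := by
  refine ⟨2 + ∑' n : ℕ, ((n:ℝ) + 1) ^ (-(5:ℝ)/4), ?_, ?_⟩
  · have : 0 ≤ ∑' n : ℕ, ((n:ℝ) + 1) ^ (-(5:ℝ)/4) := tsum_nonneg (fun n => by positivity)
    linarith
  intro s hs
  rw [Zent_eq (by linarith)]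
  set S := ∑' n : ℕ, ((n:ℝ) + 1) ^ (-(5:ℝ)/4)
  set r := ‖s‖
  have hr : 0 ≤ r := norm_nonneg s
  have hS : 0 ≤ S := tsum_nonneg (fun n => by positivity)
  have h2 : ‖s - 1‖ ≤ 1 + r := (norm_sub_le _ _).trans (by simp [r, add_comm])
  have h3 : ‖s + 1‖ ≤ 1 + r := (norm_add_le _ _).trans (by simp [r, add_comm])
  have h4 : ‖∑' n, eterm s n‖ ≤ (1 + r) ^ 3 * S := by
    have := tsum_of_norm_bounded (summable_K.mul_left (‖s - 1‖ * ‖s‖ * ‖s + 1‖)).hasSum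
      (eterm_bound s (by linarith))
    rw [tsum_mul_left] at this
    refine this.trans ?_
    calc ‖s - 1‖ * ‖s‖ * ‖s + 1‖ * S ≤ (1 + r) * (1 + r) * (1 + r) * S := by
          gcongr; linarith
      _ = _ := by ring
  have h5 : ‖1 + (s - 1) / 2‖ ≤ 2 * (1 + r) ^ 3 := by
    refine (norm_add_le _ _).trans ?_
    rw [norm_div]; simp
    nlinarith [pow_nonneg hr 2, pow_nonneg hr 3]
  calc _ ≤ _ := norm_add_le _ _
    _ ≤ 2 * (1 + r) ^ 3 + (1 + r) ^ 3 * S := add_le_add h5 h4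
    _ = _ := by ring

noncomputable def lam (a b : ℝ) (p : ℕ × ℕ) : ℝ :=
  a * Real.log ((p.1:ℝ) + 1) + b * Real.log ((p.2:ℝ) + 1)

lemma lam_nonneg {a b : ℝ} (ha : 1 ≤ a) (hb : 1 ≤ b) (p : ℕ × ℕ) : 0 ≤ lam a b p := by
  have h1 : 0 ≤ Real.log ((p.1:ℝ) + 1) := Real.log_nonneg (by simp)
  have h2 : 0 ≤ Real.log ((p.2:ℝ) + 1) := Real.log_nonneg (by simp)
  unfold lam; positivity

lemma lam_subset {a b : ℝ} (ha : 1 ≤ a) (hb : 1 ≤ b) (w : ℝ) :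
    {p : ℕ × ℕ | lam a b p ≤ w} ⊆ ((Finset.range ⌊Real.exp w⌋₊ ×ˢ Finset.range ⌊Real.exp w⌋₊ : Finset (ℕ × ℕ)) : Set (ℕ × ℕ)) := by
  intro p hp
  have h1 : 0 ≤ Real.log ((p.1:ℝ) + 1) := Real.log_nonneg (by simp)
  have h2 : 0 ≤ Real.log ((p.2:ℝ) + 1) := Real.log_nonneg (by simp)
  have hp' : a * Real.log ((p.1:ℝ) + 1) + b * Real.log ((p.2:ℝ) + 1) ≤ w := hp
  have h3 : Real.log ((p.1:ℝ) + 1) ≤ w := by nlinarith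
  have h4 : Real.log ((p.2:ℝ) + 1) ≤ w := by nlinarith
  rw [Real.log_le_iff_le_exp (by positivity)] at h3 h4
  simp only [Finset.coe_product, Finset.coe_range, Set.mem_prod, Set.mem_Iio]
  constructor
  · exact Nat.lt_of_succ_le (Nat.le_floor (by push_cast; linarith))
  · exact Nat.lt_of_succ_le (Nat.le_floor (by push_cast; linarith))

lemma latticeCount_eq_ncard {a b : ℝ} (w : ℝ) :
    latticeCount a b (Real.exp w) = (Set.ncard {p : ℕ × ℕ | lam a b p ≤ w} : ℝ) := by
  unfold latticeCount
  congr 1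
  have : {p : ℕ × ℕ | 0 < p.1 ∧ 0 < p.2 ∧ (p.1 : ℝ) ^ a * (p.2 : ℝ) ^ b ≤ Real.exp w}
      = (fun p : ℕ × ℕ => (p.1 + 1, p.2 + 1)) '' {p : ℕ × ℕ | lam a b p ≤ w} := by
    have key : ∀ h r : ℕ, (((h + 1 : ℕ) : ℝ) ^ a * ((r + 1 : ℕ) : ℝ) ^ b ≤ Real.exp w ↔ lam a b (h, r) ≤ w) := by
      intro h r
      rw [← Real.exp_le_exp (x := lam a b (h, r))]
      have : Real.exp (lam a b (h, r)) = ((h + 1 : ℕ) : ℝ) ^ a * ((r + 1 : ℕ) : ℝ) ^ b := by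
        rw [lam, Real.exp_add, Real.rpow_def_of_pos (by positivity), Real.rpow_def_of_pos (by positivity)]
        push_cast
        rw [mul_comm a, mul_comm b]
      rw [this]
    ext ⟨h, r⟩
    simp only [Set.mem_ofPred_eq, Set.mem_image, Prod.mk.injEq, Prod.exists]
    constructor
    · rintro ⟨h1, h2, h3⟩
      obtain ⟨h', rfl⟩ := Nat.exists_eq_succ_of_ne_zero h1.ne'
      obtain ⟨r', rfl⟩ := Nat.exists_eq_succ_of_ne_zero h2.ne'
      exact ⟨h', r', (key h' r').1 h3, rfl, rfl⟩
    · rintro ⟨h', r', h1, rfl, rfl⟩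
      exact ⟨by omega, by omega, (key h' r').2 h1⟩
  rw [this, Set.ncard_image_of_injective]
  intro p q hpq
  simp only [Prod.mk.injEq] at hpq
  exact Prod.ext (by omega) (by omega)

lemma latticeCount_mono {a b : ℝ} (ha : 1 ≤ a) (hb : 1 ≤ b) :
    Monotone (fun w : ℝ => latticeCount a b (Real.exp w)) := by
  intro w w' hw
  simp only [latticeCount_eq_ncard]
  exact_mod_cast Set.ncard_le_ncard (fun p (hp : lam a b p ≤ w) => le_trans hp hw)
    ((Finset.finite_toSet _).subset (lam_subset ha hb w'))

lemma latticeCount_nonneg (a b x : ℝ) : 0 ≤ latticeCount a b x := by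
  unfold latticeCount; positivity

lemma latticeCount_le {a b : ℝ} (ha : 1 ≤ a) (hb : 1 ≤ b) (w : ℝ) :
    latticeCount a b (Real.exp w) ≤ Real.exp (2 * w) := by
  rw [latticeCount_eq_ncard]
  have h1 := Set.ncard_le_ncard (lam_subset ha hb w) (Finset.finite_toSet _)
  rw [Set.ncard_coe_finset, Finset.card_product, Finset.card_range] at h1
  have h2 : ((⌊Real.exp w⌋₊ : ℕ) : ℝ) ≤ Real.exp w := Nat.floor_le (Real.exp_pos w).le
  calc (Set.ncard {p : ℕ × ℕ | lam a b p ≤ w} : ℝ) ≤ ((⌊Real.exp w⌋₊ * ⌊Real.exp w⌋₊ : ℕ) : ℝ) := by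
        exact_mod_cast h1
    _ = (⌊Real.exp w⌋₊ : ℝ) * ⌊Real.exp w⌋₊ := by push_cast; ring
    _ ≤ Real.exp w * Real.exp w := by gcongr
    _ = _ := by rw [← Real.exp_add]; ring_nf

lemma latticeCount_tsum {a b : ℝ} (ha : 1 ≤ a) (hb : 1 ≤ b) (w : ℝ) (z : ℂ) :
    (latticeCount a b (Real.exp w) : ℂ) * z =
      ∑' p : ℕ × ℕ, (Set.Ici (lam a b p)).indicator (fun _ => z) w := by
  rw [latticeCount_eq_ncard]
  have hfin : {p : ℕ × ℕ | lam a b p ≤ w}.Finite := (Finset.finite_toSet _).subset (lam_subset ha hb w)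
  rw [tsum_eq_sum (s := hfin.toFinset)]
  · rw [Finset.sum_congr rfl (g := fun _ => z)]
    · rw [Finset.sum_const, Set.ncard_eq_toFinset_card _ hfin]
      simp
    · intro p hp
      have : lam a b p ≤ w := by simpa using hp
      simp [this]
  · intro p hp
    have : ¬ lam a b p ≤ w := by simpa using hp
    simp [this]

lemma laplace_count {a b : ℝ} (ha : 1 ≤ a) (hb : 1 ≤ b) {s : ℂ} (hs : 2 < s.re) :
    ∫ w in Set.Ioi (0:ℝ), (latticeCount a b (Real.exp w) : ℂ) * Complex.exp (-s * w)
      = riemannZeta (a * s) * riemannZeta (b * s) / s := by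
  have hs0 : s ≠ 0 := by rintro rfl; simp at hs; linarith
  have hneg : (-s).re < 0 := by simp; linarith
  set F : ℕ × ℕ → ℝ → ℂ := fun p => (Set.Ici (lam a b p)).indicator (fun w : ℝ => Complex.exp (-s * w)) with hF
  have e0 : ∀ w : ℝ, (latticeCount a b (Real.exp w) : ℂ) * Complex.exp (-s * w) = ∑' p, F p w := by
    intro w
    rw [latticeCount_tsum ha hb]
    simp only [hF, Set.indicator]
    rfl
  simp_rw [e0]
  have hInteg0 : ∀ c : ℝ, IntegrableOn (fun w : ℝ => Complex.exp (-s * w)) (Set.Ioi c) :=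
    fun c => integrableOn_exp_mul_complex_Ioi hneg c
  have hInteg : ∀ p, Integrable (F p) (volume.restrict (Set.Ioi 0)) := by
    intro p
    exact (hInteg0 0).integrable.indicator measurableSet_Ici
  have hset : ∀ p, (Set.Ici (lam a b p) ∩ Set.Ioi (0:ℝ) : Set ℝ) =ᵐ[volume] Set.Ioi (lam a b p) := by
    intro p
    have h1 : (Set.Ici (lam a b p) ∩ Set.Ioi (0:ℝ) : Set ℝ) =ᵐ[volume] (Set.Ioi (lam a b p) ∩ Set.Ioi (0:ℝ) : Set ℝ) :=
      Ioi_ae_eq_Ici.symm.inter (ae_eq_refl _)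
    have h2 : (Set.Ioi (lam a b p) ∩ Set.Ioi (0:ℝ) : Set ℝ) = Set.Ioi (lam a b p) := by
      ext x
      simp only [Set.mem_inter_iff, Set.mem_Ioi]
      have := lam_nonneg ha hb p
      constructor
      · exact fun h => h.1
      · exact fun h => ⟨h, by linarith⟩
    rw [h2] at h1
    exact h1
  have hval : ∀ p, ∫ w in Set.Ioi (0:ℝ), F p w = Complex.exp (-s * lam a b p) / s := by
    intro p
    simp only [hF]
    rw [integral_indicator measurableSet_Ici, Measure.restrict_restrict measurableSet_Ici,
      Measure.restrict_congr_set (hset p), integral_exp_mul_complex_Ioi hneg]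
    field_simp
  have hnorm : ∀ p, ∫ w in Set.Ioi (0:ℝ), ‖F p w‖ = Real.exp (-s.re * lam a b p) / s.re := by
    intro p
    have : ∀ w, ‖F p w‖ = (Set.Ici (lam a b p)).indicator (fun w : ℝ => Real.exp (-s.re * w)) w := by
      intro w
      simp only [hF, Set.indicator]
      split_ifs
      · rw [Complex.norm_exp]; simp
      · simp
    simp_rw [this]
    rw [integral_indicator measurableSet_Ici, Measure.restrict_restrict measurableSet_Ici,
      Measure.restrict_congr_set (hset p), integral_exp_mul_Ioi (by linarith)]
    have : s.re ≠ 0 := by linarith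
    field_simp
  have hexp : ∀ p : ℕ × ℕ, Complex.exp (-s * lam a b p) =
      (1 / ((p.1:ℂ) + 1) ^ ((a:ℂ) * s)) * (1 / ((p.2:ℂ) + 1) ^ ((b:ℂ) * s)) := by
    intro p
    have h : ∀ (n : ℕ) (z : ℂ), 1 / ((n:ℂ) + 1) ^ z = Complex.exp (-z * (Real.log ((n:ℝ) + 1) : ℝ)) := by
      intro n z
      have hn : ((n:ℂ) + 1) ≠ 0 := by exact_mod_cast Nat.succ_ne_zero n
      rw [Complex.cpow_def_of_ne_zero hn, one_div, ← Complex.exp_neg, Complex.ofReal_log (by positivity)]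
      push_cast
      ring_nf
    rw [h, h, ← Complex.exp_add, lam]
    push_cast
    ring_nf
  have hre : ∀ c : ℝ, 1 ≤ c → 1 < ((c:ℂ) * s).re := by
    intro c hc
    simp
    nlinarith
  have hsum1 : ∀ c : ℝ, 1 ≤ c → Summable (fun n : ℕ => ‖1 / ((n:ℂ) + 1) ^ ((c:ℂ) * s)‖) := by
    intro c hc
    have := (summable_nat_add_iff 1).2 (Complex.summable_one_div_nat_cpow.2 (hre c hc)).norm
    refine this.congr fun n => ?_
    push_cast; rfl
  have hsumn : Summable fun p => ∫ w in Set.Ioi (0:ℝ), ‖F p w‖ := by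
    simp_rw [hnorm]
    apply Summable.div_const
    have := (hsum1 a ha).mul_of_nonneg (hsum1 b hb) (fun _ => norm_nonneg _) (fun _ => norm_nonneg _)
    refine this.congr fun p => ?_
    rw [← norm_mul, ← hexp p, Complex.norm_exp]
    simp
  have := (hasSum_integral_of_summable_integral_norm hInteg hsumn).tsum_eq
  rw [← this]
  simp_rw [hval]
  rw [tsum_div_const]
  simp_rw [hexp]
  rw [zeta_eq_tsum_one_div_nat_add_one_cpow (hre a ha), zeta_eq_tsum_one_div_nat_add_one_cpow (hre b hb),
    tsum_mul_tsum_of_summable_norm (hsum1 a ha) (hsum1 b hb)]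

lemma dslope_entire {f : ℂ → ℂ} (hf : Differentiable ℂ f) (p : ℂ) : Differentiable ℂ (dslope f p) := by
  have := (Complex.differentiableOn_dslope (f := f) (s := Set.univ) (c := p) Filter.univ_mem).2 hf.differentiableOn
  exact differentiableOn_univ.1 this

lemma divdiff (f : ℂ → ℂ) (hf : Differentiable ℂ f) (p q r : ℝ) (hpq : p ≠ q) (hpr : p ≠ r) (hqr : q ≠ r)
    (α β C : ℝ) (hC : 0 ≤ C)
    (hb : ∀ x ∈ Set.Icc α β, ∀ y : ℝ, ‖f (x + y * Complex.I)‖ ≤ C * (1 + |y|)^6) :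
    ∃ R : ℂ → ℂ, Differentiable ℂ R ∧
      (∀ s : ℂ, s ≠ p → s ≠ q → s ≠ r → R s = f s / ((s - p) * (s - q) * (s - r))
        - f p / ((s - p) * ((p - q) * (p - r))) - f q / ((s - q) * ((q - p) * (q - r)))
        - f r / ((s - r) * ((r - p) * (r - q)))) ∧
      ∃ C' : ℝ, 0 < C' ∧ ∀ x ∈ Set.Icc α β, ∀ y : ℝ, ‖R (x + y * Complex.I)‖ ≤ C' * (1 + |y|)^6 := by
  have h1 : (p:ℂ) ≠ q := by exact_mod_cast hpq
  have h2 : (p:ℂ) ≠ r := by exact_mod_cast hpr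
  have h3 : (q:ℂ) ≠ r := by exact_mod_cast hqr
  have h1' := sub_ne_zero.2 h1
  have h2' := sub_ne_zero.2 h2
  have h3' := sub_ne_zero.2 h3
  have h1'' := sub_ne_zero.2 h1.symm
  have h2'' := sub_ne_zero.2 h2.symm
  have h3'' := sub_ne_zero.2 h3.symm
  set R := dslope (dslope (dslope f p) q) r with hR
  have hRd : Differentiable ℂ R := dslope_entire (dslope_entire (dslope_entire hf p) q) r
  have hform : ∀ s : ℂ, s ≠ p → s ≠ q → s ≠ r → R s = f s / ((s - p) * (s - q) * (s - r))
        - f p / ((s - p) * ((p - q) * (p - r))) - f q / ((s - q) * ((q - p) * (q - r)))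
        - f r / ((s - r) * ((r - p) * (r - q))) := by
    intro s sp sq sr
    have k1 := sub_ne_zero.2 sp
    have k2 := sub_ne_zero.2 sq
    have k3 := sub_ne_zero.2 sr
    rw [hR, dslope_of_ne _ sr, slope_def_field, dslope_of_ne _ sq, slope_def_field,
      dslope_of_ne _ h3.symm, slope_def_field, dslope_of_ne _ sp, slope_def_field,
      dslope_of_ne _ h2.symm, slope_def_field, dslope_of_ne _ h1.symm, slope_def_field]
    have e1 : (p:ℂ) - q = -(q - p) := by ring
    have e2 : (p:ℂ) - r = -(r - p) := by ring
    have e3 : (q:ℂ) - r = -(r - q) := by ring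
    rw [e1, e2, e3]
    field_simp
    ring
  refine ⟨R, hRd, hform, ?_⟩
  have hcomp : IsCompact ((fun z : ℝ × ℝ => ‖R (z.1 + z.2 * Complex.I)‖) '' (Set.Icc α β ×ˢ Set.Icc (-1) 1)) := by
    apply (isCompact_Icc.prod isCompact_Icc).image
    exact (hRd.continuous.comp (by fun_prop)).norm
  obtain ⟨B, hB⟩ := hcomp.bddAbove
  set A := ‖f p / (((p:ℂ) - q) * (p - r))‖ + ‖f q / (((q:ℂ) - p) * (q - r))‖ + ‖f r / (((r:ℂ) - p) * (r - q))‖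
  have hA : 0 ≤ A := by positivity
  refine ⟨|B| + C + A + 1, by positivity, ?_⟩
  intro x hx y
  have hy : 1 ≤ (1 + |y|)^6 := one_le_pow₀ (by linarith [abs_nonneg y])
  by_cases hy1 : |y| ≤ 1
  · have : ‖R (x + y * Complex.I)‖ ≤ B := hB ⟨(x, y), ⟨hx, abs_le.1 hy1⟩, rfl⟩
    calc _ ≤ B := this
      _ ≤ |B| := le_abs_self _
      _ ≤ |B| + C + A + 1 := by linarith
      _ ≤ _ := le_mul_of_one_le_right (by positivity) hy
  · push Not at hy1
    set s : ℂ := x + y * Complex.I with hs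
    have hn : ∀ u : ℝ, 1 ≤ ‖s - u‖ := by
      intro u
      have : |(s - u).im| ≤ ‖s - u‖ := Complex.abs_im_le_norm _
      have e : (s - u).im = y := by simp [hs]
      rw [e] at this
      linarith
    have hne : ∀ u : ℝ, s ≠ u := by
      intro u h
      have := hn u
      rw [h] at this; simp at this; linarith
    have hterm : ∀ (u : ℝ) (v d : ℂ), ‖v / ((s - u) * d)‖ ≤ ‖v / d‖ := by
      intro u v d
      rw [mul_comm, ← div_div, norm_div]
      exact div_le_self (norm_nonneg _) (hn u)
    rw [hform s (hne p) (hne q) (hne r)]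
    have hmain : ‖f s / ((s - p) * (s - q) * (s - r))‖ ≤ C * (1 + |y|)^6 := by
      rw [mul_assoc]
      refine (hterm p _ _).trans ((hterm q _ _).trans ?_)
      rw [norm_div]
      exact (div_le_self (norm_nonneg _) (hn r)).trans (hb x hx y)
    calc _ ≤ ‖f s / ((s - p) * (s - q) * (s - r))‖ + ‖f p / ((s - p) * ((p - q) * (p - r)))‖
          + ‖f q / ((s - q) * ((q - p) * (q - r)))‖ + ‖f r / ((s - r) * ((r - p) * (r - q)))‖ := by
          refine (norm_sub_le _ _).trans (add_le_add_left ((norm_sub_le _ _).trans (add_le_add_left (norm_sub_le _ _) _)) _)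
      _ ≤ C * (1 + |y|)^6 + ‖f p / (((p:ℂ) - q) * (p - r))‖ + ‖f q / (((q:ℂ) - p) * (q - r))‖ + ‖f r / (((r:ℂ) - p) * (r - q))‖ := by
          gcongr
          · exact hterm _ _ _
          · exact hterm _ _ _
          · exact hterm _ _ _
      _ = C * (1 + |y|)^6 + A := by simp only [A]; ring
      _ ≤ C * (1 + |y|)^6 + A * (1 + |y|)^6 := by
          gcongr; exact le_mul_of_one_le_right hA hy
      _ ≤ _ := by nlinarith [abs_nonneg B]

noncomputable def phi (a b w : ℝ) : ℝ := DeltaErr a b (Real.exp w) - 1 / 4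

lemma phi_eq (a b w : ℝ) : phi a b w = latticeCount a b (Real.exp w)
    - (riemannZeta ((b / a : ℝ) : ℂ)).re * Real.exp (w / a)
    - (riemannZeta ((a / b : ℝ) : ℂ)).re * Real.exp (w / b) - 1 / 4 := by
  unfold phi DeltaErr
  rw [← Real.exp_mul, ← Real.exp_mul]
  simp only [mul_one_div]

lemma phi_measurable {a b : ℝ} (ha : 1 ≤ a) (hb : 1 ≤ b) : Measurable (phi a b) := by
  have : phi a b = fun w => latticeCount a b (Real.exp w)
    - (riemannZeta ((b / a : ℝ) : ℂ)).re * Real.exp (w / a)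
    - (riemannZeta ((a / b : ℝ) : ℂ)).re * Real.exp (w / b) - 1 / 4 := funext (phi_eq a b)
  rw [this]
  have h := (latticeCount_mono ha hb).measurable
  fun_prop

lemma phi_bound {a b : ℝ} (ha : 1 ≤ a) (hb : 1 ≤ b) :
    ∃ C : ℝ, 0 < C ∧ ∀ w : ℝ, 0 ≤ w → |phi a b w| ≤ C * Real.exp (2 * w) := by
  refine ⟨2 + |(riemannZeta ((b / a : ℝ) : ℂ)).re| + |(riemannZeta ((a / b : ℝ) : ℂ)).re|, by positivity, ?_⟩
  intro w hw
  rw [phi_eq]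
  have e1 : ∀ c : ℝ, 1 ≤ c → Real.exp (w / c) ≤ Real.exp (2 * w) := by
    intro c hc
    apply Real.exp_le_exp.2
    have : w / c ≤ w := div_le_self hw hc
    linarith
  have e2 : (1:ℝ) ≤ Real.exp (2 * w) := Real.one_le_exp (by linarith)
  have e3 := latticeCount_le ha hb w
  have e4 := latticeCount_nonneg a b (Real.exp w)
  set z1 := (riemannZeta ((b / a : ℝ) : ℂ)).re
  set z2 := (riemannZeta ((a / b : ℝ) : ℂ)).re
  have f1 : |z1 * Real.exp (w / a)| ≤ |z1| * Real.exp (2 * w) := by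
    rw [abs_mul, abs_of_pos (Real.exp_pos _)]; exact mul_le_mul_of_nonneg_left (e1 a ha) (abs_nonneg _)
  have f2 : |z2 * Real.exp (w / b)| ≤ |z2| * Real.exp (2 * w) := by
    rw [abs_mul, abs_of_pos (Real.exp_pos _)]; exact mul_le_mul_of_nonneg_left (e1 b hb) (abs_nonneg _)
  rw [abs_le] at f1 f2 ⊢
  constructor <;> nlinarith

lemma phi_integrable {a b : ℝ} (ha : 1 ≤ a) (hb : 1 ≤ b) :
    Integrable (fun w : ℝ => Real.exp (-3 * w) * phi a b w) (volume.restrict (Set.Ioi 0)) := by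
  obtain ⟨C, hC, h⟩ := phi_bound ha hb
  have hi : Integrable (fun w : ℝ => C * Real.exp (-1 * w)) (volume.restrict (Set.Ioi 0)) :=
    (integrableOn_exp_mul_Ioi (by norm_num) 0).integrable.const_mul C
  refine hi.mono' ?_ ?_
  · have := phi_measurable ha hb
    exact (by fun_prop : Measurable (fun w : ℝ => Real.exp (-3 * w) * phi a b w)).aestronglyMeasurable
  · filter_upwards [ae_restrict_mem measurableSet_Ioi] with w hw
    have hw0 : 0 < w := hw
    rw [Real.norm_eq_abs, abs_mul, abs_of_pos (Real.exp_pos _)]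
    calc _ ≤ Real.exp (-3 * w) * (C * Real.exp (2 * w)) := by gcongr; exact h w hw0.le
      _ = C * (Real.exp (-3 * w) * Real.exp (2 * w)) := by ring
      _ = _ := by rw [← Real.exp_add]; ring_nf

lemma zeta_real (x : ℝ) : (((riemannZeta (x : ℂ)).re : ℝ) : ℂ) = riemannZeta (x : ℂ) := by
  have := riemannZeta_conj (x : ℂ)
  rw [Complex.conj_ofReal] at this
  exact Complex.conj_eq_iff_re.1 this.symm

lemma laplace_phi {a b : ℝ} (ha : 1 ≤ a) (hb : 1 ≤ b) (s : ℂ) (hs : 2 < s.re) :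
    ∫ w in Set.Ioi (0:ℝ), (phi a b w : ℂ) * Complex.exp (-s * w) =
      riemannZeta (a * s) * riemannZeta (b * s) / s
        - riemannZeta ((b / a : ℝ) : ℂ) / (s - (1 / a : ℝ)) - riemannZeta ((a / b : ℝ) : ℂ) / (s - (1 / b : ℝ))
        - (1 / 4) / s := by
  have hs0 : s ≠ 0 := by rintro rfl; simp at hs; linarith
  have hia : ∀ c : ℝ, 1 ≤ c → ((((1 / c : ℝ) : ℂ)) - s).re < 0 := by
    intro c hc
    have : 1 / c ≤ 1 := by rw [div_le_one (by linarith)]; exact hc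
    rw [Complex.sub_re, Complex.ofReal_re]; linarith
  have hneg : (-s).re < 0 := by simp; linarith
  have i1 := integrableOn_exp_mul_complex_Ioi (hia a ha) 0
  have i2 := integrableOn_exp_mul_complex_Ioi (hia b hb) 0
  have i3 := integrableOn_exp_mul_complex_Ioi hneg 0
  have i0 : IntegrableOn (fun w : ℝ => (latticeCount a b (Real.exp w) : ℂ) * Complex.exp (-s * w)) (Set.Ioi 0) := by
    have hneg2 : ((2:ℂ) - s).re < 0 := by simp; linarith
    have := (integrableOn_exp_mul_complex_Ioi hneg2 0).norm
    refine Integrable.mono' this ?_ ?_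
    · have := (latticeCount_mono ha hb).measurable
      exact (by fun_prop : Measurable (fun w : ℝ => (latticeCount a b (Real.exp w) : ℂ) * Complex.exp (-s * w))).aestronglyMeasurable
    · refine Filter.Eventually.of_forall fun w => ?_
      rw [norm_mul, Complex.norm_exp, Complex.norm_exp, Complex.norm_real, Real.norm_eq_abs,
        abs_of_nonneg (latticeCount_nonneg _ _ _)]
      calc _ ≤ Real.exp (2 * w) * Real.exp ((-s * w).re) := by
            gcongr; exact latticeCount_le ha hb w
        _ = _ := by rw [← Real.exp_add]; congr 1; simp; ring
  have e : ∀ w : ℝ, (phi a b w : ℂ) * Complex.exp (-s * w) =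
      (latticeCount a b (Real.exp w) : ℂ) * Complex.exp (-s * w)
      - riemannZeta ((b / a : ℝ) : ℂ) * Complex.exp ((((1 / a : ℝ) : ℂ) - s) * w)
      - riemannZeta ((a / b : ℝ) : ℂ) * Complex.exp ((((1 / b : ℝ) : ℂ) - s) * w)
      - (1/4) * Complex.exp (-s * w) := by
    intro w
    rw [phi_eq, ← zeta_real (b / a), ← zeta_real (a / b)]
    have h : ∀ c : ℝ, Complex.exp ((((1 / c : ℝ) : ℂ) - s) * w) = Complex.exp ((w / c : ℝ) : ℂ) * Complex.exp (-s * w) := by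
      intro c
      rw [← Complex.exp_add]; congr 1; push_cast; ring
    rw [h, h, ← Complex.ofReal_exp, ← Complex.ofReal_exp]
    simp only [Complex.ofReal_re]
    generalize (riemannZeta ((b / a : ℝ) : ℂ)).re = z1
    generalize (riemannZeta ((a / b : ℝ) : ℂ)).re = z2
    push_cast
    ring
  simp_rw [e]
  rw [integral_sub, integral_sub, integral_sub, integral_const_mul, integral_const_mul, integral_const_mul,
    laplace_count ha hb hs, integral_exp_mul_complex_Ioi (hia a ha), integral_exp_mul_complex_Ioi (hia b hb),
    integral_exp_mul_complex_Ioi hneg]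
  · have n1 : ((1 / a : ℝ) : ℂ) - s ≠ 0 := fun h => by have := hia a ha; rw [h] at this; simp at this
    have n2 : ((1 / b : ℝ) : ℂ) - s ≠ 0 := fun h => by have := hia b hb; rw [h] at this; simp at this
    rw [← neg_sub (((1 / a : ℝ)) : ℂ) s, ← neg_sub (((1 / b : ℝ)) : ℂ) s]
    simp only [Complex.ofReal_zero, mul_zero, Complex.exp_zero]
    set u := ((1 / a : ℝ) : ℂ) - s
    set v := ((1 / b : ℝ) : ℂ) - s
    field_simp
  · exact i0
  · exact i1.integrable.const_mul _
  · exact i0.integrable.sub (i1.integrable.const_mul _)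
  · exact i2.integrable.const_mul _
  · exact (i0.integrable.sub (i1.integrable.const_mul _)).sub (i2.integrable.const_mul _)
  · exact i3.integrable.const_mul _

lemma contour_shift (f : ℂ → ℂ) (hf : Differentiable ℂ f) (p q : ℝ) (hpq : p ≤ q) (B : ℝ → ℝ)
    (hB : Integrable B) (hB0 : Filter.Tendsto B Filter.atTop (nhds 0))
    (hB1 : Filter.Tendsto B Filter.atBot (nhds 0))
    (hb : ∀ x ∈ Set.Icc p q, ∀ y : ℝ, ‖f (x + y * Complex.I)‖ ≤ B y) :
    ∫ y : ℝ, f (q + y * Complex.I) = ∫ y : ℝ, f (p + y * Complex.I) := by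
  have hInteg : ∀ x ∈ Set.Icc p q, Integrable (fun y : ℝ => f (x + y * Complex.I)) := by
    intro x hx
    refine hB.mono' ?_ (Filter.Eventually.of_forall (hb x hx))
    exact (hf.continuous.comp (by fun_prop)).aestronglyMeasurable
  have key : ∀ N : ℝ, (∫ y in (-N)..N, f (q + y * Complex.I)) - (∫ y in (-N)..N, f (p + y * Complex.I))
      = Complex.I * ((∫ x in p..q, f (x + (-N : ℝ) * Complex.I)) - ∫ x in p..q, f (x + (N : ℝ) * Complex.I)) := by
    intro N
    have := Complex.integral_boundary_rect_eq_zero_of_differentiableOn f (p + (-N : ℝ) * Complex.I)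
      (q + (N : ℝ) * Complex.I) hf.differentiableOn
    simp only [Complex.add_re, Complex.add_im, Complex.ofReal_re, Complex.ofReal_im, Complex.mul_re,
      Complex.mul_im, Complex.I_re, Complex.I_im, mul_zero, mul_one, sub_zero, add_zero, zero_add,
      smul_eq_mul] at this
    linear_combination (-Complex.I) * this + ((∫ y in (-N)..N, f (q + y * Complex.I)) - (∫ y in (-N)..N, f (p + y * Complex.I))) * Complex.I_mul_I
  have hlim : Filter.Tendsto (fun N : ℝ => (∫ y in (-N)..N, f (q + y * Complex.I)) -
      (∫ y in (-N)..N, f (p + y * Complex.I))) Filter.atTop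
      (nhds ((∫ y : ℝ, f (q + y * Complex.I)) - ∫ y : ℝ, f (p + y * Complex.I))) :=
    (intervalIntegral_tendsto_integral (hInteg q ⟨hpq, le_rfl⟩) Filter.tendsto_neg_atTop_atBot
      Filter.tendsto_id).sub
    (intervalIntegral_tendsto_integral (hInteg p ⟨le_rfl, hpq⟩) Filter.tendsto_neg_atTop_atBot
      Filter.tendsto_id)
  have hbd : ∀ N : ℝ, ‖∫ x in p..q, f (x + (N : ℝ) * Complex.I)‖ ≤ B N * |q - p| := by
    intro N
    refine intervalIntegral.norm_integral_le_of_norm_le_const ?_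
    intro x hx
    rw [Set.uIoc_of_le hpq] at hx
    exact hb x ⟨hx.1.le, hx.2⟩ N
  have z1 : Filter.Tendsto (fun N : ℝ => ∫ x in p..q, f (x + (N : ℝ) * Complex.I)) Filter.atTop (nhds 0) :=
    squeeze_zero_norm hbd (by simpa using hB0.mul_const |q - p|)
  have z2 : Filter.Tendsto (fun N : ℝ => ∫ x in p..q, f (x + (-N : ℝ) * Complex.I)) Filter.atTop (nhds 0) := by
    refine squeeze_zero_norm (fun N => ?_)
      (by simpa using (hB1.comp Filter.tendsto_neg_atTop_atBot).mul_const |q - p|)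
    simpa using hbd (-N)
  have hlim2 := (z2.sub z1).const_mul Complex.I
  simp only [sub_zero, mul_zero] at hlim2
  have := tendsto_nhds_unique (hlim.congr (fun N => (key N))) (by simpa using hlim2)
  exact sub_eq_zero.1 this

/-- Fubini with a Gaussian kernel. -/
lemma gauss_fubini (φ : ℝ → ℝ) (R : ℂ → ℂ) (c : ℝ)
    (hφ : Integrable (fun w : ℝ => Real.exp (-c * w) * φ w) (volume.restrict (Set.Ioi 0)))
    (hR : ∀ t : ℝ, R (c + t * Complex.I) =
      ∫ w in Set.Ioi (0:ℝ), (φ w : ℂ) * Complex.exp (-(c + t * Complex.I) * w))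
    (L η : ℝ) (hη : 0 < η) :
    ∫ t : ℝ, Complex.exp ((η:ℂ)^2 / 2 * (c + t * Complex.I)^2 + L * (c + t * Complex.I)) * R (c + t * Complex.I)
     = ((√(2 * π) / η * ∫ w in Set.Ioi (0:ℝ), φ w * Real.exp (-(L - w)^2 / (2 * η^2)) : ℝ) : ℂ) := by
  have hη' : (η : ℂ) ≠ 0 := by exact_mod_cast hη.ne'
  simp_rw [hR]
  simp_rw [show ∀ t : ℝ, Complex.exp ((η:ℂ)^2 / 2 * (c + t * Complex.I)^2 + L * (c + t * Complex.I)) *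
      (∫ w in Set.Ioi (0:ℝ), (φ w : ℂ) * Complex.exp (-(c + t * Complex.I) * w)) =
      ∫ w in Set.Ioi (0:ℝ), Complex.exp ((η:ℂ)^2 / 2 * (c + t * Complex.I)^2 + L * (c + t * Complex.I)) *
        ((φ w : ℂ) * Complex.exp (-(c + t * Complex.I) * w)) from
    fun t => (integral_const_mul _ _).symm]
  rw [integral_integral_swap]
  · rw [← integral_const_mul, ← integral_complex_ofReal]
    refine integral_congr_ae (Filter.Eventually.of_forall fun w => ?_)
    simp only
    have e : ∀ t : ℝ, Complex.exp ((η:ℂ)^2 / 2 * (c + t * Complex.I)^2 + L * (c + t * Complex.I)) *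
        ((φ w : ℂ) * Complex.exp (-(c + t * Complex.I) * w)) = (φ w : ℂ) *
        Complex.exp (-(η:ℂ)^2 / 2 * (t:ℂ) ^ 2 + (Complex.I * (η^2 * c + (L - w))) * t +
          (η^2 / 2 * c^2 + c * (L - w))) := by
      intro t
      rw [mul_left_comm, ← Complex.exp_add]
      congr 2
      linear_combination ((η:ℂ)^2 / 2 * t^2) * Complex.I_sq
    simp_rw [e]
    rw [integral_const_mul, integral_cexp_quadratic (by
      rw [show -(η:ℂ)^2/2 = ((-η^2/2 : ℝ) : ℂ) by push_cast; ring, Complex.ofReal_re]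
      have : 0 < η^2 := by positivity
      linarith)]
    have e1 : ((π:ℂ) / -(-(η:ℂ)^2 / 2)) ^ (1 / 2 : ℂ) = ((√(2 * π) / η : ℝ) : ℂ) := by
      rw [show (π:ℂ) / -(-(η:ℂ)^2 / 2) = ((2 * π / η^2 : ℝ) : ℂ) by push_cast; field_simp,
        show (1 / 2 : ℂ) = ((1 / 2 : ℝ) : ℂ) by push_cast; rfl,
        ← Complex.ofReal_cpow (by positivity), ← Real.sqrt_eq_rpow, Real.sqrt_div (by positivity),
        Real.sqrt_sq hη.le]
    have e2 : ((η:ℂ)^2 / 2 * c^2 + c * (L - w)) - (Complex.I * (η^2 * c + (L - w)))^2 / (4 * (-(η:ℂ)^2 / 2))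
        = ((-(L - w)^2 / (2 * η^2) : ℝ) : ℂ) := by
      push_cast
      rw [mul_pow, Complex.I_sq]
      field_simp
      ring
    rw [e1, e2, ← Complex.ofReal_exp]
    push_cast
    ring
  · have hG : Integrable (fun t : ℝ => Complex.exp ((η:ℂ)^2 / 2 * (c + t * Complex.I)^2 + L * (c + t * Complex.I))) := by
      have h0 : Integrable (fun t : ℝ => Complex.exp (-((η:ℂ)^2/2) * t^2 + (Complex.I * (η^2 * c + L)) * t + (η^2/2 * c^2 + L * c))) := by
        apply integrable_cexp_quadratic
        rw [show (η:ℂ)^2/2 = ((η^2/2 : ℝ) : ℂ) by push_cast; ring, Complex.ofReal_re]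
        positivity
      refine h0.congr (Filter.Eventually.of_forall fun t => ?_)
      simp only
      congr 1
      linear_combination (-(η:ℂ)^2 / 2 * t^2) * Complex.I_sq
    have hP0 : Integrable (fun w : ℝ => ((Real.exp (-c * w) * φ w : ℝ) : ℂ))
        (volume.restrict (Set.Ioi 0)) := hφ.ofReal
    have hP := hG.mul_prod hP0
    have hu : Continuous (fun z : ℝ × ℝ => Complex.exp (-(z.1 * Complex.I) * z.2)) := by fun_prop
    refine (hP.mul_bdd (c := 1) hu.aestronglyMeasurable ?_).congr ?_
    · refine Filter.Eventually.of_forall fun z => ?_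
      rw [Complex.norm_exp]; simp
    · refine Filter.Eventually.of_forall fun z => ?_
      simp only [Function.uncurry]
      push_cast
      rw [mul_assoc, mul_right_comm _ (φ z.2 : ℂ), ← Complex.exp_add]
      rw [mul_comm (φ z.2 : ℂ)]
      congr 3
      push_cast
      ring

lemma pow_gauss_bound (η y : ℝ) (hη : 0 < η) (hη1 : η ≤ 1) :
    (1 + |y|)^6 * Real.exp (-η^2 * y^2 / 2) ≤ 720 * Real.exp 2 / η^6 * Real.exp (-(η^2/4) * y^2) := by
  have hy := abs_nonneg y
  have h1 : (η * (1 + |y|))^6 ≤ 720 * Real.exp (1 + η * |y|) := by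
    have h0 : η * (1 + |y|) ≤ 1 + η * |y| := by nlinarith
    have h2 := Real.pow_div_factorial_le_exp (1 + η * |y|) (by positivity) 6
    rw [div_le_iff₀ (by positivity)] at h2
    calc (η * (1 + |y|))^6 ≤ (1 + η * |y|)^6 := by gcongr
      _ ≤ _ := h2
      _ = _ := by norm_num [Nat.factorial]; ring
  have h3 : Real.exp (1 + η * |y|) * Real.exp (-η^2 * y^2 / 2) ≤ Real.exp 2 * Real.exp (-(η^2/4) * y^2) := by
    rw [← Real.exp_add, ← Real.exp_add]
    apply Real.exp_le_exp.2
    nlinarith [sq_nonneg (η * |y| / 2 - 1), sq_abs y]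
  rw [div_mul_eq_mul_div, le_div_iff₀ (by positivity)]
  calc _ = (η * (1 + |y|))^6 * Real.exp (-η^2 * y^2 / 2) := by ring
    _ ≤ 720 * Real.exp (1 + η * |y|) * Real.exp (-η^2 * y^2 / 2) := by gcongr
    _ ≤ _ := by rw [mul_assoc, mul_assoc]; gcongr

lemma smooth_bound (φ : ℝ → ℝ) (R : ℂ → ℂ) (c σ C : ℝ) (hσ : 0 < σ) (hc : 0 < c) (hC : 0 < C)
    (hφ : Integrable (fun w : ℝ => Real.exp (-c * w) * φ w) (volume.restrict (Set.Ioi 0)))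
    (hR : ∀ t : ℝ, R (c + t * Complex.I) =
      ∫ w in Set.Ioi (0:ℝ), (φ w : ℂ) * Complex.exp (-(c + t * Complex.I) * w))
    (hRd : Differentiable ℂ R)
    (hRb : ∀ x ∈ Set.Icc (-σ) c, ∀ y : ℝ, ‖R (x + y * Complex.I)‖ ≤ C * (1 + |y|)^6) :
    ∃ K : ℝ, 0 < K ∧ ∀ L η : ℝ, 0 < η → η ≤ 1 →
      |∫ w in Set.Ioi (0:ℝ), φ w * Real.exp (-(L - w)^2 / (2 * η^2))| ≤ K * Real.exp (-σ * L) / η^6 := by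
  refine ⟨Real.exp (σ^2/2) * C * (720 * Real.exp 2) * 2, by positivity, ?_⟩
  intro L η hη hη1
  set f : ℂ → ℂ := fun s => Complex.exp ((η:ℂ)^2 / 2 * s^2 + L * s) * R s with hf
  have hfd : Differentiable ℂ f := by
    have : Differentiable ℂ (fun s : ℂ => Complex.exp ((η:ℂ)^2 / 2 * s^2 + L * s)) := by fun_prop
    exact this.mul hRd
  have hfb : ∀ x ∈ Set.Icc (-σ) c, ∀ y : ℝ, ‖f (x + y * Complex.I)‖ ≤
      Real.exp (η^2/2 * x^2 + L * x) * C * (720 * Real.exp 2 / η^6 * Real.exp (-(η^2/4) * y^2)) := by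
    intro x hx y
    have e : ‖Complex.exp ((η:ℂ)^2 / 2 * (x + y * Complex.I)^2 + L * (x + y * Complex.I))‖
        = Real.exp (η^2/2 * x^2 + L * x) * Real.exp (-η^2 * y^2 / 2) := by
      rw [Complex.norm_exp, ← Real.exp_add]
      congr 1
      have : ((η:ℂ)^2 / 2 * (x + y * Complex.I)^2 + L * (x + y * Complex.I))
        = ((η^2/2 * x^2 + L * x + -η^2 * y^2 / 2 : ℝ) : ℂ) + ((η^2 * x * y + L * y : ℝ) : ℂ) * Complex.I := by
        push_cast
        linear_combination ((η:ℂ)^2/2 * y^2) * Complex.I_sq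
      rw [this]
      simp only [Complex.add_re, Complex.ofReal_re, Complex.re_ofReal_mul, Complex.I_re, mul_zero, add_zero]
    simp only [hf]
    rw [norm_mul, e]
    calc _ ≤ Real.exp (η^2/2 * x^2 + L * x) * Real.exp (-η^2 * y^2 / 2) * (C * (1 + |y|)^6) := by
          gcongr; exact hRb x hx y
      _ = Real.exp (η^2/2 * x^2 + L * x) * C * ((1 + |y|)^6 * Real.exp (-η^2 * y^2 / 2)) := by ring
      _ ≤ _ := by
          have := pow_gauss_bound η y hη hη1
          gcongr
  have hgi : Integrable (fun y : ℝ => Real.exp (-(η^2/4) * y^2)) :=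
    integrable_exp_neg_mul_sq (by positivity)
  set M : ℝ := σ + c
  set A : ℝ := Real.exp (η^2/2 * M^2 + |L| * M) * C * (720 * Real.exp 2 / η^6) with hA
  have hAb : ∀ x ∈ Set.Icc (-σ) c, ∀ y : ℝ, ‖f (x + y * Complex.I)‖ ≤ A * Real.exp (-(η^2/4) * y^2) := by
    intro x hx y
    refine (hfb x hx y).trans ?_
    have hxM : |x| ≤ M := abs_le.2 ⟨by simp only [M]; linarith [hx.1], by simp only [M]; linarith [hx.2]⟩
    have h1 : x^2 ≤ M^2 := by rw [← sq_abs x]; gcongr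
    have h2 : L * x ≤ |L| * M := by
      calc L * x ≤ |L * x| := le_abs_self _
        _ = |L| * |x| := abs_mul _ _
        _ ≤ _ := by gcongr
    rw [hA, mul_assoc _ (720 * Real.exp 2 / η^6)]
    gcongr
  have htz : Filter.Tendsto (fun y : ℝ => A * Real.exp (-(η^2/4) * y^2)) Filter.atTop (nhds 0) := by
    have h : Filter.Tendsto (fun y : ℝ => (η^2/4) * y^2) Filter.atTop Filter.atTop :=
      (Filter.tendsto_pow_atTop (by norm_num)).const_mul_atTop (by positivity)
    have := (Real.tendsto_exp_neg_atTop_nhds_zero.comp h).const_mul A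
    simpa [Function.comp_def, neg_mul] using this
  have htz' : Filter.Tendsto (fun y : ℝ => A * Real.exp (-(η^2/4) * y^2)) Filter.atBot (nhds 0) := by
    have := htz.comp Filter.tendsto_neg_atBot_atTop
    simpa [Function.comp_def] using this
  have hshift := contour_shift f hfd (-σ) c (by linarith) _ (hgi.const_mul A) htz htz' hAb
  have hfub := gauss_fubini φ R c hφ hR L η hη
  set I := ∫ w in Set.Ioi (0:ℝ), φ w * Real.exp (-(L - w)^2 / (2 * η^2))
  have h1 : ‖∫ y : ℝ, f (((-σ : ℝ) : ℂ) + y * Complex.I)‖ ≤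
      Real.exp (η^2/2 * σ^2 - L * σ) * C * (720 * Real.exp 2 / η^6) * √(π / (η^2/4)) := by
    have hle := norm_integral_le_of_norm_le (hgi.const_mul
      (Real.exp (η^2/2 * (-σ)^2 + L * (-σ)) * C * (720 * Real.exp 2 / η^6)))
      (Filter.Eventually.of_forall (fun y => by
        rw [mul_assoc _ (720 * Real.exp 2 / η^6)]
        exact hfb (-σ) ⟨le_rfl, by linarith⟩ y))
    rw [integral_const_mul, integral_gaussian] at hle
    refine hle.trans (le_of_eq ?_)
    congr 4
    ring_nf
  rw [← hshift] at h1
  simp only [hf] at h1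
  rw [hfub, Complex.norm_real, Real.norm_eq_abs, abs_mul, abs_of_pos (by positivity)] at h1
  have hs : √(π / (η^2/4)) = 2 * √π / η := by
    rw [show π / (η^2/4) = (2/η)^2 * π by field_simp; ring, Real.sqrt_mul (by positivity),
      Real.sqrt_sq (by positivity)]
    ring
  have hs2 : √(2 * π) = √2 * √π := Real.sqrt_mul (by norm_num) _
  have hs3 : 1 ≤ √2 := by rw [Real.one_le_sqrt]; norm_num
  have hpi : 0 < √π := Real.sqrt_pos.2 Real.pi_pos
  rw [hs, hs2] at h1
  have hexp : Real.exp (η^2/2 * σ^2 - L * σ) ≤ Real.exp (σ^2/2) * Real.exp (-σ * L) := by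
    rw [← Real.exp_add]
    apply Real.exp_le_exp.2
    have : η^2 ≤ 1 := pow_le_one₀ hη.le hη1
    nlinarith [sq_nonneg σ]
  have h2 : √π / η * |I| ≤ √π / η * (Real.exp (σ^2/2) * C * (720 * Real.exp 2) * 2 * Real.exp (-σ * L) / η^6) := by
    calc √π / η * |I| ≤ √2 * √π / η * |I| := by
          gcongr
          nlinarith
      _ ≤ _ := h1
      _ ≤ Real.exp (σ^2/2) * Real.exp (-σ * L) * C * (720 * Real.exp 2 / η^6) * (2 * √π / η) := by gcongr
      _ = _ := by ring
  exact le_of_mul_le_mul_left h2 (by positivity)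

lemma Zent_zero : Zent 0 = 1 / 2 := by
  rw [Zent_ne (by norm_num), riemannZeta_zero]; norm_num

lemma phi_smooth {a b : ℝ} (ha : 1 ≤ a) (hab : a < b) :
    ∃ K : ℝ, 0 < K ∧ ∀ L η : ℝ, 0 < η → η ≤ 1 →
      |∫ w in Set.Ioi (0:ℝ), phi a b w * Real.exp (-(L - w)^2 / (2 * η^2))|
        ≤ K * Real.exp (-(1 / (2 * b)) * L) / η^6 := by
  have ha0 : 0 < a := by linarith
  have hb0 : 0 < b := by linarith
  have hb : 1 ≤ b := by linarith
  obtain ⟨C, hC, hZ⟩ := Zent_bound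
  set f : ℂ → ℂ := fun s => Zent (a * s) * Zent (b * s) / (a * b) with hf
  have hfd : Differentiable ℂ f := by
    have h := Zent_diff
    have h1 : Differentiable ℂ (fun s : ℂ => Zent (a * s)) := h.comp (by fun_prop)
    have h2 : Differentiable ℂ (fun s : ℂ => Zent (b * s)) := h.comp (by fun_prop)
    exact (h1.mul h2).div_const _
  have hfb : ∀ x ∈ Set.Icc (-(1 / (2 * b))) 3, ∀ y : ℝ,
      ‖f (x + y * Complex.I)‖ ≤ (C^2 * (4 * b)^6) * (1 + |y|)^6 := by
    intro x hx y
    have hz : ∀ c : ℝ, 1 ≤ c → c ≤ b → ‖Zent (c * (x + y * Complex.I))‖ ≤ C * (4 * b)^3 * (1 + |y|)^3 := by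
      intro c hc hcb
      have hx3 : |x| ≤ 3 := by
        rw [abs_le]
        refine ⟨?_, hx.2⟩
        have : 1 / (2 * b) ≤ 1 := by rw [div_le_one (by linarith)]; linarith
        linarith [hx.1]
      have hn : ‖(c:ℂ) * (x + y * Complex.I)‖ ≤ b * (3 + |y|) := by
        rw [norm_mul, Complex.norm_real, Real.norm_eq_abs, abs_of_pos (by linarith)]
        have : ‖(x:ℂ) + y * Complex.I‖ ≤ 3 + |y| := by
          refine (norm_add_le _ _).trans ?_
          simp only [norm_mul, Complex.norm_real, Complex.norm_I, Real.norm_eq_abs, mul_one]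
          linarith
        gcongr
      refine (hZ _ ?_).trans ?_
      · have e : ((c:ℂ) * (x + y * Complex.I)).re = c * x := by simp
        rw [e]
        have h2 : -(1/2) ≤ c * (-(1 / (2 * b))) := by
          rw [mul_neg, neg_le_neg_iff, mul_one_div, div_le_div_iff₀ (by linarith) (by norm_num)]
          linarith
        have h3 : c * (-(1 / (2 * b))) ≤ c * x := mul_le_mul_of_nonneg_left hx.1 (by linarith)
        linarith
      · rw [mul_assoc, ← mul_pow]
        have hy := abs_nonneg y
        have : 1 + ‖(c:ℂ) * (x + y * Complex.I)‖ ≤ 4 * b * (1 + |y|) := by nlinarith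
        gcongr
    rw [hf]
    simp only [norm_div, norm_mul, Complex.norm_real, Real.norm_eq_abs, abs_of_pos ha0, abs_of_pos hb0]
    have h1 := hz a ha hab.le
    have h2 := hz b hb le_rfl
    have hab1 : 1 ≤ a * b := by nlinarith
    calc _ ≤ ‖Zent (a * (x + y * Complex.I))‖ * ‖Zent (b * (x + y * Complex.I))‖ :=
          div_le_self (by positivity) hab1
      _ ≤ (C * (4 * b)^3 * (1 + |y|)^3) * (C * (4 * b)^3 * (1 + |y|)^3) := by gcongr
      _ = _ := by ring
  have hqa : 0 < 1 / a := by positivity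
  have hqb : 0 < 1 / b := by positivity
  have hqab : 1 / b < 1 / a := one_div_lt_one_div_of_lt ha0 hab
  obtain ⟨R, hRd, hRf, C', hC', hRb⟩ := divdiff f hfd 0 (1 / a) (1 / b) hqa.ne hqb.ne hqab.ne'
    (-(1 / (2 * b))) 3 (C^2 * (4 * b)^6) (by positivity) hfb
  have hac : (a:ℂ) ≠ 0 := by exact_mod_cast ha0.ne'
  have hbc : (b:ℂ) ≠ 0 := by exact_mod_cast hb0.ne'
  have hbac : (b:ℂ) - a ≠ 0 := by rw [sub_ne_zero]; exact_mod_cast hab.ne'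
  have hba2 : (a:ℂ) - b ≠ 0 := by rw [sub_ne_zero]; exact_mod_cast hab.ne
  have := smooth_bound (phi a b) R 3 (1 / (2 * b)) C' (by positivity) (by norm_num) hC'
    (phi_integrable ha hb) ?_ hRd (by exact_mod_cast hRb)
  · exact this
  · intro t
    set s : ℂ := ((3:ℝ):ℂ) + t * Complex.I with hs
    have hsre : s.re = 3 := by simp [hs]
    have hne : ∀ u : ℝ, u ≤ 1 → s ≠ u := by
      intro u hu h
      rw [h, Complex.ofReal_re] at hsre; linarith
    have hle : ∀ c : ℝ, 1 ≤ c → 1 / c ≤ 1 := by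
      intro c hc; rw [div_le_one (by linarith)]; exact hc
    have hcs : ∀ c : ℝ, 1 ≤ c → (c:ℂ) * s ≠ 1 := by
      intro c hc h
      have : ((c:ℂ) * s).re = 1 := by rw [h]; simp
      rw [Complex.re_ofReal_mul, hsre] at this
      linarith
    rw [laplace_phi ha hb s (by rw [hsre]; norm_num), hRf s (hne 0 (by norm_num)) (hne _ (hle a ha)) (hne _ (hle b hb))]
    have f0 : f ((0:ℝ):ℂ) = 1 / 4 / (a * b) := by
      simp only [hf, Complex.ofReal_zero, mul_zero, Zent_zero]; norm_num
    have f1 : f ((1 / a : ℝ):ℂ) = ((b:ℂ) / a - 1) * riemannZeta ((b / a : ℝ) : ℂ) / (a * b) := by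
      have e1 : (a:ℂ) * ((1 / a : ℝ):ℂ) = 1 := by push_cast; field_simp
      have e2 : (b:ℂ) * ((1 / a : ℝ):ℂ) = ((b / a : ℝ) : ℂ) := by push_cast; field_simp
      have n : ((b / a : ℝ) : ℂ) ≠ 1 := by
        have : b / a ≠ 1 := by rw [Ne, div_eq_one_iff_eq ha0.ne']; exact hab.ne'
        exact_mod_cast this
      simp only [hf]
      rw [e1, e2, Zent_one, Zent_ne n, one_mul]
      push_cast; rfl
    have f2 : f ((1 / b : ℝ):ℂ) = ((a:ℂ) / b - 1) * riemannZeta ((a / b : ℝ) : ℂ) / (a * b) := by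
      have e1 : (b:ℂ) * ((1 / b : ℝ):ℂ) = 1 := by push_cast; field_simp
      have e2 : (a:ℂ) * ((1 / b : ℝ):ℂ) = ((a / b : ℝ) : ℂ) := by push_cast; field_simp
      have n : ((a / b : ℝ) : ℂ) ≠ 1 := by
        have : a / b ≠ 1 := by rw [Ne, div_eq_one_iff_eq hb0.ne']; exact hab.ne
        exact_mod_cast this
      simp only [hf]
      rw [e1, e2, Zent_one, Zent_ne n, mul_one]
      push_cast; rfl
    rw [f0, f1, f2]
    simp only [hf]
    rw [Zent_ne (hcs a ha), Zent_ne (hcs b hb)]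
    generalize riemannZeta ((b / a : ℝ) : ℂ) = z1
    generalize riemannZeta ((a / b : ℝ) : ℂ) = z2
    generalize riemannZeta (a * s) = y1
    generalize riemannZeta (b * s) = y2
    have k0 : s ≠ 0 := by have := hne 0 (by norm_num); simpa using this
    have k1 : (a:ℂ) * s - 1 ≠ 0 := sub_ne_zero.2 (hcs a ha)
    have k2 : (b:ℂ) * s - 1 ≠ 0 := sub_ne_zero.2 (hcs b hb)
    have k3 : s - ((1 / a : ℝ):ℂ) = (a * s - 1) / a := by push_cast; field_simp
    have k4 : s - ((1 / b : ℝ):ℂ) = (b * s - 1) / b := by push_cast; field_simp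
    have k5 : ((1 / a : ℝ):ℂ) - ((1 / b : ℝ):ℂ) = (b - a) / (a * b) := by push_cast; field_simp
    have k6 : ((1 / b : ℝ):ℂ) - ((1 / a : ℝ):ℂ) = (a - b) / (a * b) := by push_cast; field_simp
    have k7 : (b:ℂ) / a - 1 = (b - a) / a := by field_simp
    have k8 : (a:ℂ) / b - 1 = (a - b) / b := by field_simp
    rw [k3, k4, k5, k6, k7, k8]
    push_cast
    simp only [sub_zero, zero_sub]
    set u := (a:ℂ) * s - 1
    set v := (b:ℂ) * s - 1
    set d := (b:ℂ) - a
    set d' := (a:ℂ) - b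
    field_simp
    ring

lemma gauss_lin_integrable : Integrable (fun v : ℝ => Real.exp (2 * v - v^2 / 4)) := by
  have h := (integrable_exp_neg_mul_sq (b := 1/4) (by norm_num)).comp_sub_right 4
  have h2 := h.const_mul (Real.exp 4)
  refine h2.congr (Filter.Eventually.of_forall fun v => ?_)
  simp only
  rw [← Real.exp_add]; congr 1; ring

lemma phi_tail {a b : ℝ} (ha : 1 ≤ a) (hb : 1 ≤ b) :
    ∃ C : ℝ, 0 < C ∧ ∀ L η κ : ℝ, 0 < η → η ≤ 1 → 0 < κ → κ^2 = η → κ ≤ L →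
      IntervalIntegrable (fun w => phi a b w * Real.exp (-(L - w)^2 / (2 * η^2))) volume (L - κ) (L + κ) ∧
      |(∫ w in Set.Ioi (0:ℝ), phi a b w * Real.exp (-(L - w)^2 / (2 * η^2)))
        - ∫ w in (L - κ)..(L + κ), phi a b w * Real.exp (-(L - w)^2 / (2 * η^2))|
        ≤ C * Real.exp (2 * L) * Real.exp (-(1 / (4 * η))) := by
  obtain ⟨C, hC, hφ⟩ := phi_bound ha hb
  set G := ∫ v : ℝ, Real.exp (2 * v - v^2 / 4) with hG
  have hG0 : 0 ≤ G := integral_nonneg fun v => (Real.exp_pos _).le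
  refine ⟨C * (G + 1), by positivity, ?_⟩
  intro L η κ hη hη1 hκ hκη hκL
  set F : ℝ → ℝ := fun w => phi a b w * Real.exp (-(L - w)^2 / (2 * η^2)) with hF
  have hmeas : Measurable F := by
    have := phi_measurable ha hb
    fun_prop
  have hη2 : η^2 ≤ 1 := by nlinarith
  have hgi : Integrable (fun w : ℝ => Real.exp (2 * (w - L) - (w - L)^2 / 4)) :=
    gauss_lin_integrable.comp_sub_right L
  have hb1 : ∀ w : ℝ, 0 ≤ w → |F w| ≤ C * Real.exp (2 * L) * Real.exp (2 * (w - L) - (w - L)^2 / 4) := by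
    intro w hw
    rw [hF]
    simp only
    rw [abs_mul, abs_of_pos (Real.exp_pos _)]
    have e : Real.exp (-(L - w)^2 / (2 * η^2)) ≤ Real.exp (-(w - L)^2 / 4) := by
      apply Real.exp_le_exp.2
      rw [div_le_div_iff₀ (by positivity) (by norm_num)]
      nlinarith [sq_nonneg (L - w), mul_nonneg (sq_nonneg (L-w)) (sub_nonneg.2 hη2)]
    calc _ ≤ (C * Real.exp (2 * w)) * Real.exp (-(w - L)^2 / 4) := by
          gcongr
          exact hφ w hw
      _ = _ := by
          rw [mul_assoc, mul_assoc, ← Real.exp_add, ← Real.exp_add]; congr 2; ring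
  have hFi : IntegrableOn F (Set.Ioi 0) := by
    refine Integrable.mono' (hgi.const_mul (C * Real.exp (2 * L))).integrableOn hmeas.aestronglyMeasurable ?_
    filter_upwards [ae_restrict_mem measurableSet_Ioi] with w hw
    exact hb1 w (le_of_lt hw)
  have hsub : Set.Ioc (L - κ) (L + κ) ⊆ Set.Ioi 0 := fun w hw => lt_of_le_of_lt (by linarith) hw.1
  have hle : L - κ ≤ L + κ := by linarith
  refine ⟨(intervalIntegrable_iff_integrableOn_Ioc_of_le hle).2 (hFi.mono_set hsub), ?_⟩
  rw [intervalIntegral.integral_of_le hle, ← setIntegral_sdiff measurableSet_Ioc hFi hsub]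
  have hbd : ∀ w ∈ Set.Ioi (0:ℝ) \ Set.Ioc (L - κ) (L + κ), ‖F w‖ ≤
      C * Real.exp (2 * L) * Real.exp (-(1 / (4 * η))) * Real.exp (2 * (w - L) - (w - L)^2 / 4) := by
    intro w hw
    have hw0 : 0 < w := hw.1
    have hout : κ^2 ≤ (w - L)^2 := by
      rcases le_or_gt w (L - κ) with h | h
      · nlinarith
      · have : L + κ < w := by
          by_contra h'
          exact hw.2 ⟨h, not_lt.1 h'⟩
        nlinarith
    rw [hF, Real.norm_eq_abs]
    simp only
    rw [abs_mul, abs_of_pos (Real.exp_pos _)]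
    have e : Real.exp (-(L - w)^2 / (2 * η^2)) ≤ Real.exp (-(1 / (4 * η)) + -(w - L)^2 / 4) := by
      apply Real.exp_le_exp.2
      have e1 : 1 / (4 * η) ≤ (w - L)^2 / (4 * η^2) := by
        rw [div_le_div_iff₀ (by positivity) (by positivity)]
        have : η * η ≤ η * (w-L)^2 := mul_le_mul_of_nonneg_left (by linarith) hη.le
        nlinarith
      have e2 : (w - L)^2 / 4 ≤ (w - L)^2 / (4 * η^2) := by
        apply div_le_div_of_nonneg_left (sq_nonneg _) (by positivity) (by linarith)
      have e3 : -(L - w)^2 / (2 * η^2) = -((w - L)^2 / (4 * η^2)) - ((w - L)^2 / (4 * η^2)) := by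
        field_simp; ring
      rw [e3]; linarith [neg_div 4 ((w-L)^2)]
    calc _ ≤ (C * Real.exp (2 * w)) * Real.exp (-(1 / (4 * η)) + -(w - L)^2 / 4) := by
          gcongr
          exact hφ w hw0.le
      _ = _ := by
          rw [mul_assoc, mul_assoc, mul_assoc, ← Real.exp_add, ← Real.exp_add, ← Real.exp_add]; congr 2; ring
  have hi2 := (hgi.const_mul (C * Real.exp (2 * L) * Real.exp (-(1 / (4 * η)))))
  have hms : MeasurableSet (Set.Ioi (0:ℝ) \ Set.Ioc (L - κ) (L + κ)) := measurableSet_Ioi.diff measurableSet_Ioc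
  calc _ ≤ ∫ w in Set.Ioi (0:ℝ) \ Set.Ioc (L - κ) (L + κ),
        C * Real.exp (2 * L) * Real.exp (-(1 / (4 * η))) * Real.exp (2 * (w - L) - (w - L)^2 / 4) := by
        rw [← Real.norm_eq_abs]
        apply norm_integral_le_of_norm_le hi2.integrableOn
        filter_upwards [ae_restrict_mem hms] with w hw
        exact hbd w hw
    _ ≤ ∫ w, C * Real.exp (2 * L) * Real.exp (-(1 / (4 * η))) * Real.exp (2 * (w - L) - (w - L)^2 / 4) := by
        apply setIntegral_le_integral hi2
        exact Filter.Eventually.of_forall fun w => by positivity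
    _ = C * Real.exp (2 * L) * Real.exp (-(1 / (4 * η))) * G := by
        rw [integral_const_mul, integral_sub_right_eq_self (fun v => Real.exp (2 * v - v^2 / 4)) L]
    _ ≤ _ := by
        have : 0 < C * Real.exp (2 * L) * Real.exp (-(1 / (4 * η))) := by positivity
        nlinarith

noncomputable def sawf (u : ℝ) : ℝ := Int.fract (-u) - Int.fract (-u)^4 - 3 / 10

lemma sawf_cont : Continuous sawf := by
  have h : Continuous ((fun v : ℝ => v - v^4 - 3/10) ∘ Int.fract) :=
    ContinuousOn.comp_fract'' (by fun_prop) (by norm_num)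
  exact h.comp continuous_neg

lemma sawf_per : Function.Periodic sawf 1 := by
  intro u
  unfold sawf
  have : Int.fract (-(u + 1)) = Int.fract (-u) := by
    rw [neg_add, ← sub_eq_add_neg]; exact Int.fract_sub_one _
  rw [this]

lemma sawf_int : ∫ u in (0:ℝ)..1, sawf u = 0 := by
  have e : ∫ u in (0:ℝ)..1, sawf u = ∫ u in (0:ℝ)..1, ((1 - u) - (1 - u)^4 - 3/10) := by
    rw [intervalIntegral.integral_of_le zero_le_one, intervalIntegral.integral_of_le zero_le_one,
      integral_Ioc_eq_integral_Ioo, integral_Ioc_eq_integral_Ioo]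
    refine setIntegral_congr_fun measurableSet_Ioo fun u hu => ?_
    have : Int.fract (-u) = 1 - u := by
      rw [Int.fract_eq_iff]
      exact ⟨by linarith [hu.2], by linarith [hu.1], -1, by push_cast; ring⟩
    simp only [sawf, this]
  rw [e, intervalIntegral.integral_comp_sub_left (fun v : ℝ => v - v^4 - 3/10) 1]
  rw [intervalIntegral.integral_sub (Continuous.intervalIntegrable (by fun_prop) _ _)
      (Continuous.intervalIntegrable (by fun_prop) _ _),
    intervalIntegral.integral_sub (Continuous.intervalIntegrable (by fun_prop) _ _)
      (Continuous.intervalIntegrable (by fun_prop) _ _)]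
  simp
  norm_num

lemma sawf_prim : ∃ (Q : ℝ → ℝ) (B : ℝ), 0 < B ∧ (∀ u, HasDerivAt Q (sawf u) u) ∧ ∀ u, |Q u| ≤ B := by
  set Q : ℝ → ℝ := fun u => ∫ v in (0:ℝ)..u, sawf v with hQ
  have hd : ∀ u, HasDerivAt Q (sawf u) u := fun u =>
    intervalIntegral.integral_hasDerivAt_right (sawf_cont.intervalIntegrable _ _)
      (sawf_cont.stronglyMeasurableAtFilter _ _) sawf_cont.continuousAt
  have hc : Continuous Q := continuous_iff_continuousAt.2 fun u => (hd u).continuousAt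
  have hp : Function.Periodic Q 1 := by
    intro u
    simp only [hQ]
    rw [← intervalIntegral.integral_add_adjacent_intervals (b := u) (sawf_cont.intervalIntegrable _ _)
      (sawf_cont.intervalIntegrable _ _), sawf_per.intervalIntegral_add_eq u 0, zero_add, sawf_int, add_zero]
  obtain ⟨B, hB⟩ := (isCompact_Icc (a := (0:ℝ)) (b := 1)).exists_bound_of_continuousOn hc.continuousOn
  refine ⟨Q, |B| + 1, by positivity, hd, fun u => ?_⟩
  obtain ⟨y, hy, e⟩ := hp.exists_mem_Ico₀ one_pos u
  rw [e]
  have := hB y ⟨hy.1, hy.2.le⟩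
  rw [Real.norm_eq_abs] at this
  linarith [le_abs_self B]

lemma equidist {a b z1 z2 : ℝ} (ha : 1 ≤ a) (hab : a < b) (hz1 : 0 < z1) :
    ∃ C W : ℝ, 0 < C ∧ ∀ L η κ : ℝ, 0 < η → η ≤ 1 → 0 < κ → κ^2 = η → W ≤ L - κ →
      |∫ w in (L - κ)..(L + κ), sawf (z1 * Real.exp (w / a) + z2 * Real.exp (w / b))
          * Real.exp (-(L - w)^2 / (2 * η^2))| ≤ C * Real.exp (-((L - κ) / a)) / η := by
  obtain ⟨Q, B, hB, hQd, hQb⟩ := sawf_prim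
  have ha0 : 0 < a := by linarith
  have hb0 : 0 < b := by linarith
  set m0 := z1 / (2 * a) with hm0
  have hm : 0 < m0 := by positivity
  set C1 := z1 / a^2 + |z2| / b^2 with hC1
  have hC1p : 0 < C1 := by positivity
  have hgrow : ∃ W : ℝ, 0 ≤ W ∧ ∀ w, W ≤ w → m0 * Real.exp (w / a) ≤ z1 / a * Real.exp (w / a) + z2 / b * Real.exp (w / b) := by
    have hθ : 0 < 1 / a - 1 / b := sub_pos.2 (one_div_lt_one_div_of_lt ha0 hab)
    have ht : Filter.Tendsto (fun w : ℝ => |z2| / b * Real.exp (-(w * (1 / a - 1 / b)))) Filter.atTop (nhds (|z2| / b * 0)) := by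
      apply Filter.Tendsto.const_mul
      exact Real.tendsto_exp_neg_atTop_nhds_zero.comp (Filter.tendsto_id.atTop_mul_const hθ)
    rw [mul_zero] at ht
    obtain ⟨W, hW⟩ := Filter.eventually_atTop.1 (ht.eventually (gt_mem_nhds hm))
    refine ⟨max W 0, le_max_right _ _, fun w hw => ?_⟩
    have h1 := hW w (le_trans (le_max_left _ _) hw)
    have h2 : Real.exp (w / b) = Real.exp (w / a) * Real.exp (-(w * (1 / a - 1 / b))) := by
      rw [← Real.exp_add]; congr 1; ring
    have h3 : z1 / a = 2 * m0 := by rw [hm0]; field_simp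
    rw [h2, h3]
    have h4 : -(|z2| / b) ≤ z2 / b := by
      rw [← neg_div]; exact div_le_div_of_nonneg_right (neg_abs_le z2) hb0.le
    have h5 := mul_le_mul_of_nonneg_right h4 (Real.exp_pos (-(w * (1 / a - 1 / b)))).le
    have h6 := Real.exp_pos (w / a)
    have h7 : 0 ≤ Real.exp (w / a) * (m0 + z2 / b * Real.exp (-(w * (1 / a - 1 / b)))) :=
      mul_nonneg h6.le (by linarith)
    nlinarith
  obtain ⟨W, hW0, hW⟩ := hgrow
  refine ⟨B * (2 / m0 + 2 / m0 + 2 * C1 / m0^2), W, by positivity, ?_⟩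
  intro L η κ hη hη1 hκ hκη hWL
  have hκ1 : κ ≤ 1 := by nlinarith
  set M : ℝ → ℝ := fun w => z1 * Real.exp (w / a) + z2 * Real.exp (w / b) with hM
  set M1 : ℝ → ℝ := fun w => z1 / a * Real.exp (w / a) + z2 / b * Real.exp (w / b) with hM1
  set M2 : ℝ → ℝ := fun w => z1 / a^2 * Real.exp (w / a) + z2 / b^2 * Real.exp (w / b) with hM2
  set g : ℝ → ℝ := fun w => Real.exp (-(L - w)^2 / (2 * η^2)) with hg
  have hed : ∀ c w : ℝ, HasDerivAt (fun w : ℝ => Real.exp (w / c)) (Real.exp (w / c) * (1 / c)) w := fun c w =>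
    ((hasDerivAt_id w).div_const c).exp
  have dM : ∀ w, HasDerivAt M (M1 w) w := by
    intro w
    have := ((hed a w).const_mul z1).add ((hed b w).const_mul z2)
    convert! this using 1
    simp only [hM1]; ring
  have dM1 : ∀ w, HasDerivAt M1 (M2 w) w := by
    intro w
    have := ((hed a w).const_mul (z1 / a)).add ((hed b w).const_mul (z2 / b))
    convert! this using 1
    simp only [hM2]; field_simp
  have dg : ∀ w, HasDerivAt g (g w * ((L - w) / η^2)) w := by
    intro w
    have h1 : HasDerivAt (fun w : ℝ => -(L - w)^2 / (2 * η^2)) ((L - w) / η^2) w := by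
      have := ((((hasDerivAt_id w).const_sub L).pow 2).neg).div_const (2 * η^2)
      convert! this using 1
      simp only [id]; field_simp; norm_num; ring
    exact h1.exp
  set h' : ℝ → ℝ := fun w => (g w * ((L - w) / η^2) * M1 w - g w * M2 w) / (M1 w)^2 with hh'
  have hle : L - κ ≤ L + κ := by linarith
  set E0 := Real.exp ((L - κ) / a) with hE0
  have hE0p : 0 < E0 := Real.exp_pos _
  have hM1low : ∀ w, L - κ ≤ w → m0 * Real.exp (w / a) ≤ M1 w := fun w hw => hW w (by linarith)
  have hM1pos : ∀ w, L - κ ≤ w → 0 < M1 w := fun w hw => lt_of_lt_of_le (by positivity) (hM1low w hw)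
  have hElow : ∀ w, L - κ ≤ w → E0 ≤ Real.exp (w / a) := fun w hw =>
    Real.exp_le_exp.2 (div_le_div_of_nonneg_right hw ha0.le)
  have dh : ∀ w, L - κ ≤ w → HasDerivAt (fun w => g w / M1 w) (h' w) w := fun w hw =>
    (dg w).div (dM1 w) (hM1pos w hw).ne'
  have dF : ∀ w ∈ Set.uIcc (L - κ) (L + κ), HasDerivAt (fun w => Q (M w) * (g w / M1 w))
      (sawf (M w) * g w + Q (M w) * h' w) w := by
    intro w hw
    rw [Set.uIcc_of_le hle] at hw
    have := ((hQd (M w)).comp w (dM w)).mul (dh w hw.1)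
    convert! this using 1
    have := (hM1pos w hw.1).ne'
    simp only [Function.comp]
    field_simp
  have cM : Continuous M := by fun_prop
  have cM1 : Continuous M1 := by fun_prop
  have cM2 : Continuous M2 := by fun_prop
  have cg : Continuous g := by fun_prop
  have cQ : Continuous Q := continuous_iff_continuousAt.2 fun u => (hQd u).continuousAt
  have ch' : ContinuousOn h' (Set.uIcc (L - κ) (L + κ)) := by
    rw [Set.uIcc_of_le hle]
    refine ContinuousOn.div (by fun_prop) (by fun_prop) fun w hw => ?_
    exact pow_ne_zero 2 (hM1pos w hw.1).ne'
  have i1 : IntervalIntegrable (fun w => sawf (M w) * g w) volume (L - κ) (L + κ) :=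
    ((sawf_cont.comp cM).mul cg).intervalIntegrable _ _
  have i2 : IntervalIntegrable (fun w => Q (M w) * h' w) volume (L - κ) (L + κ) :=
    ((cQ.comp cM).continuousOn.mul ch').intervalIntegrable
  have key := intervalIntegral.integral_eq_sub_of_hasDerivAt dF (i1.add i2)
  rw [intervalIntegral.integral_add i1 i2] at key
  have hg1 : ∀ w, g w ≤ 1 := by
    intro w
    apply Real.exp_le_one_iff.2
    rw [neg_div]; exact neg_nonpos.2 (by positivity)
  have hg0 : ∀ w, 0 < g w := fun w => Real.exp_pos _
  have hbdry : ∀ w, L - κ ≤ w → |Q (M w) * (g w / M1 w)| ≤ B * (1 / (m0 * E0)) := by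
    intro w hw
    rw [abs_mul, abs_of_pos (div_pos (hg0 w) (hM1pos w hw))]
    have h1 : m0 * E0 ≤ M1 w := le_trans (mul_le_mul_of_nonneg_left (hElow w hw) hm.le) (hM1low w hw)
    have h2 : g w / M1 w ≤ 1 / (m0 * E0) := div_le_div₀ zero_le_one (hg1 w) (by positivity) h1
    exact mul_le_mul (hQb _) h2 (div_pos (hg0 w) (hM1pos w hw)).le hB.le
  have hh'b : ∀ w ∈ Set.Icc (L - κ) (L + κ), |h' w| ≤ κ / (η^2 * m0 * E0) + C1 / (m0^2 * E0) := by
    intro w hw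
    have hp := hM1pos w hw.1
    have e : h' w = g w * ((L - w) / η^2) / M1 w - g w * M2 w / (M1 w)^2 := by
      simp only [hh']; field_simp
    have h1 : m0 * E0 ≤ M1 w := le_trans (mul_le_mul_of_nonneg_left (hElow w hw.1) hm.le) (hM1low w hw.1)
    have hLw : |L - w| ≤ κ := abs_le.2 ⟨by linarith [hw.2], by linarith [hw.1]⟩
    have hM2b : |M2 w| ≤ C1 * Real.exp (w / a) := by
      have hw0 : 0 ≤ w := by linarith [hw.1]
      have hex : Real.exp (w / b) ≤ Real.exp (w / a) :=
        Real.exp_le_exp.2 (div_le_div_of_nonneg_left hw0 ha0 hab.le)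
      simp only [hM2]
      refine (abs_add_le _ _).trans ?_
      rw [abs_mul, abs_mul, abs_of_pos (Real.exp_pos _), abs_of_pos (Real.exp_pos _), abs_div, abs_div,
        abs_of_pos hz1, abs_of_pos (by positivity : 0 < a^2), abs_of_pos (by positivity : 0 < b^2)]
      have : |z2| / b^2 * Real.exp (w / b) ≤ |z2| / b^2 * Real.exp (w / a) :=
        mul_le_mul_of_nonneg_left hex (by positivity)
      rw [hC1]; linarith
    rw [e]
    refine (abs_sub _ _).trans (add_le_add ?_ ?_)
    · rw [abs_div, abs_mul, abs_div, abs_of_pos (hg0 w), abs_of_pos hp, abs_of_pos (by positivity : 0 < η^2)]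
      calc _ ≤ (1 * (κ / η^2)) / (m0 * E0) := by
            have := hg1 w
            gcongr
        _ = _ := by field_simp
    · rw [abs_div, abs_mul, abs_of_pos (hg0 w), abs_of_pos (by positivity : 0 < (M1 w)^2)]
      have hEw := Real.exp_pos (w / a)
      calc _ ≤ (1 * (C1 * Real.exp (w / a))) / (m0 * Real.exp (w / a))^2 := by
            have := hg1 w
            have := hM1low w hw.1
            gcongr
        _ = C1 / (m0^2 * Real.exp (w / a)) := by field_simp
        _ ≤ _ := by
            have := hElow w hw.1
            gcongr
  have hInteg : |∫ w in (L - κ)..(L + κ), Q (M w) * h' w| ≤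
      B * (κ / (η^2 * m0 * E0) + C1 / (m0^2 * E0)) * (2 * κ) := by
    have := intervalIntegral.norm_integral_le_of_norm_le_const (a := L - κ) (b := L + κ)
      (f := fun w => Q (M w) * h' w) (C := B * (κ / (η^2 * m0 * E0) + C1 / (m0^2 * E0))) ?_
    · rw [Real.norm_eq_abs, abs_of_nonneg (by linarith : 0 ≤ L + κ - (L - κ))] at this
      convert! this using 2
      ring
    · intro w hw
      rw [Set.uIoc_of_le hle] at hw
      rw [Real.norm_eq_abs, abs_mul]
      exact mul_le_mul (hQb _) (hh'b w ⟨hw.1.le, hw.2⟩) (abs_nonneg _) hB.le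
  have hb1 := hbdry (L + κ) hle
  have hb2 := hbdry (L - κ) le_rfl
  have hfin : |∫ w in (L - κ)..(L + κ), sawf (M w) * g w| ≤
      B * (1 / (m0 * E0)) + B * (1 / (m0 * E0)) + B * (κ / (η^2 * m0 * E0) + C1 / (m0^2 * E0)) * (2 * κ) := by
    rw [abs_le] at *
    constructor <;> linarith [hb1.1, hb1.2, hb2.1, hb2.2, hInteg.1, hInteg.2]
  refine hfin.trans ?_
  have hE : Real.exp (-((L - κ) / a)) = 1 / E0 := by rw [Real.exp_neg, hE0, one_div]
  rw [hE]
  have t1 : B * (1 / (m0 * E0)) ≤ B * (1 / (m0 * E0)) / η := le_div_self (by positivity) hη hη1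
  have t2 : B * (κ / (η^2 * m0 * E0)) * (2 * κ) = B * (2 / m0) * (1 / E0) / η := by
    rw [← hκη]; field_simp
  have t3 : B * (C1 / (m0^2 * E0)) * (2 * κ) ≤ B * (C1 / (m0^2 * E0)) * 2 / η := by
    calc _ ≤ B * (C1 / (m0^2 * E0)) * 2 := by
          apply mul_le_mul_of_nonneg_left _ (by positivity); linarith
      _ ≤ _ := le_div_self (by positivity) hη hη1
  calc _ ≤ B * (1 / (m0 * E0)) / η + B * (1 / (m0 * E0)) / η + (B * (2 / m0) * (1 / E0) / η
        + B * (C1 / (m0^2 * E0)) * 2 / η) := by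
        rw [mul_add, add_mul, t2]; linarith
    _ = _ := by field_simp; ring

lemma gauss_lower (L η κ : ℝ) (hη : 0 < η) (hκ : η ≤ κ) :
    η ≤ ∫ w in (L - κ)..(L + κ), Real.exp (-(L - w)^2 / (2 * η^2)) := by
  have hc : Continuous (fun w : ℝ => Real.exp (-(L - w)^2 / (2 * η^2))) := by fun_prop
  calc η = ∫ w in (L - η)..(L + η), (1/2 : ℝ) := by
        rw [intervalIntegral.integral_const, smul_eq_mul]; ring
    _ ≤ ∫ w in (L - η)..(L + η), Real.exp (-(L - w)^2 / (2 * η^2)) := by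
        apply intervalIntegral.integral_mono_on (by linarith) (by simp) (hc.intervalIntegrable _ _)
        intro w hw
        have h1 : (L - w)^2 ≤ η^2 := sq_le_sq' (by linarith [hw.2]) (by linarith [hw.1])
        have h2 : -(1/2) ≤ -(L - w)^2 / (2 * η^2) := by
          rw [neg_div, neg_le_neg_iff, div_le_div_iff₀ (by positivity) (by norm_num)]; linarith
        have h3 := Real.add_one_le_exp (-(L - w)^2 / (2 * η^2))
        linarith
    _ ≤ _ := by
        apply intervalIntegral.integral_mono_interval (by linarith) (by linarith) (by linarith)
        · exact Filter.Eventually.of_forall fun w => (Real.exp_pos _).le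
        · exact hc.intervalIntegrable _ _

lemma small_total {a b : ℝ} (ha : 1 ≤ a) (hab : a < b) (K C2 C3 : ℝ) (hK : 0 < K) (hC2 : 0 < C2) (hC3 : 0 < C3) :
    ∃ l0 : ℝ, ∀ l : ℝ, l0 ≤ l → ∀ η κ : ℝ, η = Real.exp (-(1 / (16 * b) * l)) → 0 < κ → κ ≤ 1 →
      K * Real.exp (-(1 / (2 * b)) * (l + κ)) / η^6 + C2 * Real.exp (2 * (l + κ)) * Real.exp (-(1 / (4 * η)))
        + C3 * Real.exp (-(l / a)) / η < η / 20 := by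
  have hb0 : 0 < b := by linarith
  set δ := 1 / (16 * b) with hδ
  have hδ0 : 0 < δ := by positivity
  set A := K + C2 * Real.exp 2 + C3 with hA
  have hA0 : 0 < A := by positivity
  refine ⟨max (8 * (2 + 2 * δ) / δ^2) (max 0 (40 * A / δ)), ?_⟩
  intro l hl η κ hη hκ hκ1
  have hl1 : 8 * (2 + 2 * δ) / δ^2 ≤ l := (le_max_left _ _).trans hl
  have hl2 : 0 ≤ l := ((le_max_left _ _).trans (le_max_right _ _)).trans hl
  have hl3 : 40 * A / δ ≤ l := ((le_max_right _ _).trans (le_max_right _ _)).trans hl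
  have hη0 : 0 < η := by rw [hη]; exact Real.exp_pos _
  have hx : 0 ≤ δ * l := by positivity
  have hinv : 1 / η = Real.exp (δ * l) := by rw [hη, Real.exp_neg, one_div, inv_inv]
  have h8 : 1 / (2 * b) = 8 * δ := by rw [hδ]; field_simp; norm_num
  have t1 : K * Real.exp (-(1 / (2 * b)) * (l + κ)) / η^6 ≤ K * (η * η) := by
    rw [div_le_iff₀ (by positivity), mul_assoc]
    apply mul_le_mul_of_nonneg_left _ hK.le
    have : η * η * η^6 = Real.exp (-(8 * δ * l)) := by
      have : η * η * η^6 = η^8 := by ring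
      rw [this, hη, ← Real.exp_nat_mul]; congr 1; push_cast; ring
    rw [this, h8]
    apply Real.exp_le_exp.2
    nlinarith
  have t3 : C3 * Real.exp (-(l / a)) / η ≤ C3 * (η * η) := by
    rw [div_le_iff₀ hη0, mul_assoc]
    apply mul_le_mul_of_nonneg_left _ hC3.le
    have : η * η * η = Real.exp (-(3 * δ * l)) := by
      have : η * η * η = η^3 := by ring
      rw [this, hη, ← Real.exp_nat_mul]; congr 1; push_cast; ring
    rw [this]
    apply Real.exp_le_exp.2
    have h16 : l / b = 16 * δ * l := by rw [hδ]; field_simp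
    have : l / b ≤ l / a := div_le_div_of_nonneg_left hl2 (by linarith) hab.le
    nlinarith
  have t2 : C2 * Real.exp (2 * (l + κ)) * Real.exp (-(1 / (4 * η))) ≤ C2 * Real.exp 2 * (η * η) := by
    rw [mul_assoc, mul_assoc]
    apply mul_le_mul_of_nonneg_left _ hC2.le
    have e : 1 / (4 * η) = Real.exp (δ * l) / 4 := by rw [← hinv]; field_simp
    rw [e, hη, ← Real.exp_add, ← Real.exp_add, ← Real.exp_add]
    apply Real.exp_le_exp.2
    have hq := Real.quadratic_le_exp_of_nonneg hx
    rw [div_le_iff₀ (by positivity)] at hl1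
    have : 8 * (2 + 2 * δ) * l ≤ l * δ^2 * l := mul_le_mul_of_nonneg_right hl1 hl2
    nlinarith
  have hsm : A * η < 1 / 20 := by
    have h1 : δ * l + 1 ≤ Real.exp (δ * l) := Real.add_one_le_exp _
    rw [← hinv] at h1
    rw [div_le_iff₀ hδ0] at hl3
    have h2 : 40 * A < 1 / η := by nlinarith
    rw [lt_div_iff₀ hη0] at h2
    nlinarith
  have : A * (η * η) < η / 20 := by nlinarith
  have e : A * (η * η) = K * (η * η) + C2 * Real.exp 2 * (η * η) + C3 * (η * η) := by rw [hA]; ring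
  linarith

lemma Delta_pos_lower (a b w : ℝ) (h : 0 ≤ DeltaErr a b (Real.exp w)) :
    sawf ((riemannZeta ((b / a : ℝ) : ℂ)).re * Real.exp (w / a)
      + (riemannZeta ((a / b : ℝ) : ℂ)).re * Real.exp (w / b)) + 1 / 20 ≤ phi a b w := by
  have h' : 0 ≤ phi a b w + 1 / 4 := by unfold phi; linarith
  rw [phi_eq] at h' ⊢
  set M := (riemannZeta ((b / a : ℝ) : ℂ)).re * Real.exp (w / a)
      + (riemannZeta ((a / b : ℝ) : ℂ)).re * Real.exp (w / b) with hM
  obtain ⟨n, hn⟩ : ∃ n : ℕ, latticeCount a b (Real.exp w) = n := ⟨_, rfl⟩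
  rw [hn] at h' ⊢
  have h1 : M ≤ ((n : ℤ) : ℝ) := by push_cast; linarith
  have h2 : ⌈M⌉ ≤ (n : ℤ) := Int.ceil_le.2 h1
  have h3 : ((⌈M⌉ : ℤ) : ℝ) ≤ n := by exact_mod_cast h2
  have h4 : Int.fract (-M) = ⌈M⌉ - M := by
    rw [Int.fract, Int.floor_neg]; push_cast; ring
  have h5 : 0 ≤ Int.fract (-M)^4 := by positivity
  unfold sawf
  linarith

lemma core {a b : ℝ} (ha : 1 ≤ a) (hab : a < b) :
    ∃ l0 : ℝ, ∀ l : ℝ, l0 ≤ l → ∀ κ : ℝ, κ = Real.exp (-(1 / (32 * b) * l)) →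
      (∃ w ∈ Set.Icc l (l + 2 * κ), DeltaErr a b (Real.exp w) < 0) ∧
      (∃ w ∈ Set.Icc l (l + 2 * κ), 0 < DeltaErr a b (Real.exp w)) := by
  have hb0 : 0 < b := by linarith
  have hb : 1 ≤ b := by linarith
  have ha0 : 0 < a := by linarith
  set z1 := (riemannZeta ((b / a : ℝ) : ℂ)).re with hz1
  set z2 := (riemannZeta ((a / b : ℝ) : ℂ)).re with hz2
  have hz1p : 0 < z1 := riemannZeta_re_pos_of_one_lt ((one_lt_div ha0).2 hab)
  obtain ⟨K, hK, hsm⟩ := phi_smooth ha hab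
  obtain ⟨C2, hC2, htail⟩ := phi_tail ha hb
  obtain ⟨C3, W, hC3, heq⟩ := equidist (z2 := z2) ha hab hz1p
  obtain ⟨l0, hl0⟩ := small_total ha hab K C2 C3 hK hC2 hC3
  refine ⟨max l0 (max W 0), ?_⟩
  intro l hl κ hκ
  have hla : l0 ≤ l := (le_max_left _ _).trans hl
  have hlW : W ≤ l := ((le_max_left _ _).trans (le_max_right _ _)).trans hl
  have hl00 : 0 ≤ l := ((le_max_right _ _).trans (le_max_right _ _)).trans hl
  have hκ0 : 0 < κ := by rw [hκ]; exact Real.exp_pos _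
  have hκ1 : κ ≤ 1 := by
    rw [hκ]; apply Real.exp_le_one_iff.2
    rw [neg_nonpos]; positivity
  set η := κ^2 with hη
  have hη0 : 0 < η := by positivity
  have hη1 : η ≤ 1 := by rw [hη]; nlinarith
  have hηκ : η ≤ κ := by rw [hη]; nlinarith
  have hηe : η = Real.exp (-(1 / (16 * b) * l)) := by
    rw [hη, hκ, ← Real.exp_nat_mul]; congr 1; push_cast; field_simp; ring
  set L := l + κ with hL
  have e1 : L - κ = l := by rw [hL]; ring
  have e2 : L + κ = l + 2 * κ := by rw [hL]; ring
  have hs := hsm L η hη0 hη1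
  obtain ⟨hii, ht⟩ := htail L η κ hη0 hη1 hκ0 rfl (by linarith)
  have hq := heq L η κ hη0 hη1 hκ0 rfl (by linarith)
  have hG := gauss_lower L η κ hη0 hηκ
  have htot := hl0 l hla η κ hηe hκ0 hκ1
  rw [e1] at hq
  rw [e1] at hii ht hG
  rw [e2] at hii ht hG hq
  have hle : l ≤ l + 2 * κ := by linarith
  set g : ℝ → ℝ := fun w => Real.exp (-(L - w)^2 / (2 * η^2)) with hg
  have cg : Continuous g := by fun_prop
  have hg0 : ∀ w, 0 < g w := fun w => Real.exp_pos _
  rw [abs_le] at hs ht hq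
  have hGg : η ≤ ∫ w in l..(l + 2 * κ), g w := hG
  constructor
  · by_contra hcon
    push Not at hcon
    have hmono : ∫ w in l..(l + 2 * κ), (sawf (z1 * Real.exp (w / a) + z2 * Real.exp (w / b)) * g w + 1 / 20 * g w)
        ≤ ∫ w in l..(l + 2 * κ), phi a b w * g w := by
      apply intervalIntegral.integral_mono_on hle _ hii
      · intro w hw
        have := mul_le_mul_of_nonneg_right (Delta_pos_lower a b w (hcon w hw)) (hg0 w).le
        rw [add_mul] at this
        exact this
      · have := sawf_cont
        exact Continuous.intervalIntegrable (by fun_prop) _ _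
    rw [intervalIntegral.integral_add, intervalIntegral.integral_const_mul] at hmono
    · linarith [hs.1, hs.2, ht.1, ht.2, hq.1, hq.2]
    · have := sawf_cont
      exact Continuous.intervalIntegrable (by fun_prop) _ _
    · exact Continuous.intervalIntegrable (by fun_prop) _ _
  · by_contra hcon
    push Not at hcon
    have hmono : ∫ w in l..(l + 2 * κ), phi a b w * g w
        ≤ ∫ w in l..(l + 2 * κ), (-(1 / 4)) * g w := by
      apply intervalIntegral.integral_mono_on hle hii
      · exact Continuous.intervalIntegrable (by fun_prop) _ _
      · intro w hw
        apply mul_le_mul_of_nonneg_right _ (hg0 w).le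
        have := hcon w hw
        unfold phi; linarith
    rw [intervalIntegral.integral_const_mul] at hmono
    have : 0 < C3 * Real.exp (-(l / a)) / η := by positivity
    linarith [hs.1, hs.2, ht.1, ht.2]

theorem sign_changes_irrational (a b : ℝ) (ha : 1 ≤ a) (hab : a < b)
    (halga : IsAlgebraic ℚ a) (halgb : IsAlgebraic ℚ b)
    (hirr : Irrational (a / b)) :
    ∃ c₄ > (0 : ℝ), ∃ c₅ > (0 : ℝ), ∃ T₁ : ℝ, ∀ T : ℝ, T₁ ≤ T →
      ∃ x₁ ∈ Set.Icc T (T + c₅ * T *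
          Real.exp (-c₄ * (Real.log T) ^ ((1 : ℝ) / 2) *
            (Real.log (Real.log T)) ^ (-(1 : ℝ) / 2))),
      ∃ x₂ ∈ Set.Icc T (T + c₅ * T *
          Real.exp (-c₄ * (Real.log T) ^ ((1 : ℝ) / 2) *
            (Real.log (Real.log T)) ^ (-(1 : ℝ) / 2))),
        DeltaErr a b x₁ < 0 ∧ 0 < DeltaErr a b x₂ := by
  have hb0 : 0 < b := by linarith
  obtain ⟨l0, hl0⟩ := core ha hab
  set ε := 1 / (32 * b) with hε
  have hε0 : 0 < ε := by positivity
  set B := max l0 (max (Real.exp 1) (max (4 / ε^2) (4 / ε))) with hB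
  refine ⟨1, one_pos, 1, one_pos, Real.exp B, ?_⟩
  intro T hT
  have hT0 : 0 < T := lt_of_lt_of_le (Real.exp_pos _) hT
  set l := Real.log T with hl
  have hlB : B ≤ l := (Real.le_log_iff_exp_le hT0).2 hT
  have h1 : l0 ≤ l := (le_max_left _ _).trans hlB
  have h2 : Real.exp 1 ≤ l := ((le_max_left _ _).trans (le_max_right _ _)).trans hlB
  have h3 : 4 / ε^2 ≤ l := ((le_max_left _ _).trans ((le_max_right _ _).trans (le_max_right _ _))).trans hlB
  have h4 : 4 / ε ≤ l := ((le_max_right _ _).trans ((le_max_right _ _).trans (le_max_right _ _))).trans hlB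
  have hlp : 0 < l := lt_of_lt_of_le (Real.exp_pos _) h2
  have hll : 1 ≤ Real.log l := (Real.le_log_iff_exp_le hlp).2 h2
  set κ := Real.exp (-(ε * l)) with hκ
  have hκ0 : 0 < κ := Real.exp_pos _
  obtain ⟨⟨w1, hw1, hd1⟩, ⟨w2, hw2, hd2⟩⟩ := hl0 l h1 κ rfl
  set H := Real.exp (-1 * l ^ ((1 : ℝ) / 2) * (Real.log l) ^ (-(1 : ℝ) / 2)) with hH
  rw [div_le_iff₀ hε0] at h4
  rw [div_le_iff₀ (by positivity)] at h3
  have hlow : 4 * κ ≤ H := by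
    have hs : l ^ ((1 : ℝ) / 2) = Real.sqrt l := (Real.sqrt_eq_rpow l).symm
    have hr : (Real.log l) ^ (-(1 : ℝ) / 2) ≤ 1 :=
      Real.rpow_le_one_of_one_le_of_nonpos hll (by norm_num)
    have hsq : Real.sqrt l ≤ ε * l / 2 := by
      rw [Real.sqrt_le_left (by positivity)]
      nlinarith
    have hge : -(ε * l / 2) ≤ -1 * l ^ ((1 : ℝ) / 2) * (Real.log l) ^ (-(1 : ℝ) / 2) := by
      rw [hs]
      have := mul_le_mul_of_nonneg_left hr (Real.sqrt_nonneg l)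
      linarith
    have h44 : 4 ≤ Real.exp (ε * l / 2) := by
      have hq := Real.quadratic_le_exp_of_nonneg (by positivity : 0 ≤ ε * l / 2)
      nlinarith
    calc 4 * κ ≤ Real.exp (ε * l / 2) * κ := by gcongr
      _ = Real.exp (-(ε * l / 2)) := by rw [hκ, ← Real.exp_add]; congr 1; ring
      _ ≤ H := Real.exp_le_exp.2 hge
  have hκ2 : 2 * κ ≤ 1 := by
    have h5 : Real.exp (ε * l) * κ = 1 := by rw [hκ, ← Real.exp_add]; simp
    have h6 := Real.add_one_le_exp (ε * l)
    nlinarith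
  have hexp : Real.exp (2 * κ) ≤ 1 + 4 * κ := by
    have := Real.abs_exp_sub_one_le (x := 2 * κ) (by rw [abs_of_pos (by positivity)]; exact hκ2)
    rw [abs_of_pos (by positivity : 0 < 2 * κ)] at this
    linarith [le_abs_self (Real.exp (2 * κ) - 1)]
  have hmem : ∀ w ∈ Set.Icc l (l + 2 * κ), Real.exp w ∈ Set.Icc T (T + 1 * T * H) := by
    intro w hw
    have hTl : Real.exp l = T := Real.exp_log hT0
    constructor
    · rw [← hTl]; exact Real.exp_le_exp.2 hw.1
    · calc Real.exp w ≤ Real.exp (l + 2 * κ) := Real.exp_le_exp.2 hw.2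
        _ = T * Real.exp (2 * κ) := by rw [Real.exp_add, hTl]
        _ ≤ T * (1 + H) := by gcongr; linarith
        _ = _ := by ring
  exact ⟨_, hmem w1 hw1, _, hmem w2 hw2, hd1, hd2⟩
end

section
/- Let 1 ≤ a < b be fixed positive integers with gcd(a,b) = 1. Then there exists a sufficiently large constant c₆ = c₆(a,b) > 0 such that for every sufficiently large T, the function Δ_{a,b}(x) changes sign at least once in the interval [T, T + c₆ T^{1 − a/(b(a+b)(a+b−1))} (log T)⁴]; that is, Δ_{a,b} does not keep a fixed sign on the interval. -/
open Real MeasureTheory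

/-- Auxiliary term used for the continuation of zeta to the half plane `Re s > 0`. -/
noncomputable def zu (n : ℕ) (s : ℂ) : ℂ :=
  (s - 1) * (((n : ℝ) + 1 : ℝ) : ℂ) ^ (-s) + ((((n : ℝ) + 1 + 1 : ℝ)) : ℂ) ^ (1 - s)
    - (((n : ℝ) + 1 : ℝ) : ℂ) ^ (1 - s)

lemma zu_bound_aux (m : ℝ) (hm : 1 ≤ m) (s : ℂ) (hs : 0 < s.re) (hs1 : s ≠ 1) :
    ‖(s - 1) * (m : ℂ) ^ (-s) + ((m + 1 : ℝ) : ℂ) ^ (1 - s) - (m : ℂ) ^ (1 - s)‖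
      ≤ ‖s - 1‖ * (‖s‖ * m ^ (-s.re - 1)) := by
  have hm0 : 0 < m := by linarith
  have hs0 : s ≠ 0 := by
    rintro rfl; simp at hs
  have key1 : ∀ x ∈ Set.Icc m (m + 1), ‖(x : ℂ) ^ (-s) - (m : ℂ) ^ (-s)‖
      ≤ ‖s‖ * m ^ (-s.re - 1) := by
    intro x hx
    have h := (convex_Icc m (m + 1)).norm_image_sub_le_of_norm_hasDerivWithin_le
      (f := fun y : ℝ => (y : ℂ) ^ (-s)) (f' := fun y : ℝ => (-s) * (y : ℂ) ^ (-s - 1))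
      (C := ‖s‖ * m ^ (-s.re - 1)) (x := m) (y := x)
      (fun y hy => (hasDerivAt_ofReal_cpow_const (by linarith [hy.1] : y ≠ 0)
        (neg_ne_zero.mpr hs0)).hasDerivWithinAt) ?_ ⟨le_refl _, by linarith⟩ hx
    · refine h.trans ?_
      have : ‖x - m‖ ≤ 1 := by
        rw [Real.norm_eq_abs, abs_le]; constructor <;> linarith [hx.1, hx.2]
      have h2 : 0 ≤ ‖s‖ * m ^ (-s.re - 1) := by positivity
      nlinarith
    · intro y hy
      have hy0 : 0 < y := by linarith [hy.1]
      rw [norm_mul, norm_neg, Complex.norm_cpow_eq_rpow_re_of_pos hy0]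
      gcongr
      simp only [Complex.sub_re, Complex.neg_re, Complex.one_re]
      exact Real.rpow_le_rpow_of_nonpos hm0 hy.1 (by linarith)
  have h := (convex_Icc m (m + 1)).norm_image_sub_le_of_norm_hasDerivWithin_le
      (f := fun y : ℝ => (y : ℂ) ^ (1 - s) - (y : ℂ) * ((1 - s) * (m : ℂ) ^ (-s)))
      (f' := fun y : ℝ => (1 - s) * (y : ℂ) ^ (1 - s - 1) - 1 * ((1 - s) * (m : ℂ) ^ (-s)))
      (C := ‖s - 1‖ * (‖s‖ * m ^ (-s.re - 1))) (x := m) (y := m + 1)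
      (fun y hy => ((hasDerivAt_ofReal_cpow_const (by linarith [hy.1] : y ≠ 0)
        (sub_ne_zero.mpr hs1.symm)).sub
        ((Complex.ofRealCLM.hasDerivAt (x := y)).mul_const _)).hasDerivWithinAt) ?_
        ⟨le_refl _, by linarith⟩ ⟨by linarith, le_refl _⟩
  · have e : ‖m + 1 - m‖ = 1 := by simp
    rw [e, mul_one] at h
    refine le_trans (le_of_eq ?_) h
    congr 1
    push_cast
    ring
  · intro y hy
    have : (1 - s) * (y : ℂ) ^ (1 - s - 1) - 1 * ((1 - s) * (m : ℂ) ^ (-s))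
        = (1 - s) * ((y : ℂ) ^ (-s) - (m : ℂ) ^ (-s)) := by
      rw [show 1 - s - 1 = -s by ring]; ring
    rw [this, norm_mul, norm_sub_rev 1 s]
    gcongr
    exact key1 y hy

lemma zu_bound (n : ℕ) (s : ℂ) (hs : 0 < s.re) :
    ‖zu n s‖ ≤ ‖s - 1‖ * (‖s‖ * ((n : ℝ) + 1) ^ (-s.re - 1)) := by
  by_cases h1 : s = 1
  · subst h1; simp [zu]
  · exact zu_bound_aux _ (by linarith [Nat.cast_nonneg (α := ℝ) n]) s hs h1

lemma summable_aux (e : ℝ) (he : 0 < e) : Summable fun n : ℕ => ((n : ℝ) + 1) ^ (-e - 1) := by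
  have h := (Real.summable_nat_rpow (p := -e - 1)).mpr (by linarith)
  have := (summable_nat_add_iff 1).mpr h
  simpa using this

lemma zu_summable (s : ℂ) (hs : 0 < s.re) : Summable fun n => zu n s := by
  refine Summable.of_norm_bounded (g := fun n : ℕ => ‖s - 1‖ * (‖s‖ * ((n : ℝ) + 1) ^ (-s.re - 1)))
    ?_ (fun n => zu_bound n s hs)
  exact ((summable_aux _ hs).mul_left _).mul_left _

lemma zu_sum (N : ℕ) (s : ℂ) : ∑ n ∈ Finset.range N, zu n s =
    (s - 1) * ∑ n ∈ Finset.range N, (((n : ℝ) + 1 : ℝ) : ℂ) ^ (-s)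
      + (((N : ℝ) + 1 : ℝ) : ℂ) ^ (1 - s) - 1 := by
  induction N with
  | zero => simp
  | succ N ih =>
    rw [Finset.sum_range_succ, Finset.sum_range_succ, ih, zu]
    push_cast
    ring

lemma zu_diff : DifferentiableOn ℂ (fun s => ∑' n, zu n s) {s : ℂ | 0 < s.re} := by
  intro s hs
  have hs' : 0 < s.re := hs
  set e := s.re / 2 with he
  have he0 : 0 < e := by positivity
  set R := ‖s‖ + 1 with hR
  have hU : IsOpen ({w : ℂ | e < w.re} ∩ {w : ℂ | ‖w‖ < R}) :=
    (isOpen_lt continuous_const Complex.continuous_re).inter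
      (isOpen_lt continuous_norm continuous_const)
  have hd : DifferentiableOn ℂ (fun s => ∑' n, zu n s)
      ({w : ℂ | e < w.re} ∩ {w : ℂ | ‖w‖ < R}) := by
    refine Complex.differentiableOn_tsum_of_summable_norm
      (u := fun n : ℕ => (R + 1) * (R * ((n : ℝ) + 1) ^ (-e - 1))) ?_ ?_ hU ?_
    · exact ((summable_aux _ he0).mul_left _).mul_left _
    · intro n
      have h1 : (((n : ℝ) + 1 : ℝ) : ℂ) ≠ 0 := by
        exact_mod_cast (by positivity : ((n : ℝ) + 1) ≠ 0)
      have h2 : (((n : ℝ) + 1 + 1 : ℝ) : ℂ) ≠ 0 := by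
        exact_mod_cast (by positivity : ((n : ℝ) + 1 + 1) ≠ 0)
      intro w _
      apply DifferentiableAt.differentiableWithinAt
      unfold zu
      refine DifferentiableAt.sub (DifferentiableAt.add (DifferentiableAt.mul (by fun_prop) ?_) ?_) ?_
      · exact (by fun_prop : DifferentiableAt ℂ (fun s : ℂ => -s) w).const_cpow (Or.inl h1)
      · exact (by fun_prop : DifferentiableAt ℂ (fun s : ℂ => 1 - s) w).const_cpow (Or.inl h2)
      · exact (by fun_prop : DifferentiableAt ℂ (fun s : ℂ => 1 - s) w).const_cpow (Or.inl h1)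
    · rintro n w ⟨hw1, hw2⟩
      have hw1' : e < w.re := hw1
      have hw2' : ‖w‖ < R := hw2
      refine (zu_bound n w (by linarith)).trans ?_
      have : ‖w - 1‖ ≤ R + 1 := (norm_sub_le _ _).trans (by simp; linarith)
      have h3 : ((n : ℝ) + 1) ^ (-w.re - 1) ≤ ((n : ℝ) + 1) ^ (-e - 1) :=
        Real.rpow_le_rpow_of_exponent_le (by linarith [Nat.cast_nonneg (α := ℝ) n]) (by linarith)
      have : 0 ≤ R := by positivity
      gcongr
  exact ((hd.differentiableAt (hU.mem_nhds ⟨by simp only [Set.mem_ofPred_eq]; linarith,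
    by simp only [Set.mem_ofPred_eq]; linarith⟩))).differentiableWithinAt

lemma tsum_zu_of_one_lt (s : ℂ) (hs : 1 < s.re) :
    ∑' n, zu n s = (s - 1) * riemannZeta s - 1 := by
  have h1 := (zu_summable s (by linarith)).hasSum.tendsto_sum_nat
  have hsum : Summable fun n : ℕ => (((n : ℝ) + 1 : ℝ) : ℂ) ^ (-s) := by
    have h := (Complex.summable_one_div_nat_cpow (p := s)).mpr hs
    have h' := (summable_nat_add_iff 1).mpr h
    refine h'.congr fun n => ?_
    push_cast
    rw [Complex.cpow_neg, one_div]
  have hz : riemannZeta s = ∑' n : ℕ, (((n : ℝ) + 1 : ℝ) : ℂ) ^ (-s) := by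
    rw [zeta_eq_tsum_one_div_nat_add_one_cpow hs]
    refine tsum_congr fun n => ?_
    push_cast
    rw [Complex.cpow_neg, one_div]
  have h2 := hsum.hasSum.tendsto_sum_nat
  rw [← hz] at h2
  have h3 : Filter.Tendsto (fun N : ℕ => (((N : ℝ) + 1 : ℝ) : ℂ) ^ (1 - s)) Filter.atTop
      (nhds 0) := by
    rw [tendsto_zero_iff_norm_tendsto_zero]
    have : ∀ N : ℕ, ‖(((N : ℝ) + 1 : ℝ) : ℂ) ^ (1 - s)‖ = ((N : ℝ) + 1) ^ (-(s.re - 1)) := by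
      intro N
      rw [Complex.norm_cpow_eq_rpow_re_of_pos (by positivity)]
      simp
    simp_rw [this]
    exact (tendsto_rpow_neg_atTop (by linarith : 0 < s.re - 1)).comp
      (Filter.tendsto_atTop_add_const_right _ _ tendsto_natCast_atTop_atTop)
  have h4 := ((h2.const_mul (s - 1)).add h3).sub_const 1
  rw [add_zero] at h4
  refine tendsto_nhds_unique h1 (h4.congr fun N => ?_)
  rw [zu_sum]

lemma tsum_zu (s : ℂ) (hs : 0 < s.re) (hs1 : s ≠ 1) :
    ∑' n, zu n s = (s - 1) * riemannZeta s - 1 := by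
  have hU : IsOpen {s : ℂ | 0 < s.re} := isOpen_lt continuous_const Complex.continuous_re
  have hA := zu_diff.analyticOnNhd hU
  have hB : AnalyticOnNhd ℂ (fun s => riemannZeta₁ s - 1) {s : ℂ | 0 < s.re} :=
    DifferentiableOn.analyticOnNhd
      ((differentiable_riemannZeta₁.sub_const 1).differentiableOn) hU
  have hconn : IsPreconnected {s : ℂ | 0 < s.re} :=
    (convex_halfSpace_re_gt 0).isPreconnected
  have he : (fun s => ∑' n, zu n s) =ᶠ[nhds (2 : ℂ)]
      (fun s => riemannZeta₁ s - 1) := by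
    have : {s : ℂ | 1 < s.re} ∈ nhds (2 : ℂ) :=
      (isOpen_lt continuous_const Complex.continuous_re).mem_nhds (by simp)
    filter_upwards [this] with w hw
    have hw1 : w ≠ 1 := by
      rintro rfl; simp at hw
    rw [tsum_zu_of_one_lt w hw, riemannZeta_eq_inv_sub_mul hw1]
    have : w - 1 ≠ 0 := sub_ne_zero.mpr hw1
    field_simp
  have := hA.eqOn_of_preconnected_of_eventuallyEq hB hconn (by simp : (2 : ℂ) ∈ _) he hs
  simp only at this
  rw [this, riemannZeta_eq_inv_sub_mul hs1]
  have : s - 1 ≠ 0 := sub_ne_zero.mpr hs1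
  field_simp

lemma zeta_lim (α : ℝ) (hα : 0 < α) (hα1 : α ≠ 1) :
    Filter.Tendsto (fun N : ℕ => ∑ n ∈ Finset.range N, ((n : ℝ) + 1) ^ (-α)
      - ((N : ℝ) + 1) ^ (1 - α) / (1 - α)) Filter.atTop (nhds (riemannZeta (α : ℂ)).re) := by
  have hα1' : (α : ℂ) ≠ 1 := by exact_mod_cast hα1
  have h1 := (zu_summable (α : ℂ) (by simpa)).hasSum.tendsto_sum_nat
  rw [tsum_zu (α : ℂ) (by simpa) hα1'] at h1
  have h2 := ((Complex.continuous_re.tendsto _).comp h1)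
  have h3 := (h2.add_const 1).div_const (α - 1)
  have h4 : α - 1 ≠ 0 := sub_ne_zero.mpr hα1
  have h5 : 1 - α ≠ 0 := sub_ne_zero.mpr hα1.symm
  have e1 : (((α : ℂ) - 1) * riemannZeta α - 1).re = (α - 1) * (riemannZeta α).re - 1 := by
    have : ((α : ℂ) - 1) = ((α - 1 : ℝ) : ℂ) := by push_cast; ring
    rw [this, Complex.sub_re, Complex.re_ofReal_mul, Complex.one_re]
  rw [e1] at h3
  have e2 : ((α - 1) * (riemannZeta α).re - 1 + 1) / (α - 1) = (riemannZeta α).re := by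
    field_simp; ring
  rw [e2] at h3
  refine h3.congr fun N => ?_
  have e3 : (∑ n ∈ Finset.range N, zu n (α : ℂ)) =
      (((α - 1) * ∑ n ∈ Finset.range N, ((n : ℝ) + 1) ^ (-α) + ((N : ℝ) + 1) ^ (1 - α) - 1 : ℝ) : ℂ) := by
    rw [zu_sum]
    push_cast [Complex.ofReal_cpow (by positivity : (0:ℝ) ≤ (N : ℝ) + 1)]
    congr 3
    refine Finset.sum_congr rfl fun n _ => ?_
    rw [Complex.ofReal_cpow (by positivity)]
    push_cast
    rfl
  simp only [Function.comp]
  rw [e3, Complex.ofReal_re]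
  field_simp
  ring


/-- Partial sum of powers up to a real bound. -/
noncomputable def pw (γ x : ℝ) : ℝ := ∑ n ∈ Finset.Icc 1 ⌊x⌋₊, (n : ℝ) ^ γ

/-- Half the second Bernoulli polynomial. -/
noncomputable def bb2 (f : ℝ) : ℝ := f ^ 2 / 2 - f / 2 + 1 / 12

/-- One sixth of the third Bernoulli polynomial. -/
noncomputable def bb3 (f : ℝ) : ℝ := f ^ 3 / 6 - f ^ 2 / 4 + f / 12

lemma bb3_abs {f : ℝ} (h0 : 0 ≤ f) (h1 : f ≤ 1) : |bb3 f| ≤ 1 := by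
  unfold bb3
  rw [abs_le]
  constructor <;> nlinarith [mul_nonneg h0 h0, mul_nonneg (mul_nonneg h0 h0) h0, pow_le_one₀ (n := 3) h0 h1, pow_le_one₀ (n := 2) h0 h1]

lemma bb2_abs {f : ℝ} (h0 : 0 ≤ f) (h1 : f ≤ 1) : |bb2 f| ≤ 1 := by
  unfold bb2
  rw [abs_le]
  constructor <;> nlinarith [mul_nonneg h0 h0, pow_le_one₀ (n := 2) h0 h1]

/-- Local Euler-Maclaurin remainder. -/
noncomputable def emU (γ : ℝ) (n : ℕ) (x : ℝ) : ℝ :=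
  pw γ n - x ^ (γ + 1) / (γ + 1) + (x - n - 1 / 2) * x ^ γ - γ * (bb2 (x - n) * x ^ (γ - 1))
    + γ * (γ - 1) * (bb3 (x - n) * x ^ (γ - 2))

lemma emU_hasDerivAt (γ : ℝ) (hγ : γ ≠ -1) (n : ℕ) (x : ℝ) (hx : 0 < x) :
    HasDerivAt (emU γ n) (γ * (γ - 1) * ((γ - 2) * (bb3 (x - n) * x ^ (γ - 3)))) x := by
  have hg : γ + 1 ≠ 0 := fun h => hγ (by linarith)
  have hp : ∀ p : ℝ, HasDerivAt (fun y : ℝ => y ^ p) (p * x ^ (p - 1)) x := fun p =>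
    Real.hasDerivAt_rpow_const (Or.inl hx.ne')
  have hl : HasDerivAt (fun y : ℝ => y - n - 1 / 2) 1 x :=
    ((hasDerivAt_id x).sub_const _).sub_const _
  have hl0 : HasDerivAt (fun y : ℝ => y - n) 1 x := (hasDerivAt_id x).sub_const _
  have h2 : HasDerivAt (fun y : ℝ => bb2 (y - n)) (x - n - 1 / 2) x := by
    unfold bb2
    refine ((((hl0.pow 2).div_const 2).sub (hl0.div_const 2)).add_const (1 / 12 : ℝ)).congr_deriv ?_
    push_cast; ring
  have h3 : HasDerivAt (fun y : ℝ => bb3 (y - n)) (bb2 (x - n)) x := by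
    unfold bb3 bb2
    refine ((((hl0.pow 3).div_const 6).sub ((hl0.pow 2).div_const 4)).add
      (hl0.div_const 12)).congr_deriv ?_
    push_cast; ring
  have H := ((((hp (γ + 1)).div_const (γ + 1)).const_sub (pw γ n)).add (hl.mul (hp γ))).sub
    ((h2.mul (hp (γ - 1))).const_mul γ) |>.add ((h3.mul (hp (γ - 2))).const_mul (γ * (γ - 1)))
  refine H.congr_deriv ?_
  have e0 : x ^ γ = x ^ (γ - 3) * x ^ 3 := by
    rw [← Real.rpow_natCast, ← Real.rpow_add hx]; congr 1; push_cast; ring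
  have e1 : x ^ (γ - 1) = x ^ (γ - 3) * x ^ 2 := by
    rw [← Real.rpow_natCast, ← Real.rpow_add hx]; congr 1; push_cast; ring
  have e2 : x ^ (γ - 2) = x ^ (γ - 3) * x := by
    rw [← Real.rpow_add_one hx.ne']; congr 1; ring
  rw [show γ + 1 - 1 = γ by ring, show γ - 1 - 1 = γ - 2 by ring, show γ - 2 - 1 = γ - 3 by ring,
    e0, e1, e2]
  field_simp
  ring

lemma pw_succ (γ : ℝ) (n : ℕ) : pw γ ((n : ℝ) + 1) = pw γ n + ((n : ℝ) + 1) ^ γ := by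
  have : ⌊(n : ℝ) + 1⌋₊ = n + 1 := by exact_mod_cast Nat.floor_natCast (R := ℝ) (n + 1)
  unfold pw
  rw [this, Nat.floor_natCast, Finset.sum_Icc_succ_top (by omega)]
  push_cast; rfl

lemma emU_succ (γ : ℝ) (n : ℕ) : emU γ n ((n : ℝ) + 1) = emU γ (n + 1) ((n : ℝ) + 1) := by
  unfold emU
  push_cast
  rw [pw_succ]
  unfold bb2 bb3
  ring

/-- Comparison function. -/
noncomputable def emB (γ x : ℝ) : ℝ :=
  if γ < 2 then -(|γ * (γ - 1)| * x ^ (γ - 2)) else |γ * (γ - 1)| * x ^ (γ - 2)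

lemma emB_hasDerivAt (γ x : ℝ) (hx : 0 < x) :
    HasDerivAt (emB γ) (|γ * (γ - 1)| * (|γ - 2| * x ^ (γ - 3))) x := by
  have hp : HasDerivAt (fun y : ℝ => y ^ (γ - 2)) ((γ - 2) * x ^ (γ - 2 - 1)) x :=
    Real.hasDerivAt_rpow_const (Or.inl hx.ne')
  rw [show γ - 2 - 1 = γ - 3 by ring] at hp
  unfold emB
  split_ifs with h
  · rw [abs_of_neg (by linarith : γ - 2 < 0)]
    refine ((hp.const_mul (|γ * (γ - 1)|)).neg).congr_deriv ?_
    ring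
  · rw [abs_of_nonneg (by linarith : 0 ≤ γ - 2)]
    exact hp.const_mul _

lemma em_mono_piece (γ : ℝ) (hγ : γ ≠ -1) (n : ℕ) (hn : 1 ≤ n) :
    MonotoneOn (fun x => emU γ n x + emB γ x) (Set.Icc (n : ℝ) (n + 1)) ∧
    AntitoneOn (fun x => emU γ n x - emB γ x) (Set.Icc (n : ℝ) (n + 1)) := by
  have hn' : (1 : ℝ) ≤ n := by exact_mod_cast hn
  have key : ∀ x ∈ Set.Icc (n : ℝ) (n + 1), |γ * (γ - 1) * ((γ - 2) * (bb3 (x - n) * x ^ (γ - 3)))|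
      ≤ |γ * (γ - 1)| * (|γ - 2| * x ^ (γ - 3)) := by
    intro x hx
    have hx0 : 0 < x := by linarith [hx.1]
    rw [abs_mul (γ * (γ - 1)), abs_mul (γ - 2), abs_mul (bb3 _),
      abs_of_pos (Real.rpow_pos_of_pos hx0 _)]
    have hb := bb3_abs (by linarith [hx.1] : 0 ≤ x - n) (by linarith [hx.2])
    gcongr
    have : 0 < x ^ (γ - 3) := Real.rpow_pos_of_pos hx0 _
    nlinarith
  constructor
  · refine monotoneOn_of_hasDerivWithinAt_nonneg (convex_Icc _ _)
      (f' := fun x => γ * (γ - 1) * ((γ - 2) * (bb3 (x - n) * x ^ (γ - 3))) +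
        |γ * (γ - 1)| * (|γ - 2| * x ^ (γ - 3))) ?_ ?_ ?_
    · intro x hx
      have hx0 : 0 < x := by linarith [hx.1]
      exact ((emU_hasDerivAt γ hγ n x hx0).add
        (emB_hasDerivAt γ x hx0)).continuousAt.continuousWithinAt
    · intro x hx
      have hx0 : 0 < x := by linarith [(interior_subset hx).1]
      exact ((emU_hasDerivAt γ hγ n x hx0).add (emB_hasDerivAt γ x hx0)).hasDerivWithinAt
    · intro x hx
      linarith [(abs_le.mp (key x (interior_subset hx))).1]
  · refine antitoneOn_of_hasDerivWithinAt_nonpos (convex_Icc _ _)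
      (f' := fun x => γ * (γ - 1) * ((γ - 2) * (bb3 (x - n) * x ^ (γ - 3))) -
        |γ * (γ - 1)| * (|γ - 2| * x ^ (γ - 3))) ?_ ?_ ?_
    · intro x hx
      have hx0 : 0 < x := by linarith [hx.1]
      exact ((emU_hasDerivAt γ hγ n x hx0).sub
        (emB_hasDerivAt γ x hx0)).continuousAt.continuousWithinAt
    · intro x hx
      have hx0 : 0 < x := by linarith [(interior_subset hx).1]
      exact ((emU_hasDerivAt γ hγ n x hx0).sub (emB_hasDerivAt γ x hx0)).hasDerivWithinAt
    · intro x hx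
      linarith [(abs_le.mp (key x (interior_subset hx))).2]

/-- Gluing of monotonicity over unit intervals. -/
lemma glue_mono (g : ℕ → ℝ → ℝ) (hg : ∀ n : ℕ, 1 ≤ n → MonotoneOn (g n) (Set.Icc (n : ℝ) (n + 1)))
    (hs : ∀ n : ℕ, g n ((n : ℝ) + 1) = g (n + 1) ((n : ℝ) + 1)) :
    ∀ x y : ℝ, 1 ≤ x → x ≤ y → g ⌊x⌋₊ x ≤ g ⌊y⌋₊ y := by
  have hseq : ∀ m k : ℕ, 1 ≤ m → g m m ≤ g (m + k) ((m + k : ℕ) : ℝ) := by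
    intro m k hm
    induction k with
    | zero => exact le_refl _
    | succ k ih =>
      refine ih.trans ?_
      have h := hg (m + k) (by omega) (a := ((m + k : ℕ) : ℝ)) ⟨le_refl _, by linarith⟩
        (b := ((m + k : ℕ) : ℝ) + 1) ⟨by linarith, le_refl _⟩ (by linarith)
      rw [hs] at h
      convert h using 1
      push_cast
      ring_nf
  intro x y hx hxy
  have hx0 : 0 ≤ x := by linarith
  have hy0 : 0 ≤ y := by linarith
  have hfx : 1 ≤ ⌊x⌋₊ := Nat.le_floor (by simpa using hx)
  have hfy : 1 ≤ ⌊y⌋₊ := Nat.le_floor (by simpa using hx.trans hxy)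
  have hle : ⌊x⌋₊ ≤ ⌊y⌋₊ := Nat.floor_le_floor hxy
  have hxm : x ∈ Set.Icc ((⌊x⌋₊ : ℕ) : ℝ) (⌊x⌋₊ + 1) := ⟨Nat.floor_le hx0, (Nat.lt_floor_add_one x).le⟩
  have hym : y ∈ Set.Icc ((⌊y⌋₊ : ℕ) : ℝ) (⌊y⌋₊ + 1) := ⟨Nat.floor_le hy0, (Nat.lt_floor_add_one y).le⟩
  rcases hle.eq_or_lt with h | h
  · rw [← h] at hym ⊢
    exact hg _ hfx hxm hym hxy
  · have h1 := hg _ hfx hxm (b := (⌊x⌋₊ : ℝ) + 1) ⟨by linarith, le_refl _⟩ hxm.2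
    rw [hs] at h1
    have h2 := hg _ hfy (a := (⌊y⌋₊ : ℝ)) ⟨le_refl _, by linarith⟩ hym hym.1
    have h3 := hseq (⌊x⌋₊ + 1) (⌊y⌋₊ - (⌊x⌋₊ + 1)) (by omega)
    rw [show ⌊x⌋₊ + 1 + (⌊y⌋₊ - (⌊x⌋₊ + 1)) = ⌊y⌋₊ by omega] at h3
    push_cast at h3
    linarith

lemma em_main (γ : ℝ) (hγ : γ ≠ -1) : ∃ c C : ℝ, 0 ≤ C ∧ ∀ x : ℝ, 1 ≤ x →
    |pw γ x - (c + x ^ (γ + 1) / (γ + 1) - (x - ⌊x⌋₊ - 1 / 2) * x ^ γ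
      + γ * (bb2 (x - ⌊x⌋₊) * x ^ (γ - 1)))| ≤ C * x ^ (γ - 2) := by
  set K := |γ * (γ - 1)| with hK
  have hK0 : 0 ≤ K := abs_nonneg _
  have hmono := glue_mono (fun n x => emU γ n x + emB γ x)
    (fun n hn => (em_mono_piece γ hγ n hn).1) (fun n => by simp only [emU_succ])
  have hanti := glue_mono (fun n x => -(emU γ n x - emB γ x))
    (fun n hn => (em_mono_piece γ hγ n hn).2.neg) (fun n => by simp only [emU_succ])
  suffices h : ∃ c : ℝ, ∀ x : ℝ, 1 ≤ x → |emU γ ⌊x⌋₊ x - c| ≤ K * x ^ (γ - 2) by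
    obtain ⟨c, hc⟩ := h
    refine ⟨c, K + K, by positivity, fun x hx => ?_⟩
    have hx0 : 0 < x := by linarith
    have h1 := hc x hx
    have hb := bb3_abs (by linarith [Nat.floor_le hx0.le] : 0 ≤ x - ⌊x⌋₊)
      (by linarith [Nat.lt_floor_add_one x])
    have hxp : 0 < x ^ (γ - 2) := Real.rpow_pos_of_pos hx0 _
    have h2 : |γ * (γ - 1) * (bb3 (x - ⌊x⌋₊) * x ^ (γ - 2))| ≤ K * x ^ (γ - 2) := by
      rw [abs_mul (γ * (γ - 1)), abs_mul (bb3 _), abs_of_pos hxp]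
      gcongr
      nlinarith
    have e : pw γ x - (c + x ^ (γ + 1) / (γ + 1) - (x - ⌊x⌋₊ - 1 / 2) * x ^ γ
      + γ * (bb2 (x - ⌊x⌋₊) * x ^ (γ - 1))) = (emU γ ⌊x⌋₊ x - c)
        - γ * (γ - 1) * (bb3 (x - ⌊x⌋₊) * x ^ (γ - 2)) := by
      have : pw γ (⌊x⌋₊ : ℝ) = pw γ x := by simp [pw]
      unfold emU
      rw [this]
      ring
    rw [e]
    refine (abs_sub _ _).trans ?_
    linarith
  by_cases hlt : γ < 2
  · have hB : ∀ x, emB γ x = -(K * x ^ (γ - 2)) := fun x => by simp [emB, hlt, hK]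
    simp only [hB] at hmono hanti
    have hcross : ∀ x y : ℝ, 1 ≤ x → 1 ≤ y →
        emU γ ⌊x⌋₊ x - K * x ^ (γ - 2) ≤ emU γ ⌊y⌋₊ y + K * y ^ (γ - 2) := by
      intro x y hx hy
      have px : 0 ≤ K * x ^ (γ - 2) := mul_nonneg hK0 (Real.rpow_nonneg (by linarith) _)
      have py : 0 ≤ K * y ^ (γ - 2) := mul_nonneg hK0 (Real.rpow_nonneg (by linarith) _)
      rcases le_total x y with h | h
      · linarith [hmono x y hx h]
      · linarith [hanti y x hy h]
    refine ⟨sSup ((fun x => emU γ ⌊x⌋₊ x - K * x ^ (γ - 2)) '' Set.Ici 1), fun x hx => ?_⟩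
    have hbdd : BddAbove ((fun x => emU γ ⌊x⌋₊ x - K * x ^ (γ - 2)) '' Set.Ici 1) := by
      refine ⟨emU γ ⌊x⌋₊ x + K * x ^ (γ - 2), ?_⟩
      rintro _ ⟨z, hz, rfl⟩
      exact hcross z x hz hx
    have h1 := le_csSup hbdd ⟨x, hx, rfl⟩
    have h2 : sSup ((fun x => emU γ ⌊x⌋₊ x - K * x ^ (γ - 2)) '' Set.Ici 1) ≤
        emU γ ⌊x⌋₊ x + K * x ^ (γ - 2) := by
      refine csSup_le ⟨_, x, hx, rfl⟩ ?_
      rintro _ ⟨z, hz, rfl⟩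
      exact hcross z x hz hx
    simp only at h1
    rw [abs_le]
    constructor <;> linarith
  · have hB : ∀ x, emB γ x = K * x ^ (γ - 2) := fun x => by simp [emB, hlt, hK]
    simp only [hB] at hmono hanti
    refine ⟨emU γ ⌊(1 : ℝ)⌋₊ 1, fun x hx => ?_⟩
    have h1 := hmono 1 x (le_refl _) hx
    have h2 := hanti 1 x (le_refl _) hx
    have h3 : 0 ≤ K * (1 : ℝ) ^ (γ - 2) := by simp [hK0]
    rw [abs_le]
    constructor <;> linarith


lemma em_zeta (α : ℝ) (hα : 0 < α) (hα1 : α ≠ 1) : ∃ C : ℝ, 0 ≤ C ∧ ∀ x : ℝ, 1 ≤ x →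
    |pw (-α) x - ((riemannZeta (α : ℂ)).re + x ^ (-α + 1) / (-α + 1)
      - (x - ⌊x⌋₊ - 1 / 2) * x ^ (-α)
      + -α * (bb2 (x - ⌊x⌋₊) * x ^ (-α - 1)))| ≤ C * x ^ (-α - 2) := by
  obtain ⟨c, C, hC, h⟩ := em_main (-α) (fun h => hα1 (by linarith))
  suffices hc : c = (riemannZeta (α : ℂ)).re by
    subst hc
    exact ⟨C, hC, h⟩
  have htop : Filter.Tendsto (fun N : ℕ => (N : ℝ) + 1) Filter.atTop Filter.atTop :=
    Filter.tendsto_atTop_add_const_right _ _ tendsto_natCast_atTop_atTop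
  have hp : ∀ p : ℝ, 0 < p → Filter.Tendsto (fun N : ℕ => ((N : ℝ) + 1) ^ (-p)) Filter.atTop
      (nhds 0) := fun p hp => (tendsto_rpow_neg_atTop hp).comp htop
  have hpw : ∀ N : ℕ, pw (-α) ((N : ℝ) + 1) = ∑ n ∈ Finset.range N, ((n : ℝ) + 1) ^ (-α)
      + ((N : ℝ) + 1) ^ (-α) := by
    intro N
    rw [pw_succ]
    congr 1
    induction N with
    | zero => simp [pw]
    | succ N ih =>
      rw [Finset.sum_range_succ, ← ih, ← pw_succ]
      push_cast
      rfl
  have h1 : Filter.Tendsto (fun N : ℕ => pw (-α) ((N : ℝ) + 1)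
      - ((N : ℝ) + 1) ^ (1 - α) / (1 - α)) Filter.atTop (nhds (riemannZeta (α : ℂ)).re) := by
    have := (zeta_lim α hα hα1).add (hp α hα)
    rw [add_zero] at this
    refine this.congr fun N => ?_
    rw [hpw]; ring
  have h2 : Filter.Tendsto (fun N : ℕ => (pw (-α) ((N : ℝ) + 1)
      - ((N : ℝ) + 1) ^ (1 - α) / (1 - α)) - c - (1 / 2) * ((N : ℝ) + 1) ^ (-α)
        + α * (1 / 12) * ((N : ℝ) + 1) ^ (-(α + 1))) Filter.atTop (nhds 0) := by
    have hz := ((hp (α + 2) (by linarith)).const_mul C)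
    rw [mul_zero] at hz
    refine squeeze_zero_norm (fun N => ?_) hz
    have := h ((N : ℝ) + 1) (by linarith [Nat.cast_nonneg (α := ℝ) N])
    have hf : ⌊(N : ℝ) + 1⌋₊ = N + 1 := by exact_mod_cast Nat.floor_natCast (R := ℝ) (N + 1)
    rw [hf] at this
    rw [Real.norm_eq_abs]
    push_cast at this
    rw [show -(α + 2) = -α - 2 by ring, show -(α + 1) = -α - 1 by ring,
      show 1 - α = -α + 1 by ring]
    refine le_trans (le_of_eq ?_) this
    congr 1
    unfold bb2
    ring
  have h3 := ((h1.sub_const c).sub ((hp α hα).const_mul (1 / 2))).add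
    ((hp (α + 1) (by linarith)).const_mul (α * (1 / 12)))
  have := tendsto_nhds_unique h2 h3
  linarith

lemma sum_one_floor (n : ℕ) : ∑ h ∈ Finset.Icc 1 n, (h : ℝ) = n * (n + 1) / 2 := by
  induction n with
  | zero => simp
  | succ n ih => rw [Finset.sum_Icc_succ_top (by omega), ih]; push_cast; ring

lemma sum_sq_floor (n : ℕ) : ∑ h ∈ Finset.Icc 1 n, (h : ℝ) ^ 2 = n * (n + 1) * (2 * n + 1) / 6 := by
  induction n with
  | zero => simp
  | succ n ih => rw [Finset.sum_Icc_succ_top (by omega), ih]; push_cast; ring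

lemma inner_h (t q : ℝ) (hq : 0 < q) (ht : 0 < t) (K : ℕ) (hK : t / q ≤ K) :
    ∑ h ∈ Finset.Icc 1 K, (max (t - h * q) 0) ^ 2 / 2
      = t ^ 3 / (6 * q) - t ^ 2 / 4 + t * q / 12 - q ^ 2 * bb3 (t / q - ⌊t / q⌋₊) := by
  have hv : 0 ≤ t / q := by positivity
  have hsub : Finset.Icc 1 ⌊t / q⌋₊ ⊆ Finset.Icc 1 K := by
    apply Finset.Icc_subset_Icc_right
    exact_mod_cast (Nat.floor_le hv).trans hK
  rw [← Finset.sum_subset hsub]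
  · have : ∀ h ∈ Finset.Icc 1 ⌊t / q⌋₊, (max (t - h * q) 0) ^ 2 / 2
        = t ^ 2 / 2 - t * q * h + q ^ 2 / 2 * (h : ℝ) ^ 2 := by
      intro h hh
      have h1 : (h : ℝ) ≤ t / q := by
        have := (Finset.mem_Icc.mp hh).2
        exact (by exact_mod_cast this : (h : ℝ) ≤ ⌊t / q⌋₊).trans (Nat.floor_le hv)
      rw [le_div_iff₀ hq] at h1
      rw [max_eq_left (by linarith)]
      ring
    rw [Finset.sum_congr rfl this, Finset.sum_add_distrib, Finset.sum_sub_distrib,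
      ← Finset.mul_sum, ← Finset.mul_sum, sum_one_floor, sum_sq_floor, Finset.sum_const,
      Nat.card_Icc]
    simp only [Nat.add_sub_cancel, nsmul_eq_mul]
    generalize (⌊t / q⌋₊ : ℝ) = n
    unfold bb3
    field_simp
    ring
  · intro h hh hn
    have : ⌊t / q⌋₊ < h := by
      by_contra hcon
      exact hn (Finset.mem_Icc.mpr ⟨(Finset.mem_Icc.mp hh).1, by omega⟩)
    have h2 := (Nat.floor_lt hv).mp this
    rw [div_lt_iff₀ hq] at h2
    rw [max_eq_right (by linarith)]
    simp

lemma part_one (β t : ℝ) (hβ : 0 < β) (ht : 0 < t) (Y K : ℕ) (hK : t ≤ K) :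
    |∑ r ∈ Finset.Icc 1 Y, ∑ h ∈ Finset.Icc 1 K, (max (t - h * (r : ℝ) ^ β) 0) ^ 2 / 2
      - (t ^ 3 / 6 * pw (-β) Y - t ^ 2 / 4 * Y + t / 12 * pw β Y)| ≤ Y * ((Y : ℝ) ^ β) ^ 2 := by
  unfold pw
  rw [Nat.floor_natCast, Finset.mul_sum, Finset.mul_sum]
  have e : t ^ 2 / 4 * (Y : ℝ) = ∑ r ∈ Finset.Icc 1 Y, t ^ 2 / 4 := by
    simp; ring
  rw [e, ← Finset.sum_sub_distrib, ← Finset.sum_add_distrib, ← Finset.sum_sub_distrib]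
  refine (Finset.abs_sum_le_sum_abs _ _).trans ?_
  have : ∀ r ∈ Finset.Icc 1 Y, |∑ h ∈ Finset.Icc 1 K, (max (t - h * (r : ℝ) ^ β) 0) ^ 2 / 2
      - (t ^ 3 / 6 * (r : ℝ) ^ (-β) - t ^ 2 / 4 + t / 12 * (r : ℝ) ^ β)| ≤ ((Y : ℝ) ^ β) ^ 2 := by
    intro r hr
    obtain ⟨hr1, hr2⟩ := Finset.mem_Icc.mp hr
    have hr1' : (1 : ℝ) ≤ r := by exact_mod_cast hr1
    have hr2' : (r : ℝ) ≤ Y := by exact_mod_cast hr2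
    have hq1 : 1 ≤ (r : ℝ) ^ β := Real.one_le_rpow hr1' hβ.le
    have hq2 : (r : ℝ) ^ β ≤ (Y : ℝ) ^ β := Real.rpow_le_rpow (by linarith) hr2' hβ.le
    rw [inner_h t _ (by linarith) ht K ((div_le_self ht.le hq1).trans hK),
      Real.rpow_neg (by linarith)]
    set q := (r : ℝ) ^ β with hq
    have hb := bb3_abs (by linarith [Nat.floor_le (by positivity : 0 ≤ t / q)] : 0 ≤ t / q - ⌊t / q⌋₊)
      (by linarith [Nat.lt_floor_add_one (t / q)])
    have e2 : t ^ 3 / (6 * q) - t ^ 2 / 4 + t * q / 12 - q ^ 2 * bb3 (t / q - ⌊t / q⌋₊) -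
      (t ^ 3 / 6 * q⁻¹ - t ^ 2 / 4 + t / 12 * q) = -(q ^ 2 * bb3 (t / q - ⌊t / q⌋₊)) := by
      field_simp
      ring
    rw [e2, abs_neg, abs_mul, abs_of_nonneg (by positivity)]
    have : q ^ 2 ≤ ((Y : ℝ) ^ β) ^ 2 := by gcongr
    nlinarith [sq_nonneg q]
  refine (Finset.sum_le_sum this).trans ?_
  simp


lemma sum_Ioc_pw (γ x : ℝ) (Y : ℕ) (h : (Y : ℝ) ≤ x) :
    ∑ r ∈ Finset.Ioc Y ⌊x⌋₊, (r : ℝ) ^ γ = pw γ x - pw γ Y := by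
  have hY : Y ≤ ⌊x⌋₊ := Nat.le_floor h
  have hu : Finset.Icc 1 ⌊x⌋₊ = Finset.Icc 1 Y ∪ Finset.Ioc Y ⌊x⌋₊ := by
    ext r; simp only [Finset.mem_union, Finset.mem_Icc, Finset.mem_Ioc]; omega
  have hd : Disjoint (Finset.Icc 1 Y) (Finset.Ioc Y ⌊x⌋₊) := by
    rw [Finset.disjoint_left]; intro r; simp only [Finset.mem_Icc, Finset.mem_Ioc]; omega
  unfold pw
  rw [Nat.floor_natCast, hu, Finset.sum_union hd]
  ring

lemma em_int (γ : ℝ) {c C : ℝ} (h : ∀ x : ℝ, 1 ≤ x →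
    |pw γ x - (c + x ^ (γ + 1) / (γ + 1) - (x - ⌊x⌋₊ - 1 / 2) * x ^ γ
      + γ * (bb2 (x - ⌊x⌋₊) * x ^ (γ - 1)))| ≤ C * x ^ (γ - 2)) (Y : ℕ) (hY : 1 ≤ Y) :
    |pw γ Y - (c + (Y : ℝ) ^ γ * (Y / (γ + 1) + 1 / 2 + γ / (12 * Y)))|
      ≤ C * ((Y : ℝ) ^ γ / (Y : ℝ) ^ 2) := by
  have hY0 : (0 : ℝ) < Y := by exact_mod_cast hY
  have := h Y (by exact_mod_cast hY)
  rw [Nat.floor_natCast, Real.rpow_add_one hY0.ne', Real.rpow_sub_one hY0.ne',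
    show γ - 2 = γ - (2 : ℕ) by norm_num, Real.rpow_sub_natCast hY0.ne'] at this
  refine le_trans (le_of_eq ?_) this
  congr 1
  unfold bb2
  field_simp
  ring

lemma part_two_inner (β : ℝ) (hβ : 1 < β) : ∃ C : ℝ, 0 ≤ C ∧ ∀ (t q X : ℝ) (Y K : ℕ),
    0 < t → 0 < q → 1 ≤ Y → (Y : ℝ) ≤ X → X ≤ K → q * X ^ β = t →
    |∑ r ∈ Finset.Ioc Y K, (max (t - q * (r : ℝ) ^ β) 0) ^ 2 / 2
      - (β ^ 2 / ((β + 1) * (2 * β + 1)) * t ^ 2 * X - t ^ 2 * (1 / 4 + Y / 2)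
        + t * q * (Y : ℝ) ^ β * (Y / (β + 1) + 1 / 2 + β / (12 * Y))
        - q ^ 2 * ((Y : ℝ) ^ β) ^ 2 * (Y / (2 * (2 * β + 1)) + 1 / 4 + β / (12 * Y)))|
      ≤ C * (t ^ 2 / (Y : ℝ) ^ 2) := by
  obtain ⟨c₁, C₁, hC₁, h₁⟩ := em_main β (by linarith)
  obtain ⟨c₂, C₂, hC₂, h₂⟩ := em_main (2 * β) (by linarith)
  refine ⟨2 * C₁ + C₂, by positivity, ?_⟩
  intro t q X Y K ht hq hY hYX hXK hqX
  have hY0 : (0 : ℝ) < Y := by exact_mod_cast hY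
  have hX0 : 0 < X := by linarith
  have hX1 : 1 ≤ X := le_trans (by exact_mod_cast hY) hYX
  have hsub : Finset.Ioc Y ⌊X⌋₊ ⊆ Finset.Ioc Y K := by
    apply Finset.Ioc_subset_Ioc_right
    exact Nat.floor_le_of_le hXK
  have hsum : ∑ r ∈ Finset.Ioc Y K, (max (t - q * (r : ℝ) ^ β) 0) ^ 2 / 2
      = t ^ 2 / 2 * (⌊X⌋₊ - Y) - t * q * (pw β X - pw β Y)
        + q ^ 2 / 2 * (pw (2 * β) X - pw (2 * β) Y) := by
    rw [← Finset.sum_subset hsub, ← sum_Ioc_pw β X Y hYX, ← sum_Ioc_pw (2 * β) X Y hYX]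
    · have : ∀ r ∈ Finset.Ioc Y ⌊X⌋₊, (max (t - q * (r : ℝ) ^ β) 0) ^ 2 / 2
          = t ^ 2 / 2 - t * q * (r : ℝ) ^ β + q ^ 2 / 2 * (r : ℝ) ^ (2 * β) := by
        intro r hr
        have h1 : (r : ℝ) ≤ X := by
          have := (Finset.mem_Ioc.mp hr).2
          exact (by exact_mod_cast this : (r : ℝ) ≤ ⌊X⌋₊).trans (Nat.floor_le hX0.le)
        have h2 : (r : ℝ) ^ β ≤ X ^ β := Real.rpow_le_rpow (Nat.cast_nonneg r) h1 (by linarith)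
        have h3 : (r : ℝ) ^ (2 * β) = ((r : ℝ) ^ β) ^ 2 := by
          rw [mul_comm, Real.rpow_mul (Nat.cast_nonneg r)]; norm_num
        rw [max_eq_left (by nlinarith), h3]
        ring
      rw [Finset.sum_congr rfl this, Finset.sum_add_distrib, Finset.sum_sub_distrib,
        ← Finset.mul_sum, ← Finset.mul_sum, Finset.sum_const, Nat.card_Ioc, nsmul_eq_mul,
        Nat.cast_sub (Nat.le_floor hYX)]
      ring
    · intro r hr hn
      have : ⌊X⌋₊ < r := by
        by_contra hcon
        exact hn (Finset.mem_Ioc.mpr ⟨(Finset.mem_Ioc.mp hr).1, by omega⟩)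
      have h2 := (Nat.floor_lt hX0.le).mp this
      have h3 : X ^ β ≤ (r : ℝ) ^ β := Real.rpow_le_rpow hX0.le h2.le (by linarith)
      rw [max_eq_right (by nlinarith)]
      simp
  rw [hsum]
  have a1 := h₁ X hX1
  have a2 := h₂ X hX1
  have b1 := em_int β h₁ Y hY
  have b2 := em_int (2 * β) h₂ Y hY
  have sq : ∀ x : ℝ, 0 < x → x ^ (2 * β) = (x ^ β) ^ 2 := by
    intro x hx
    rw [mul_comm, Real.rpow_mul hx.le]; norm_num
  rw [show β - 2 = β - (2 : ℕ) by norm_num, Real.rpow_sub_natCast hX0.ne',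
    Real.rpow_add_one hX0.ne', Real.rpow_sub_one hX0.ne'] at a1
  rw [show 2 * β - 2 = 2 * β - (2 : ℕ) by norm_num, Real.rpow_sub_natCast hX0.ne',
    Real.rpow_add_one hX0.ne', Real.rpow_sub_one hX0.ne', sq X hX0] at a2
  rw [sq Y hY0] at b2
  have hWP : (Y : ℝ) ^ β ≤ X ^ β := Real.rpow_le_rpow hY0.le hYX (by linarith)
  have hW0 : 0 < (Y : ℝ) ^ β := by positivity
  generalize (Y : ℝ) ^ β = W at *
  generalize X ^ β = P at *
  generalize pw β X = u1 at *
  generalize pw (2 * β) X = u2 at *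
  generalize pw β Y = v1 at *
  generalize pw (2 * β) Y = v2 at *
  set y : ℝ := (Y : ℝ) with hy
  generalize (⌊X⌋₊ : ℝ) = n at *
  generalize hB : bb2 (X - n) = B at *
  set e1 := u1 - (c₁ + P * X / (β + 1) - (X - n - 1 / 2) * P + β * (B * (P / X))) with he1
  set e2 := u2 - (c₂ + P ^ 2 * X / (2 * β + 1) - (X - n - 1 / 2) * P ^ 2
    + 2 * β * (B * (P ^ 2 / X))) with he2
  set f1 := v1 - (c₁ + W * (y / (β + 1) + 1 / 2 + β / (12 * y))) with hf1
  set f2 := v2 - (c₂ + W ^ 2 * (y / (2 * β + 1) + 1 / 2 + 2 * β / (12 * y))) with hf2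
  have hP0 : 0 < P := by linarith
  have key : t ^ 2 / 2 * (n - y) - t * q * (u1 - v1) + q ^ 2 / 2 * (u2 - v2)
      - (β ^ 2 / ((β + 1) * (2 * β + 1)) * t ^ 2 * X - t ^ 2 * (1 / 4 + y / 2)
        + t * q * W * (y / (β + 1) + 1 / 2 + β / (12 * y))
        - q ^ 2 * W ^ 2 * (y / (2 * (2 * β + 1)) + 1 / 4 + β / (12 * y)))
      = - (t * q * e1) + t * q * f1 + q ^ 2 / 2 * e2 - q ^ 2 / 2 * f2 := by
    rw [he1, he2, hf1, hf2, ← hqX]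
    have : β + 1 ≠ 0 := by linarith
    have : 2 * β + 1 ≠ 0 := by linarith
    field_simp
    ring
  rw [key]
  have hq2 : (0 : ℝ) < q ^ 2 := by positivity
  have hy2 : (0 : ℝ) < y ^ 2 := by positivity
  have hyX2 : y ^ 2 ≤ X ^ 2 := by gcongr
  have E1 : |t * q * e1| ≤ C₁ * (t ^ 2 / y ^ 2) := by
    rw [abs_mul, abs_of_pos (by positivity : 0 < t * q)]
    calc t * q * |e1| ≤ t * q * (C₁ * (P / X ^ 2)) := by gcongr
      _ = C₁ * (t * (q * P) / X ^ 2) := by ring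
      _ ≤ C₁ * (t ^ 2 / y ^ 2) := by rw [hqX, ← sq_abs t, abs_of_pos ht, pow_two t]; gcongr
  have F1 : |t * q * f1| ≤ C₁ * (t ^ 2 / y ^ 2) := by
    rw [abs_mul, abs_of_pos (by positivity : 0 < t * q)]
    calc t * q * |f1| ≤ t * q * (C₁ * (W / y ^ 2)) := by gcongr
      _ ≤ t * q * (C₁ * (P / y ^ 2)) := by gcongr
      _ = C₁ * (t * (q * P) / y ^ 2) := by ring
      _ = C₁ * (t ^ 2 / y ^ 2) := by rw [hqX, pow_two t]
  have E2 : |q ^ 2 / 2 * e2| ≤ C₂ / 2 * (t ^ 2 / y ^ 2) := by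
    rw [abs_mul, abs_of_pos (by positivity : 0 < q ^ 2 / 2)]
    calc q ^ 2 / 2 * |e2| ≤ q ^ 2 / 2 * (C₂ * (P ^ 2 / X ^ 2)) := by gcongr
      _ = C₂ / 2 * ((q * P) ^ 2 / X ^ 2) := by ring
      _ ≤ C₂ / 2 * (t ^ 2 / y ^ 2) := by rw [hqX]; gcongr
  have F2 : |q ^ 2 / 2 * f2| ≤ C₂ / 2 * (t ^ 2 / y ^ 2) := by
    rw [abs_mul, abs_of_pos (by positivity : 0 < q ^ 2 / 2)]
    calc q ^ 2 / 2 * |f2| ≤ q ^ 2 / 2 * (C₂ * (W ^ 2 / y ^ 2)) := by gcongr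
      _ ≤ q ^ 2 / 2 * (C₂ * (P ^ 2 / y ^ 2)) := by gcongr
      _ = C₂ / 2 * ((q * P) ^ 2 / y ^ 2) := by ring
      _ = C₂ / 2 * (t ^ 2 / y ^ 2) := by rw [hqX]
  rw [abs_le] at *
  constructor <;> linarith [E1.1, E1.2, E2.1, E2.2, F1.1, F1.2, F2.1, F2.2]


lemma part_two (β : ℝ) (hβ : 1 < β) : ∃ C : ℝ, 0 ≤ C ∧ ∀ (t Z : ℝ) (Y K : ℕ),
    1 ≤ t → 1 ≤ Y → (Y : ℝ) ≤ Z → t ≤ K → Z * (Y : ℝ) ^ β = t →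
    |∑ r ∈ Finset.Ioc Y K, ∑ h ∈ Finset.Icc 1 K, (max (t - h * (r : ℝ) ^ β) 0) ^ 2 / 2
      - (β ^ 2 / ((β + 1) * (2 * β + 1)) * t ^ 2 * (t ^ (1 / β) * pw (-(1 / β)) Z)
        - ⌊Z⌋₊ * (t ^ 2 * (1 / 4 + Y / 2))
        + ⌊Z⌋₊ * (⌊Z⌋₊ + 1) / 2 * (t * (Y : ℝ) ^ β * (Y / (β + 1) + 1 / 2 + β / (12 * Y)))
        - ⌊Z⌋₊ * (⌊Z⌋₊ + 1) * (2 * ⌊Z⌋₊ + 1) / 6 *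
          (((Y : ℝ) ^ β) ^ 2 * (Y / (2 * (2 * β + 1)) + 1 / 4 + β / (12 * Y))))|
      ≤ C * (Z * t ^ 2 / (Y : ℝ) ^ 2) := by
  obtain ⟨C, hC, hin⟩ := part_two_inner β hβ
  refine ⟨C, hC, ?_⟩
  intro t Z Y K ht hY hYZ hK hZ
  have hβ0 : 0 < β := by linarith
  have hY1 : (1 : ℝ) ≤ Y := by exact_mod_cast hY
  have hW1 : 1 ≤ (Y : ℝ) ^ β := Real.one_le_rpow hY1 hβ0.le
  have hZ0 : 0 < Z := by linarith
  have hZt : Z ≤ t := by nlinarith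
  have hnK : ⌊Z⌋₊ ≤ K := Nat.floor_le_of_le (hZt.trans hK)
  have hsub : Finset.Icc 1 ⌊Z⌋₊ ⊆ Finset.Icc 1 K := Finset.Icc_subset_Icc_right hnK
  rw [Finset.sum_comm, ← Finset.sum_subset hsub]
  swap
  · intro h hh hn
    have : ⌊Z⌋₊ < h := by
      by_contra hcon
      exact hn (Finset.mem_Icc.mpr ⟨(Finset.mem_Icc.mp hh).1, by omega⟩)
    have h2 := (Nat.floor_lt hZ0.le).mp this
    refine Finset.sum_eq_zero fun r hr => ?_
    have h1 : (Y : ℝ) ≤ r := by exact_mod_cast (Finset.mem_Ioc.mp hr).1.le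
    have h3 : (Y : ℝ) ^ β ≤ (r : ℝ) ^ β := Real.rpow_le_rpow (by linarith) h1 hβ0.le
    rw [max_eq_right (by nlinarith)]
    simp
  have hterm : ∀ h ∈ Finset.Icc 1 ⌊Z⌋₊,
      |∑ r ∈ Finset.Ioc Y K, (max (t - h * (r : ℝ) ^ β) 0) ^ 2 / 2
      - (β ^ 2 / ((β + 1) * (2 * β + 1)) * t ^ 2 * (t ^ (1 / β) * (h : ℝ) ^ (-(1 / β)))
        - t ^ 2 * (1 / 4 + Y / 2)
        + (h : ℝ) * (t * (Y : ℝ) ^ β * (Y / (β + 1) + 1 / 2 + β / (12 * Y)))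
        - (h : ℝ) ^ 2 * (((Y : ℝ) ^ β) ^ 2 * (Y / (2 * (2 * β + 1)) + 1 / 4 + β / (12 * Y))))|
      ≤ C * (t ^ 2 / (Y : ℝ) ^ 2) := by
    intro h hh
    obtain ⟨hh1, hh2⟩ := Finset.mem_Icc.mp hh
    have hh1' : (1 : ℝ) ≤ h := by exact_mod_cast hh1
    have hh2' : (h : ℝ) ≤ Z :=
      (by exact_mod_cast hh2 : (h : ℝ) ≤ ⌊Z⌋₊).trans (Nat.floor_le hZ0.le)
    have hX : t ^ (1 / β) * (h : ℝ) ^ (-(1 / β)) = (t / h) ^ (1 / β) := by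
      rw [Real.rpow_neg (by linarith), Real.div_rpow (by linarith) (by linarith)]; rfl
    have hth : (Y : ℝ) ^ β ≤ t / h := by
      rw [le_div_iff₀ (by linarith), ← hZ, mul_comm]
      gcongr
    have hpow : ((t / h) ^ (1 / β)) ^ β = t / h := by
      rw [← Real.rpow_mul (by positivity), one_div_mul_cancel hβ0.ne', Real.rpow_one]
    have hYX : (Y : ℝ) ≤ (t / h) ^ (1 / β) := by
      calc (Y : ℝ) = ((Y : ℝ) ^ β) ^ (1 / β) := by
            rw [← Real.rpow_mul (by linarith), mul_one_div_cancel hβ0.ne', Real.rpow_one]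
        _ ≤ _ := Real.rpow_le_rpow (by linarith) hth (by positivity)
    have hXK : (t / h) ^ (1 / β) ≤ K := by
      have h1 : (1 : ℝ) ≤ t / h := hW1.trans hth
      calc (t / h) ^ (1 / β) ≤ (t / h) ^ (1 : ℝ) :=
            Real.rpow_le_rpow_of_exponent_le h1 (by rw [div_le_one hβ0]; linarith)
        _ = t / h := Real.rpow_one _
        _ ≤ t := div_le_self (by linarith) hh1'
        _ ≤ K := hK
    have := hin t h ((t / h) ^ (1 / β)) Y K (by linarith) (by linarith) hY hYX hXK
      (by rw [hpow]; field_simp)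
    rw [hX]
    refine le_trans (le_of_eq ?_) this
    congr 1
    ring
  have hsum := Finset.sum_le_sum hterm
  have habs := (Finset.abs_sum_le_sum_abs _ _).trans hsum
  rw [Finset.sum_sub_distrib, Finset.sum_sub_distrib, Finset.sum_add_distrib,
    Finset.sum_sub_distrib, Finset.sum_const, Finset.sum_const,
    Nat.card_Icc, Nat.add_sub_cancel, nsmul_eq_mul, nsmul_eq_mul,
    ← Finset.mul_sum, ← Finset.mul_sum, ← Finset.sum_mul,
    ← Finset.sum_mul, sum_one_floor, sum_sq_floor] at habs
  unfold pw
  refine habs.trans ?_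
  have : (⌊Z⌋₊ : ℝ) ≤ Z := Nat.floor_le hZ0.le
  calc (⌊Z⌋₊ : ℝ) * (C * (t ^ 2 / (Y : ℝ) ^ 2)) ≤ Z * (C * (t ^ 2 / (Y : ℝ) ^ 2)) := by gcongr
    _ = _ := by ring


/-- Second Riesz sum over a box. -/
noncomputable def dTwo (β : ℝ) (K : ℕ) (t : ℝ) : ℝ :=
  ∑ r ∈ Finset.Icc 1 K, ∑ h ∈ Finset.Icc 1 K, (max (t - h * (r : ℝ) ^ β) 0) ^ 2 / 2

lemma main_identity (β y Z W A V c zb za n s1 s2 s3 : ℝ) (hβ : 1 < β) (hy : 0 < y) (hZ : 0 < Z)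
    (hW : 0 < W) (hA : A * V = y) :
    ((Z * W) ^ 3 / 6 * (s1 + (zb + W⁻¹ * (y / (-β + 1) + 1 / 2 + -β / (12 * y))))
      - (Z * W) ^ 2 / 4 * y
      + (Z * W) / 12 * (s2 + (c + W * (y / (β + 1) + 1 / 2 + β / (12 * y)))))
    + (β ^ 2 / ((β + 1) * (2 * β + 1)) * (Z * W) ^ 2 * (A * (s3 + (za + V * Z / (-(1 / β) + 1)
        - (Z - n - 1 / 2) * V + -(1 / β) * (bb2 (Z - n) * (V / Z)))))
      - n * ((Z * W) ^ 2 * (1 / 4 + y / 2))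
      + n * (n + 1) / 2 * ((Z * W) * W * (y / (β + 1) + 1 / 2 + β / (12 * y)))
      - n * (n + 1) * (2 * n + 1) / 6 *
        (W ^ 2 * (y / (2 * (2 * β + 1)) + 1 / 4 + β / (12 * y))))
    - (zb * (Z * W) ^ 3 / 6 + β ^ 2 / ((β + 1) * (2 * β + 1)) * za * ((Z * W) ^ 2 * A)
        + (Z * W) ^ 2 / 8)
    = (Z * W) ^ 3 / 6 * s1 + (Z * W) / 12 * s2
      + β ^ 2 / ((β + 1) * (2 * β + 1)) * (Z * W) ^ 2 * A * s3
      + W ^ 2 * (2 * bb3 (Z - n) * (y / (2 * (2 * β + 1)) + 1 / 4 + β / (12 * y)))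
      - W ^ 2 * (β * bb2 (Z - n) / 12 * (Z / y)) + c * (Z * W) / 12 := by
  have h1 : β + 1 ≠ 0 := by linarith
  have h2 : 2 * β + 1 ≠ 0 := by linarith
  have h3 : -β + 1 ≠ 0 := by intro h; linarith
  have h3' : 1 - β ≠ 0 := by intro h; linarith
  have h4 : β - 1 ≠ 0 := by intro h; linarith
  have hβ0 : β ≠ 0 := by linarith
  have e1 : V * Z / (-(1 / β) + 1) = V * Z * β / (β - 1) := by
    have : -(1 / β) + 1 = (β - 1) / β := by field_simp; ring
    rw [this]; field_simp
  have e2 : y / (-β + 1) = - (y / (β - 1)) := by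
    rw [show -β + 1 = -(β - 1) by ring, div_neg]
  have e3 : A * (s3 + (za + V * Z / (-(1 / β) + 1)
        - (Z - n - 1 / 2) * V + -(1 / β) * (bb2 (Z - n) * (V / Z))))
      = A * s3 + A * za + (A * V) * (Z * β / (β - 1) - (Z - n - 1 / 2)
        - (1 / β) * (bb2 (Z - n) / Z)) := by
    rw [e1]; ring
  rw [e3, e2, hA]
  unfold bb2 bb3
  field_simp
  ring

set_option maxHeartbeats 2000000 in
theorem dTwo_asymp (β : ℝ) (hβ : 1 < β) : ∃ C : ℝ, 0 ≤ C ∧ ∀ (t : ℝ) (K : ℕ), 1 ≤ t → t ≤ K →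
    |dTwo β K t - ((riemannZeta (β : ℂ)).re * t ^ 3 / 6
      + β ^ 2 / ((β + 1) * (2 * β + 1)) * (riemannZeta ((1 / β : ℝ) : ℂ)).re * (t ^ 2 * t ^ (1 / β))
      + t ^ 2 / 8)| ≤ C * (t ^ 2 * t ^ (-(1 / (β + 1)))) := by
  have hβ0 : 0 < β := by linarith
  obtain ⟨C₁, hC₁, h₁⟩ := em_zeta β hβ0 hβ.ne'
  obtain ⟨c, C₂, hC₂, h₂⟩ := em_main β (by linarith)
  obtain ⟨C₃, hC₃, h₃⟩ := em_zeta (1 / β) (by positivity)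
    (by intro h; rw [div_eq_one_iff_eq hβ0.ne'] at h; linarith)
  obtain ⟨C₄, hC₄, h₄⟩ := part_two β hβ
  generalize (riemannZeta (β : ℂ)).re = zb at *
  generalize (riemannZeta ((1 / β : ℝ) : ℂ)).re = za at *
  set M : ℝ := 2 ^ (β + 1) with hM
  have hM0 : 0 < M := by positivity
  refine ⟨2 * (1 + C₄ * M + C₁ * M + C₂ + C₃ + (4 + 2 * β) + β + |c|), by positivity, ?_⟩
  intro t K ht hK
  set p : ℝ := t ^ (1 / (β + 1)) with hp
  have hp1 : 1 ≤ p := Real.one_le_rpow ht (by positivity)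
  have hpt : p ^ (β + 1) = t := by
    rw [hp, ← Real.rpow_mul (by linarith), one_div_mul_cancel (by linarith), Real.rpow_one]
  set Y : ℕ := ⌊p⌋₊ with hY
  have hY1 : 1 ≤ Y := by rw [hY]; exact Nat.le_floor (by exact_mod_cast hp1)
  have hy1 : (1 : ℝ) ≤ Y := by exact_mod_cast hY1
  have hyp : (Y : ℝ) ≤ p := Nat.floor_le (by linarith)
  have hp2 : p ≤ 2 * Y := by
    have := Nat.lt_floor_add_one p
    rw [← hY] at this
    linarith
  have hy0 : (0 : ℝ) < Y := by linarith
  set W : ℝ := (Y : ℝ) ^ β with hW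
  have hW0 : 0 < W := by positivity
  have hW1 : 1 ≤ W := Real.one_le_rpow hy1 hβ0.le
  have hWY : (Y : ℝ) ^ (β + 1) = W * Y := Real.rpow_add_one hy0.ne' β
  have hYt : W * Y ≤ t := by
    rw [← hWY, ← hpt]; exact Real.rpow_le_rpow hy0.le hyp (by linarith)
  have htY : t ≤ M * (W * Y) := by
    rw [← hWY, ← hpt, hM, ← Real.mul_rpow (by norm_num) hy0.le]
    exact Real.rpow_le_rpow (by linarith) hp2 (by linarith)
  obtain ⟨Z, hZ⟩ : ∃ Z : ℝ, Z * W = t := ⟨t / W, by field_simp⟩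
  have hYZ : (Y : ℝ) ≤ Z := by
    have : W * Y ≤ W * Z := by linarith
    exact le_of_mul_le_mul_left this hW0
  have hZY : Z ≤ M * Y := by
    have : W * Z ≤ W * (M * Y) := by linarith
    exact le_of_mul_le_mul_left this hW0
  have hZ1 : 1 ≤ Z := by linarith
  have hZ0 : 0 < Z := by linarith
  have hZt : Z ≤ t := hZ ▸ le_mul_of_one_le_right hZ0.le hW1
  have hYK : Y ≤ K := by
    have : (Y : ℝ) ≤ K := (hYZ.trans hZt).trans hK
    exact_mod_cast this
  have q1 := part_one β t hβ0 (by linarith) Y K hK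
  have q2 := h₄ t Z Y K ht hY1 hYZ hK hZ
  have q3 := em_int (-β) h₁ Y hY1
  have q4 := em_int β h₂ Y hY1
  have q5 := h₃ Z hZ1
  rw [show (-(1 / β) - 2 : ℝ) = -(1 / β) - (2 : ℕ) by norm_num, Real.rpow_sub_natCast hZ0.ne',
    Real.rpow_add_one hZ0.ne', Real.rpow_sub_one hZ0.ne'] at q5
  rw [Real.rpow_neg hy0.le] at q3
  have hsplit : dTwo β K t = (∑ r ∈ Finset.Icc 1 Y, ∑ h ∈ Finset.Icc 1 K,
      (max (t - h * (r : ℝ) ^ β) 0) ^ 2 / 2) + ∑ r ∈ Finset.Ioc Y K, ∑ h ∈ Finset.Icc 1 K,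
      (max (t - h * (r : ℝ) ^ β) 0) ^ 2 / 2 := by
    have hu : Finset.Icc 1 K = Finset.Icc 1 Y ∪ Finset.Ioc Y K := by
      ext r; simp only [Finset.mem_union, Finset.mem_Icc, Finset.mem_Ioc]; omega
    have hd : Disjoint (Finset.Icc 1 Y) (Finset.Ioc Y K) := by
      rw [Finset.disjoint_left]; intro r; simp only [Finset.mem_Icc, Finset.mem_Ioc]; omega
    unfold dTwo
    rw [← Finset.sum_union hd, ← hu]
  rw [hsplit]
  have hV : t ^ (1 / β) * Z ^ (-(1 / β)) = Y := by
    rw [← hZ, Real.mul_rpow hZ0.le hW0.le, mul_right_comm, ← Real.rpow_add hZ0, add_neg_cancel,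
      Real.rpow_zero, one_mul, hW, ← Real.rpow_mul hy0.le, mul_one_div_cancel hβ0.ne',
      Real.rpow_one]
  have hV0 : 0 < Z ^ (-(1 / β)) := by positivity
  have hA0 : 0 < t ^ (1 / β) := by positivity
  have f0 : 0 ≤ Z - ⌊Z⌋₊ := by linarith [Nat.floor_le hZ0.le]
  have f1 : Z - ⌊Z⌋₊ ≤ 1 := by linarith [Nat.lt_floor_add_one Z]
  have hb2 := bb2_abs f0 f1
  have hb3 := bb3_abs f0 f1
  have hG : t ^ 2 / Y ≤ 2 * (t ^ 2 * t ^ (-(1 / (β + 1)))) := by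
    rw [Real.rpow_neg (by linarith), ← hp, div_le_iff₀ hy0]
    have : 1 ≤ 2 * p⁻¹ * Y := by
      rw [mul_right_comm, ← div_eq_mul_inv, le_div_iff₀ (by linarith)]; linarith
    calc t ^ 2 = t ^ 2 * 1 := (mul_one _).symm
      _ ≤ t ^ 2 * (2 * p⁻¹ * Y) := by gcongr
      _ = _ := by ring
  rw [← hW] at q1 q2 q3 q4
  generalize (∑ r ∈ Finset.Icc 1 Y, ∑ h ∈ Finset.Icc 1 K,
      (max (t - h * (r : ℝ) ^ β) 0) ^ 2 / 2) = S1 at *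
  generalize (∑ r ∈ Finset.Ioc Y K, ∑ h ∈ Finset.Icc 1 K,
      (max (t - h * (r : ℝ) ^ β) 0) ^ 2 / 2) = S2 at *
  generalize t ^ (1 / β) = A at *
  generalize Z ^ (-(1 / β)) = V at *
  generalize pw β Y = u1 at *
  generalize pw (-β) Y = u2 at *
  generalize pw (-(1 / β)) Z = u3 at *
  clear_value W
  generalize (Y : ℝ) = y at *
  generalize (⌊Z⌋₊ : ℝ) = n at *
  generalize t ^ 2 * t ^ (-(1 / (β + 1))) = R at *
  have id := main_identity β y Z W A V c zb za n
    (u2 - (zb + W⁻¹ * (y / (-β + 1) + 1 / 2 + -β / (12 * y))))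
    (u1 - (c + W * (y / (β + 1) + 1 / 2 + β / (12 * y))))
    (u3 - (za + V * Z / (-(1 / β) + 1)
        - (Z - n - 1 / 2) * V + -(1 / β) * (bb2 (Z - n) * (V / Z)))) hβ hy0 hZ0 hW0 hV
  rw [sub_add_cancel, sub_add_cancel, sub_add_cancel, hZ] at id
  generalize (u2 - (zb + W⁻¹ * (y / (-β + 1) + 1 / 2 + -β / (12 * y)))) = s1 at *
  generalize (u1 - (c + W * (y / (β + 1) + 1 / 2 + β / (12 * y)))) = s2 at *
  generalize (u3 - (za + V * Z / (-(1 / β) + 1)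
        - (Z - n - 1 / 2) * V + -(1 / β) * (bb2 (Z - n) * (V / Z)))) = s3 at *
  have hyZ2 : y ^ 2 ≤ Z ^ 2 := by gcongr
  have t0 : 0 < t := by linarith
  have hWt : W = t / Z := by field_simp; linarith
  set G := t ^ 2 / y with hGd
  have hG0 : 0 < G := by positivity
  have B0 : y * W ^ 2 ≤ G := by
    rw [hWt, hGd, le_div_iff₀ hy0, div_pow]
    have : t ^ 2 / Z ^ 2 * y ^ 2 ≤ t ^ 2 := by
      rw [div_mul_eq_mul_div, div_le_iff₀ (by positivity)]; gcongr
    linarith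
  have B1 : C₄ * (Z * t ^ 2 / y ^ 2) ≤ C₄ * M * G := by
    rw [mul_assoc]
    gcongr
    rw [hGd, div_le_iff₀ (by positivity)]
    have : M * (t ^ 2 / y) * y ^ 2 = (M * y) * t ^ 2 := by field_simp
    rw [this]; gcongr
  have B2 : |t ^ 3 / 6 * s1| ≤ C₁ * M * G := by
    rw [abs_mul, abs_of_pos (by positivity)]
    have e : W⁻¹ = Z / t := by rw [hWt]; field_simp
    rw [e] at q3
    calc t ^ 3 / 6 * |s1| ≤ t ^ 3 / 6 * (C₁ * (Z / t / y ^ 2)) := by gcongr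
      _ = C₁ * (t ^ 2 * Z / y ^ 2 / 6) := by field_simp
      _ ≤ C₁ * (t ^ 2 * (M * y) / y ^ 2 / 1) := by gcongr; norm_num
      _ = C₁ * M * G := by rw [hGd]; field_simp
  have B3 : |t / 12 * s2| ≤ C₂ * G := by
    rw [abs_mul, abs_of_pos (by positivity)]
    calc t / 12 * |s2| ≤ t / 12 * (C₂ * (W / y ^ 2)) := by gcongr
      _ = C₂ * (t ^ 2 / (12 * Z * y * y)) := by rw [hWt]; field_simp
      _ ≤ C₂ * G := by
        rw [hGd]; gcongr
        have k : 1 ≤ 12 * Z * y := one_le_mul_of_one_le_of_one_le (by linarith) hy1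
        exact le_mul_of_one_le_left hy0.le k
  have hc' : β ^ 2 / ((β + 1) * (2 * β + 1)) ≤ 1 := by
    rw [div_le_one (by positivity)]; nlinarith only [hβ, sq_nonneg β]
  have hc0 : 0 < β ^ 2 / ((β + 1) * (2 * β + 1)) := by positivity
  have B4 : |β ^ 2 / ((β + 1) * (2 * β + 1)) * t ^ 2 * A * s3| ≤ C₃ * G := by
    rw [abs_mul, abs_of_pos (by positivity)]
    calc β ^ 2 / ((β + 1) * (2 * β + 1)) * t ^ 2 * A * |s3|
        ≤ 1 * t ^ 2 * A * (C₃ * (V / Z ^ 2)) := by gcongr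
      _ = C₃ * (t ^ 2 * (A * V) / Z ^ 2) := by ring
      _ = C₃ * (y * W ^ 2) := by rw [hV, hWt, div_pow]; ring
      _ ≤ C₃ * G := by gcongr
  have B5 : |W ^ 2 * (2 * bb3 (Z - n) * (y / (2 * (2 * β + 1)) + 1 / 4 + β / (12 * y)))|
      ≤ (4 + 2 * β) * G := by
    have k1 : y / (2 * (2 * β + 1)) ≤ y := div_le_self hy0.le (by linarith)
    have k12 : 1 ≤ y * (12 * y) := one_le_mul_of_one_le_of_one_le hy1 (by linarith)
    have k2 : β / (12 * y) ≤ β * y := by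
      rw [div_le_iff₀ (by positivity)]; exact le_mul_of_one_le_right hβ0.le k12 |>.trans (le_of_eq (by ring))
    rw [abs_mul, abs_mul, abs_mul, abs_of_pos (by positivity : 0 < W ^ 2),
      abs_of_pos (by norm_num : (0 : ℝ) < 2),
      abs_of_pos (by positivity : 0 < y / (2 * (2 * β + 1)) + 1 / 4 + β / (12 * y))]
    calc W ^ 2 * (2 * |bb3 (Z - n)| * (y / (2 * (2 * β + 1)) + 1 / 4 + β / (12 * y)))
        ≤ W ^ 2 * (2 * 1 * (y + y + β * y)) := by gcongr; linarith
      _ = (4 + 2 * β) * (y * W ^ 2) := by ring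
      _ ≤ _ := by gcongr
  have B6 : |W ^ 2 * (β * bb2 (Z - n) / 12 * (Z / y))| ≤ β * G := by
    rw [abs_mul, abs_mul, abs_div, abs_mul, abs_of_pos (by positivity : 0 < W ^ 2),
      abs_of_pos (by positivity : 0 < Z / y), abs_of_pos hβ0,
      abs_of_pos (by norm_num : (0 : ℝ) < 12)]
    calc W ^ 2 * (β * |bb2 (Z - n)| / 12 * (Z / y)) ≤ W ^ 2 * (β * 1 / 1 * (Z / y)) := by
          gcongr; norm_num
      _ = β * (t ^ 2 / (Z * y)) := by rw [hWt]; field_simp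
      _ ≤ β * G := by rw [hGd]; gcongr; exact le_mul_of_one_le_left hy0.le hZ1
  have B7 : |c * t / 12| ≤ |c| * G := by
    rw [abs_div, abs_mul, abs_of_pos t0, abs_of_pos (by norm_num : (0 : ℝ) < 12)]
    have : t ≤ G := by
      rw [hGd, le_div_iff₀ hy0]
      have hyt : y ≤ t := hYZ.trans hZt
      rw [pow_two]
      exact mul_le_mul_of_nonneg_left hyt t0.le
    have := mul_le_mul_of_nonneg_left this (abs_nonneg c)
    have := mul_nonneg (abs_nonneg c) t0.le
    linarith
  have hfin : (1 + C₄ * M + C₁ * M + C₂ + C₃ + (4 + 2 * β) + β + |c|) * G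
      ≤ (1 + C₄ * M + C₁ * M + C₂ + C₃ + (4 + 2 * β) + β + |c|) * (2 * R) := by gcongr
  refine le_trans ?_ (le_trans hfin (le_of_eq (by ring)))
  rw [abs_le] at q1 q2 B2 B3 B4 B5 B6 B7 ⊢
  constructor <;> linarith [q1.1, q1.2, q2.1, q2.2, B2.1, B2.2, B3.1, B3.2, B4.1, B4.2, B5.1, B5.2, B6.1, B6.2, B7.1, B7.2]


lemma hasDerivAt_max_sq (v s : ℝ) :
    HasDerivAt (fun x : ℝ => (max (x - v) 0) ^ 2 / 2) (max (s - v) 0) s := by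
  rcases lt_trichotomy s v with h | h | h
  · rw [max_eq_right (by linarith)]
    refine (hasDerivAt_const s (0 : ℝ)).congr_of_eventuallyEq ?_
    filter_upwards [eventually_lt_nhds h] with x hx
    rw [max_eq_right (by linarith)]; norm_num
  · subst h
    rw [sub_self, max_self]
    rw [hasDerivAt_iff_isLittleO]
    simp only [sub_self, max_self]
    have : (fun x : ℝ => (x - s) * (x - s)) =o[nhds s] fun x => x - s := by
      have h1 : (fun x : ℝ => x - s) =o[nhds s] fun _ => (1 : ℝ) := by
        rw [Asymptotics.isLittleO_one_iff]
        have : Filter.Tendsto (fun x : ℝ => x - s) (nhds s) (nhds (s - s)) :=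
          (continuous_id.sub continuous_const).tendsto s
        rwa [sub_self] at this
      simpa using h1.mul_isBigO (Asymptotics.isBigO_refl (fun x : ℝ => x - s) (nhds s))
    refine (Asymptotics.IsBigO.of_bound 1 (Filter.Eventually.of_forall fun x => ?_)).trans_isLittleO this
    simp only [Real.norm_eq_abs, smul_zero]
    rw [abs_mul_self, abs_of_nonneg (by norm_num; positivity)]
    rcases le_total x s with hx | hx
    · rw [max_eq_right (by linarith)]; norm_num; exact mul_self_nonneg _
    · rw [max_eq_left (by linarith)]; nlinarith [sq_nonneg (x - s)]
  · rw [max_eq_left (by linarith)]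
    have h1 : HasDerivAt (fun x : ℝ => (x - v) ^ 2 / 2) (s - v) s := by
      refine ((((hasDerivAt_id s).sub_const v).pow 2).div_const 2).congr_deriv ?_
      simp
    refine h1.congr_of_eventuallyEq ?_
    filter_upwards [eventually_gt_nhds h] with x hx
    rw [max_eq_left (by linarith)]

lemma hasDerivWithinAt_max (v s : ℝ) :
    HasDerivWithinAt (fun x : ℝ => max (x - v) 0) (if v ≤ s then 1 else 0) (Set.Ici s) s := by
  split_ifs with h
  · refine ((hasDerivAt_id s).sub_const v).hasDerivWithinAt.congr ?_ ?_
    · intro x hx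
      have : s ≤ x := hx
      rw [max_eq_left (by linarith)]; rfl
    · rw [max_eq_left (by linarith)]; rfl
  · push Not at h
    refine HasDerivAt.hasDerivWithinAt ?_
    refine (hasDerivAt_const s (0 : ℝ)).congr_of_eventuallyEq ?_
    filter_upwards [eventually_lt_nhds h] with x hx
    rw [max_eq_right (by linarith)]

lemma right_mono (f f' : ℝ → ℝ) (a b e : ℝ) (hab : a ≤ b) (hf : ContinuousOn f (Set.Icc a b))
    (hf' : ∀ x ∈ Set.Ico a b, HasDerivWithinAt f (f' x) (Set.Ici x) x)
    (hb : ∀ x ∈ Set.Ico a b, e ≤ f' x) : e * (b - a) ≤ f b - f a := by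
  have := image_le_of_deriv_right_le_deriv_boundary (f := fun x => e * (x - a) + f a)
    (f' := fun _ => e) (a := a) (b := b) (B := f) (B' := f') (by fun_prop) (fun x _ => by
      have h := ((((hasDerivAt_id x).sub_const a).const_mul e).add_const (f a))
      exact (h.congr_deriv (by ring)).hasDerivWithinAt) (by simp) hf hf' hb
      (Set.right_mem_Icc.mpr hab)
  linarith

lemma second_diff (E E1 : ℝ → ℝ) (t H L : ℝ) (hH : 0 ≤ H)
    (hE : ∀ x, t ≤ x → HasDerivAt E (E1 x) x)
    (hL : ∀ x ∈ Set.Icc t (t + H), L ≤ E1 (x + H) - E1 x) :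
    L * H ≤ E (t + 2 * H) - 2 * E (t + H) + E t := by
  have hd : ∀ x, t ≤ x → HasDerivAt (fun y => E (y + H) - E y) (E1 (x + H) - E1 x) x := by
    intro x hx
    exact ((hE (x + H) (by linarith)).comp_add_const x H).sub (hE x hx)
  have := right_mono (fun y => E (y + H) - E y) (fun x => E1 (x + H) - E1 x) t (t + H) L
    (by linarith) (fun x hx => (hd x hx.1).continuousAt.continuousWithinAt)
    (fun x hx => (hd x hx.1).hasDerivWithinAt) (fun x hx => hL x ⟨hx.1, hx.2.le⟩)
  rw [show t + H + H = t + 2 * H by ring] at this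
  linarith

/-- Periodic antiderivative of the sawtooth. -/
noncomputable def saw2 (y : ℝ) : ℝ := (Int.fract y ^ 2 - Int.fract y) / 2

lemma saw2_cont : Continuous saw2 := by
  have : Continuous ((fun x : ℝ => (x ^ 2 - x) / 2) ∘ Int.fract) :=
    ContinuousOn.comp_fract'' (by fun_prop) (by norm_num)
  exact this

lemma saw2_abs (y : ℝ) : |saw2 y| ≤ 1 / 8 := by
  unfold saw2
  have h0 := Int.fract_nonneg y
  have h1 := Int.fract_lt_one y
  rw [abs_le]
  constructor <;> nlinarith [sq_nonneg (Int.fract y - 1 / 2)]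

lemma saw2_right (M : ℝ → ℝ) (m s : ℝ) (hM : HasDerivAt M m s)
    (hmono : ∀ x, s ≤ x → M s ≤ M x) :
    HasDerivWithinAt (fun x => saw2 (M x)) ((Int.fract (M s) - 1 / 2) * m) (Set.Ici s) s := by
  have h1 : HasDerivAt (fun x => ((M x - ⌊M s⌋) ^ 2 - (M x - ⌊M s⌋)) / 2)
      ((Int.fract (M s) - 1 / 2) * m) s := by
    have h0 := hM.sub_const (⌊M s⌋ : ℝ)
    refine (((h0.pow 2).sub h0).div_const 2).congr_deriv ?_
    rw [← Int.self_sub_floor]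
    push_cast
    ring
  refine h1.hasDerivWithinAt.congr_of_eventuallyEq ?_ ?_
  · have hlt : M s < ⌊M s⌋ + 1 := Int.lt_floor_add_one _
    have := (hM.continuousAt.eventually (eventually_lt_nhds hlt)).filter_mono
      (nhdsWithin_le_nhds (s := Set.Ici s))
    filter_upwards [this, self_mem_nhdsWithin] with x hx hxs
    have hfl : ⌊M x⌋ = ⌊M s⌋ := by
      rw [Int.floor_eq_iff]
      exact ⟨(Int.floor_le _).trans (hmono x hxs), hx⟩
    unfold saw2
    rw [← Int.self_sub_floor, hfl]
  · unfold saw2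
    rw [← Int.self_sub_floor]


section
variable {ι : Type*}

/-- Counting function. -/
noncomputable def fZero (S : Finset ι) (v : ι → ℝ) (x : ℝ) : ℝ := ∑ i ∈ S, if v i ≤ x then 1 else 0
/-- First Riesz sum. -/
noncomputable def fOne (S : Finset ι) (v : ι → ℝ) (x : ℝ) : ℝ := ∑ i ∈ S, max (x - v i) 0
/-- Second Riesz sum. -/
noncomputable def fTwo (S : Finset ι) (v : ι → ℝ) (x : ℝ) : ℝ := ∑ i ∈ S, (max (x - v i) 0) ^ 2 / 2

lemma fTwo_deriv (S : Finset ι) (v : ι → ℝ) (x : ℝ) : HasDerivAt (fTwo S v) (fOne S v x) x := by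
  unfold fTwo fOne
  exact HasDerivAt.fun_sum fun i _ => hasDerivAt_max_sq (v i) x

lemma fOne_deriv (S : Finset ι) (v : ι → ℝ) (x : ℝ) :
    HasDerivWithinAt (fOne S v) (fZero S v x) (Set.Ici x) x := by
  unfold fZero fOne
  exact HasDerivWithinAt.fun_sum fun i _ => hasDerivWithinAt_max (v i) x

lemma fOne_cont (S : Finset ι) (v : ι → ℝ) : Continuous (fOne S v) := by
  unfold fOne
  fun_prop

lemma fZero_nat (S : Finset ι) (v : ι → ℝ) (x : ℝ) : ∃ n : ℕ, fZero S v x = n := by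
  classical
  refine ⟨(S.filter fun i => v i ≤ x).card, ?_⟩
  unfold fZero
  simp

lemma fZero_right (S : Finset ι) (v : ι → ℝ) (x : ℝ) :
    ∀ᶠ y in nhdsWithin x (Set.Ioi x), fZero S v y = fZero S v x := by
  have : ∀ i ∈ S, ∀ᶠ y in nhdsWithin x (Set.Ioi x), (v i ≤ y ↔ v i ≤ x) := by
    intro i _
    by_cases h : v i ≤ x
    · filter_upwards [self_mem_nhdsWithin] with y hy
      have : x < y := hy
      exact ⟨fun _ => h, fun _ => by linarith⟩
    · push Not at h
      filter_upwards [(eventually_lt_nhds h).filter_mono nhdsWithin_le_nhds] with y hy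
      constructor <;> intro <;> linarith
  filter_upwards [(Filter.eventually_all_finset S).mpr this] with y hy
  unfold fZero
  exact Finset.sum_congr rfl fun i hi => by simp only [hy i hi]

lemma case_neg (S : Finset ι) (v : ι → ℝ) (M1 M : ℝ → ℝ) (t H : ℝ) (hH : 0 < H)
    (hM1 : ∀ x, t ≤ x → HasDerivAt M1 (M x) x)
    (hneg : ∀ x ∈ Set.Icc t (t + 2 * H), fZero S v x ≤ M x) :
    ∀ x ∈ Set.Icc t (t + H), (fOne S v (x + H) - M1 (x + H)) - (fOne S v x - M1 x) ≤ 0 := by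
  intro x hx
  obtain ⟨hx1, hx2⟩ := hx
  have := right_mono (fun y => M1 y - fOne S v y) (fun y => M y - fZero S v y) x (x + H) 0
    (by linarith)
    (fun y hy => ((hM1 y (by linarith [hy.1])).continuousAt.continuousWithinAt).sub
      (fOne_cont S v).continuousWithinAt)
    (fun y hy => (hM1 y (by linarith [hy.1])).hasDerivWithinAt.sub (fOne_deriv S v y))
    (fun y hy => by linarith [hneg y ⟨by linarith [hy.1], by linarith [hy.2]⟩])
  linarith

lemma case_pos (S : Finset ι) (v : ι → ℝ) (M1 M M' M'' : ℝ → ℝ) (t H m : ℝ) (hH : 0 < H)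
    (hm0 : 0 < m)
    (hM1 : ∀ x, t ≤ x → HasDerivAt M1 (M x) x)
    (hM : ∀ x, t ≤ x → HasDerivAt M (M' x) x)
    (hM' : ∀ x, t ≤ x → HasDerivAt M' (M'' x) x)
    (hm : ∀ x, t ≤ x → m ≤ M' x)
    (hM'' : ∀ x, t ≤ x → |M'' x| ≤ m ^ 2 / 2)
    (hpos : ∀ x ∈ Set.Icc t (t + 2 * H), M x ≤ fZero S v x) :
    ∀ x ∈ Set.Icc t (t + H), 7 / 16 * H - 1 / (4 * m)
      ≤ (fOne S v (x + H) - M1 (x + H)) - (fOne S v x - M1 x) := by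
  have hmono : StrictMonoOn M (Set.Ici t) := by
    refine strictMonoOn_of_deriv_pos (convex_Ici t)
      (fun x hx => (hM x hx).continuousAt.continuousWithinAt) ?_
    intro x hx
    rw [interior_Ici] at hx
    have hx' : t ≤ x := le_of_lt hx
    rw [(hM x hx').deriv]
    linarith [hm x hx']
  have hfl : ∀ x ∈ Set.Ico t (t + 2 * H), (⌊M x⌋ : ℝ) + 1 ≤ fZero S v x := by
    intro x hx
    have h1 : ∀ᶠ y in nhdsWithin x (Set.Ioi x), y < t + 2 * H :=
      (eventually_lt_nhds hx.2).filter_mono nhdsWithin_le_nhds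
    have h2 : ∀ᶠ y in nhdsWithin x (Set.Ioi x), x < y := self_mem_nhdsWithin
    obtain ⟨y, hy1, hy2, hy3⟩ := (h1.and (h2.and (fZero_right S v x))).exists
    have h4 := hpos y ⟨by linarith [hx.1], hy1.le⟩
    rw [hy3] at h4
    have h5 : M x < M y := hmono hx.1 (by simp only [Set.mem_Ici]; linarith [hx.1]) hy2
    obtain ⟨n, hn⟩ := fZero_nat S v x
    rw [hn] at h4 ⊢
    have h6 : ⌊M x⌋ < (n : ℤ) := by
      rw [Int.floor_lt]
      push_cast
      linarith
    have h7 : ⌊M x⌋ + 1 ≤ (n : ℤ) := h6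
    exact_mod_cast h7
  intro x hx
  obtain ⟨hx1, hx2⟩ := hx
  have hder : ∀ y ∈ Set.Ico x (x + H), HasDerivWithinAt
      (fun y => fOne S v y - M1 y - y / 2 + saw2 (M y) / M' y)
      (fZero S v y - M y - 1 / 2 + (((Int.fract (M y) - 1 / 2) * M' y) * M' y
        - saw2 (M y) * M'' y) / M' y ^ 2) (Set.Ici y) y := by
    intro y hy
    have hty : t ≤ y := by linarith [hy.1]
    refine HasDerivWithinAt.add ((HasDerivWithinAt.sub (fOne_deriv S v y)
      (hM1 y hty).hasDerivWithinAt).sub ((hasDerivAt_id y).div_const 2).hasDerivWithinAt) ?_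
    refine (saw2_right M (M' y) y (hM y hty) ?_).div (hM' y hty).hasDerivWithinAt ?_
    · intro z hz
      exact hmono.monotoneOn hty (hty.trans hz) hz
    · linarith [hm y hty]
  have hcont : ContinuousOn (fun y => fOne S v y - M1 y - y / 2 + saw2 (M y) / M' y)
      (Set.Icc x (x + H)) := by
    intro y hy
    have hty : t ≤ y := by linarith [hy.1]
    refine ContinuousAt.continuousWithinAt ?_
    refine (((fOne_cont S v).continuousAt.sub (hM1 y hty).continuousAt).sub
      (continuousAt_id.div_const 2)).add ?_
    refine ContinuousAt.div ?_ (hM' y hty).continuousAt (by linarith [hm y hty])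
    exact ContinuousAt.comp' saw2_cont.continuousAt (hM y hty).continuousAt
  have hbound : ∀ y ∈ Set.Ico x (x + H), -(1 / 16 : ℝ) ≤
      (fZero S v y - M y - 1 / 2 + (((Int.fract (M y) - 1 / 2) * M' y) * M' y
        - saw2 (M y) * M'' y) / M' y ^ 2) := by
    intro y hy
    have hty : t ≤ y := by linarith [hy.1]
    have h1 := hfl y ⟨hty, by linarith [hy.2]⟩
    have h2 := hm y hty
    have h3 : M' y ≠ 0 := by linarith
    have h4 : (((Int.fract (M y) - 1 / 2) * M' y) * M' y - saw2 (M y) * M'' y) / M' y ^ 2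
        = Int.fract (M y) - 1 / 2 - saw2 (M y) * M'' y / M' y ^ 2 := by
      field_simp
    have h5 : |saw2 (M y) * M'' y / M' y ^ 2| ≤ 1 / 16 := by
      rw [abs_div, abs_mul, abs_of_pos (by positivity : 0 < M' y ^ 2), div_le_iff₀ (by positivity)]
      have h6 : m ^ 2 ≤ M' y ^ 2 := by gcongr
      calc |saw2 (M y)| * |M'' y| ≤ 1 / 8 * (m ^ 2 / 2) := by
            gcongr
            · exact saw2_abs _
            · exact hM'' y hty
        _ ≤ _ := by linarith
    rw [h4, ← Int.self_sub_floor]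
    linarith [(abs_le.mp h5).2]
  have := right_mono _ _ x (x + H) (-(1 / 16)) (by linarith) hcont hder hbound
  have hs : ∀ y, t ≤ y → |saw2 (M y) / M' y| ≤ 1 / (8 * m) := by
    intro y hty
    have h2 := hm y hty
    rw [abs_div, abs_of_pos (by linarith : 0 < M' y), ← div_div]
    gcongr
    exact saw2_abs _
  have k1 := abs_le.mp (hs x hx1)
  have k2 := abs_le.mp (hs (x + H) (by linarith))
  have k3 : 1 / (4 * m) = 1 / (8 * m) + 1 / (8 * m) := by field_simp; norm_num
  rw [k3]
  linarith [k1.1, k1.2, k2.1, k2.2]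

end


lemma fTwo_eq_dTwo (β : ℝ) (K : ℕ) (t : ℝ) :
    fTwo (Finset.Icc 1 K ×ˢ Finset.Icc 1 K) (fun p : ℕ × ℕ => (p.1 : ℝ) * (p.2 : ℝ) ^ β) t
      = dTwo β K t := by
  unfold fTwo dTwo
  rw [Finset.sum_product_right]

theorem core_sign (β : ℝ) (hβ : 1 < β) (δ : ℝ) (hδ : 0 < δ) (hδ2 : 2 * δ < 1 / (β + 1)) :
    ∃ t₁ : ℝ, 1 ≤ t₁ ∧ ∀ t : ℝ, t₁ ≤ t → ∀ K : ℕ, 3 * t ≤ K →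
      (∃ x ∈ Set.Icc t (t + 2 * t ^ (1 - δ)),
        fZero (Finset.Icc 1 K ×ˢ Finset.Icc 1 K) (fun p : ℕ × ℕ => (p.1 : ℝ) * (p.2 : ℝ) ^ β) x
          < (riemannZeta (β : ℂ)).re * x + (riemannZeta ((1 / β : ℝ) : ℂ)).re * x ^ (1 / β)) ∧
      (∃ x ∈ Set.Icc t (t + 2 * t ^ (1 - δ)),
        (riemannZeta (β : ℂ)).re * x + (riemannZeta ((1 / β : ℝ) : ℂ)).re * x ^ (1 / β) <
        fZero (Finset.Icc 1 K ×ˢ Finset.Icc 1 K) (fun p : ℕ × ℕ => (p.1 : ℝ) * (p.2 : ℝ) ^ β) x) := by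
  have hβ0 : 0 < β := by linarith
  obtain ⟨C, hC, hasym⟩ := dTwo_asymp β hβ
  have hzb : 0 < (riemannZeta (β : ℂ)).re := riemannZeta_re_pos_of_one_lt hβ
  generalize (riemannZeta (β : ℂ)).re = zb at *
  generalize (riemannZeta ((1 / β : ℝ) : ℂ)).re = za at *
  have hα0 : 0 < 1 / β := by positivity
  have hα1 : 1 / β < 1 := by rw [div_lt_one hβ0]; exact hβ
  have hcc : β ^ 2 / ((β + 1) * (2 * β + 1)) = 1 / ((1 / β + 1) * (1 / β + 2)) := by
    field_simp
    ring
  rw [hcc] at hasym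
  have hκ1 : 1 / (β + 1) < 1 := by rw [div_lt_one (by linarith)]; linarith
  generalize hκ : 1 / (β + 1) = κ at *
  generalize 1 / β = α at *
  have hM2 : ∀ x : ℝ, 0 < x → HasDerivAt
      (fun x : ℝ => zb * x ^ 3 / 6 + 1 / ((α + 1) * (α + 2)) * za * (x ^ 2 * x ^ α))
      (zb * x ^ 2 / 2 + za / (α + 1) * (x * x ^ α)) x := by
    intro x hx
    have h1 := ((hasDerivAt_pow 3 x).const_mul zb).div_const 6
    have h2 := ((hasDerivAt_pow 2 x).mul
      (Real.hasDerivAt_rpow_const (p := α) (Or.inl hx.ne'))).const_mul (1 / ((α + 1) * (α + 2)) * za)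
    refine (h1.add h2).congr_deriv ?_
    rw [Real.rpow_sub_one hx.ne']
    push_cast
    field_simp
    ring
  have hM1 : ∀ x : ℝ, 0 < x → HasDerivAt
      (fun x : ℝ => zb * x ^ 2 / 2 + za / (α + 1) * (x * x ^ α))
      (zb * x + za * x ^ α) x := by
    intro x hx
    have h1 := ((hasDerivAt_pow 2 x).const_mul zb).div_const 2
    have h2 := ((hasDerivAt_id x).mul
      (Real.hasDerivAt_rpow_const (p := α) (Or.inl hx.ne'))).const_mul (za / (α + 1))
    refine (h1.add h2).congr_deriv ?_
    rw [Real.rpow_sub_one hx.ne']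
    simp only [id]
    push_cast
    field_simp
    ring
  have hM : ∀ x : ℝ, 0 < x → HasDerivAt (fun x : ℝ => zb * x + za * x ^ α)
      (zb + za * (α * x ^ (α - 1))) x := by
    intro x hx
    refine (((hasDerivAt_id x).const_mul zb).add
      ((Real.hasDerivAt_rpow_const (p := α) (Or.inl hx.ne')).const_mul za)).congr_deriv ?_
    ring
  have hM' : ∀ x : ℝ, 0 < x → HasDerivAt (fun x : ℝ => zb + za * (α * x ^ (α - 1)))
      (za * (α * ((α - 1) * x ^ (α - 1 - 1)))) x := by
    intro x hx
    exact (((Real.hasDerivAt_rpow_const (p := α - 1) (Or.inl hx.ne')).const_mul α).const_mul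
      za).const_add zb
  have hp : ∀ p : ℝ, 0 < p → ∀ A : ℝ, Filter.Tendsto (fun x : ℝ => A * x ^ (-p)) Filter.atTop
      (nhds 0) := by
    intro p hp A
    have := (tendsto_rpow_neg_atTop hp).const_mul A
    rwa [mul_zero] at this
  set m := zb / 2 with hm
  have hm0 : 0 < m := by positivity
  have ev1 : ∀ᶠ t : ℝ in Filter.atTop, ∀ x, t ≤ x → m ≤ zb + za * (α * x ^ (α - 1)) := by
    rw [Filter.eventually_forall_ge_atTop]
    filter_upwards [(hp (1 - α) (by linarith) (za * α)).eventually (eventually_gt_nhds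
      (by linarith : -m < 0))] with x hx
    rw [show -(1 - α) = α - 1 by ring] at hx
    linarith
  have ev2 : ∀ᶠ t : ℝ in Filter.atTop, ∀ x, t ≤ x →
      |za * (α * ((α - 1) * x ^ (α - 1 - 1)))| ≤ m ^ 2 / 2 := by
    rw [Filter.eventually_forall_ge_atTop]
    have h := (hp (2 - α) (by linarith) (za * α * (α - 1))).abs
    rw [abs_zero] at h
    filter_upwards [h.eventually (eventually_lt_nhds
      (by positivity : 0 < m ^ 2 / 2))] with x hx
    rw [show -(2 - α) = α - 1 - 1 by ring] at hx
    refine le_trans (le_of_eq ?_) hx.le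
    congr 1; ring
  have ev3 : ∀ᶠ t : ℝ in Filter.atTop, 36 * C * t ^ (-(κ - 2 * δ)) < 1 / 16 :=
    (hp (κ - 2 * δ) (by linarith) (36 * C)).eventually (eventually_lt_nhds (by norm_num))
  have ev4 : ∀ᶠ t : ℝ in Filter.atTop, 4 / m < t ^ (1 - δ) :=
    (tendsto_rpow_atTop (by linarith : 0 < 1 - δ)).eventually (Filter.eventually_gt_atTop _)
  obtain ⟨t₁, ht₁⟩ := Filter.eventually_atTop.mp (ev1.and (ev2.and (ev3.and ev4)))
  refine ⟨max t₁ 1, le_max_right _ _, ?_⟩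
  intro t ht K hK
  obtain ⟨hv1, hv2, hv3, hv4⟩ := ht₁ t ((le_max_left _ _).trans ht)
  have ht1 : 1 ≤ t := (le_max_right _ _).trans ht
  have ht0 : 0 < t := by linarith
  set H := t ^ (1 - δ) with hH
  have hH0 : 0 < H := by positivity
  have hHt : H ≤ t := by
    calc H ≤ t ^ (1 : ℝ) := Real.rpow_le_rpow_of_exponent_le ht1 (by linarith)
      _ = t := Real.rpow_one t
  set S := Finset.Icc 1 K ×ˢ Finset.Icc 1 K with hS
  set v := (fun p : ℕ × ℕ => (p.1 : ℝ) * (p.2 : ℝ) ^ β) with hv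
  set E : ℝ → ℝ := fun x => fTwo S v x - (zb * x ^ 3 / 6 + 1 / ((α + 1) * (α + 2)) * za * (x ^ 2 * x ^ α))
    with hE
  have herr : ∀ x, t ≤ x → x ≤ 3 * t → |E x - x ^ 2 / 8| ≤ H ^ 2 / 64 := by
    intro x hx1 hx2
    have h := hasym x K (by linarith) (by linarith)
    rw [← fTwo_eq_dTwo] at h
    have h1 : C * (x ^ 2 * x ^ (-κ)) ≤ H ^ 2 / 64 := by
      have h2 : x ^ (-κ) ≤ t ^ (-κ) := Real.rpow_le_rpow_of_nonpos ht0 hx1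
        (by rw [← hκ]; have : 0 < 1 / (β + 1) := by positivity
            linarith)
      have h3 : H ^ 2 * t ^ (-(κ - 2 * δ)) = t ^ 2 * t ^ (-κ) := by
        rw [hH, ← Real.rpow_natCast (t ^ (1 - δ)) 2, ← Real.rpow_mul ht0.le,
          ← Real.rpow_natCast t 2, ← Real.rpow_add ht0, ← Real.rpow_add ht0]
        congr 1
        push_cast
        ring
      calc C * (x ^ 2 * x ^ (-κ)) ≤ C * ((3 * t) ^ 2 * t ^ (-κ)) := by
            have : 0 < x := by linarith
            gcongr
        _ = 9 * C * (t ^ 2 * t ^ (-κ)) := by ring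
        _ = H ^ 2 / 4 * (36 * C * t ^ (-(κ - 2 * δ))) := by rw [← h3]; ring
        _ ≤ H ^ 2 / 4 * (1 / 16) := by gcongr
        _ = _ := by ring
    refine le_trans (le_of_eq ?_) (h.trans h1)
    congr 1
    rw [hE]
    ring
  have a0 := abs_le.mp (herr t le_rfl (by linarith))
  have a1 := abs_le.mp (herr (t + H) (by linarith) (by linarith))
  have a2 := abs_le.mp (herr (t + 2 * H) (by linarith) (by linarith))
  have hEd : ∀ x, t ≤ x → HasDerivAt E
      (fOne S v x - (zb * x ^ 2 / 2 + za / (α + 1) * (x * x ^ α))) x := fun x hx =>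
    (fTwo_deriv S v x).sub (hM2 x (by linarith))
  have hHsq : 0 < H ^ 2 := by positivity
  constructor
  · by_contra hcon
    push Not at hcon
    have k := case_pos S v _ _ _ _ t H m hH0 hm0 (fun x hx => hM1 x (by linarith))
      (fun x hx => hM x (by linarith)) (fun x hx => hM' x (by linarith)) hv1 hv2 hcon
    have k2 := second_diff E _ t H _ hH0.le hEd k
    have k3 : 1 / (4 * m) < H / 16 := by
      rw [show 1 / (4 * m) = 4 / m / 16 by field_simp; norm_num]
      linarith
    have k4 : (6 / 16 * H) * H ≤ (7 / 16 * H - 1 / (4 * m)) * H := by gcongr; linarith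
    linarith [a0.1, a0.2, a1.1, a1.2, a2.1, a2.2]
  · by_contra hcon
    push Not at hcon
    have k := case_neg S v _ _ t H hH0 (fun x hx => hM1 x (by linarith)) hcon
    have k2 := second_diff (fun x => - E x) _ t H 0 hH0.le (fun x hx => (hEd x hx).neg)
      (fun x hx => by linarith [k x hx])
    linarith [a0.1, a0.2, a1.1, a1.2, a2.1, a2.2]

lemma latticeCount_eq (a b : ℕ) (ha : 1 ≤ a) (hb : a ≤ b) (s : ℝ) (hs : 1 ≤ s) (K : ℕ) (hK : s ≤ K) :
    latticeCount a b (s ^ (a : ℝ)) = fZero (Finset.Icc 1 K ×ˢ Finset.Icc 1 K)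
      (fun p : ℕ × ℕ => (p.1 : ℝ) * (p.2 : ℝ) ^ ((b : ℝ) / a)) s := by
  classical
  have ha0 : (0 : ℝ) < a := by exact_mod_cast ha
  have hb0 : (0 : ℝ) < b := by exact_mod_cast (ha.trans hb)
  have hβ0 : (0 : ℝ) < (b : ℝ) / a := by positivity
  unfold latticeCount fZero
  rw [Finset.sum_boole]
  congr 1
  rw [← Set.ncard_coe_finset]
  congr 1
  ext ⟨h, r⟩
  simp only [Set.mem_ofPred_eq, Finset.coe_filter, Finset.mem_product, Finset.mem_Icc]
  have key : ((h : ℝ) ^ (a : ℝ) * (r : ℝ) ^ (b : ℝ) ≤ s ^ (a : ℝ)) ↔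
      (h : ℝ) * (r : ℝ) ^ ((b : ℝ) / a) ≤ s := by
    have e : (h : ℝ) ^ (a : ℝ) * (r : ℝ) ^ (b : ℝ) = ((h : ℝ) * (r : ℝ) ^ ((b : ℝ) / a)) ^ (a : ℝ) := by
      rw [Real.mul_rpow (by positivity) (by positivity), ← Real.rpow_mul (by positivity),
        div_mul_cancel₀ _ ha0.ne']
    rw [e]
    exact Real.rpow_le_rpow_iff (by positivity) (by linarith) ha0
  rw [key]
  constructor
  · rintro ⟨h1, h2, h3⟩
    have h1' : (1 : ℝ) ≤ h := by exact_mod_cast h1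
    have h2' : (1 : ℝ) ≤ r := by exact_mod_cast h2
    have h4 : 1 ≤ (r : ℝ) ^ ((b : ℝ) / a) := Real.one_le_rpow h2' hβ0.le
    refine ⟨⟨⟨h1, ?_⟩, h2, ?_⟩, h3⟩
    · have : (h : ℝ) ≤ K := by nlinarith
      exact_mod_cast this
    · have hβ1 : (1 : ℝ) ≤ (b : ℝ) / a := by
        rw [one_le_div ha0]; exact_mod_cast hb
      have h5 : (r : ℝ) ≤ (r : ℝ) ^ ((b : ℝ) / a) := Real.self_le_rpow_of_one_le h2' hβ1
      have h6 : (r : ℝ) ≤ K := by nlinarith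
      exact_mod_cast h6
  · rintro ⟨⟨⟨h1, _⟩, h2, _⟩, h3⟩
    exact ⟨h1, h2, h3⟩

lemma one_add_two_pow (u : ℝ) (h0 : 0 ≤ u) (h1 : u ≤ 1) (n : ℕ) :
    (1 + 2 * u) ^ n ≤ 1 + (3 ^ n - 1) * u := by
  induction n with
  | zero => simp
  | succ n ih =>
    have h3 : (1 : ℝ) ≤ 3 ^ n := one_le_pow₀ (by norm_num)
    rw [pow_succ, pow_succ]
    have := mul_le_mul_of_nonneg_right ih (by linarith : 0 ≤ 1 + 2 * u)
    nlinarith [mul_nonneg (mul_nonneg (by linarith : (0 : ℝ) ≤ 3 ^ n - 1) h0)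
      (by linarith : 0 ≤ 1 - u)]

theorem sign_changes_coprime_integers (a b : ℕ) (ha : 1 ≤ a) (hab : a < b)
    (hcop : Nat.gcd a b = 1) :
    ∃ c₆ > (0 : ℝ), ∃ T₁ : ℝ, ∀ T : ℝ, T₁ ≤ T →
      ∃ x₁ ∈ Set.Icc T (T + c₆ *
          T ^ (1 - (a : ℝ) / (b * ((a : ℝ) + b) * ((a : ℝ) + b - 1))) * (Real.log T) ^ 4),
      ∃ x₂ ∈ Set.Icc T (T + c₆ *
          T ^ (1 - (a : ℝ) / (b * ((a : ℝ) + b) * ((a : ℝ) + b - 1))) * (Real.log T) ^ 4),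
        DeltaErr a b x₁ < 0 ∧ 0 < DeltaErr a b x₂ := by
  have ha0 : (0 : ℝ) < a := by exact_mod_cast ha
  have ha1 : (1 : ℝ) ≤ a := by exact_mod_cast ha
  have hab' : (a : ℝ) + 1 ≤ b := by exact_mod_cast hab
  have hb0 : (0 : ℝ) < b := by linarith
  set δ : ℝ := (a : ℝ) / (b * ((a : ℝ) + b) * ((a : ℝ) + b - 1)) with hδ
  have hab1 : (0 : ℝ) < (a : ℝ) + b - 1 := by linarith
  have hδ0 : 0 < δ := by positivity
  have hβ : 1 < (b : ℝ) / a := by rw [one_lt_div ha0]; linarith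
  have hδ2 : 2 * (a * δ) < 1 / ((b : ℝ) / a + 1) := by
    have e : 1 / ((b : ℝ) / a + 1) = a / (a + b) := by field_simp; ring
    have e2 : 2 * (a * δ) = (a / (a + b)) * (2 * a / (b * (a + b - 1))) := by
      rw [hδ]; field_simp
    rw [e, e2]
    have : 2 * a / (b * (a + b - 1)) < (1 : ℝ) := by
      rw [div_lt_one (by positivity)]; nlinarith
    exact mul_lt_of_lt_one_right (by positivity) this
  obtain ⟨t₁, ht₁, hcore⟩ := core_sign ((b : ℝ) / a) hβ (a * δ) (by positivity) hδ2
  refine ⟨3 ^ a, by positivity, max (t₁ ^ (a : ℝ)) (Real.exp 1), ?_⟩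
  intro T hT
  have hT1 : t₁ ^ (a : ℝ) ≤ T := (le_max_left _ _).trans hT
  have hTe : Real.exp 1 ≤ T := (le_max_right _ _).trans hT
  have hT0 : 0 < T := (Real.exp_pos 1).trans_le hTe
  have hTone : 1 ≤ T := (Real.one_le_exp (by norm_num)).trans hTe
  set t : ℝ := T ^ (1 / (a : ℝ)) with ht
  have htT : t ^ (a : ℝ) = T := by
    rw [ht, ← Real.rpow_mul hT0.le, one_div_mul_cancel ha0.ne', Real.rpow_one]
  have ht0 : 0 < t := by positivity
  have htt : t₁ ≤ t := by
    rw [← htT] at hT1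
    exact (Real.rpow_le_rpow_iff (by linarith) ht0.le ha0).mp hT1
  have ht1 : 1 ≤ t := ht₁.trans htt
  obtain ⟨⟨s₁, hs₁, hn⟩, s₂, hs₂, hp⟩ := hcore t htt ⌈3 * t⌉₊ (Nat.le_ceil _)
  set u : ℝ := T ^ (-δ) with hu
  have hu0 : 0 < u := by positivity
  have hu1 : u ≤ 1 := Real.rpow_le_one_of_one_le_of_nonpos hTone (by linarith)
  have hHu : t ^ (1 - a * δ) = t * u := by
    rw [hu, ← htT, ← Real.rpow_mul ht0.le, sub_eq_add_neg, Real.rpow_add ht0, Real.rpow_one]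
    congr 2
    ring
  rw [hHu] at hs₁ hs₂
  have hlog : 1 ≤ (Real.log T) ^ 4 :=
    one_le_pow₀ ((Real.le_log_iff_exp_le hT0).mpr hTe)
  have hTu : T ^ (1 - δ) = T * u := by
    rw [hu, sub_eq_add_neg, Real.rpow_add hT0, Real.rpow_one]
  have hmem : ∀ s ∈ Set.Icc t (t + 2 * (t * u)), s ^ (a : ℝ) ∈ Set.Icc T (T + 3 ^ a *
      T ^ (1 - δ) * (Real.log T) ^ 4) := by
    intro s hs
    constructor
    · rw [← htT]; exact Real.rpow_le_rpow ht0.le hs.1 ha0.le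
    · have hle := Real.rpow_le_rpow (by linarith [hs.1]) hs.2 ha0.le
      refine hle.trans ?_
      rw [show t + 2 * (t * u) = t * (1 + 2 * u) by ring, Real.mul_rpow ht0.le (by linarith), htT,
        hTu, Real.rpow_natCast]
      have h1 := one_add_two_pow u hu0.le hu1 a
      have h2 : T * (1 + 2 * u) ^ a ≤ T * (1 + 3 ^ a * u) := by
        gcongr; linarith
      have h3 : 3 ^ a * (T * u) * 1 ≤ 3 ^ a * (T * u) * (Real.log T) ^ 4 := by gcongr
      linarith
  have hval : ∀ s ∈ Set.Icc t (t + 2 * (t * u)), DeltaErr a b (s ^ (a : ℝ))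
      = fZero (Finset.Icc 1 ⌈3 * t⌉₊ ×ˢ Finset.Icc 1 ⌈3 * t⌉₊)
      (fun p : ℕ × ℕ => (p.1 : ℝ) * (p.2 : ℝ) ^ ((b : ℝ) / a)) s
        - ((riemannZeta ((b / a : ℝ) : ℂ)).re * s
        + (riemannZeta ((1 / (b / a) : ℝ) : ℂ)).re * s ^ (1 / ((b : ℝ) / a))) := by
    intro s hs
    have hs0 : 0 < s := by linarith [hs.1]
    have hsK : s ≤ ⌈3 * t⌉₊ := by
      refine le_trans ?_ (Nat.le_ceil _)
      have : t * u ≤ t := mul_le_of_le_one_right ht0.le hu1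
      linarith [hs.2]
    unfold DeltaErr
    rw [latticeCount_eq a b ha (by omega) s (by linarith [hs.1]) _ hsK, ← Real.rpow_mul hs0.le,
      ← Real.rpow_mul hs0.le, mul_one_div_cancel ha0.ne', Real.rpow_one, one_div_div, mul_one_div]
    ring
  refine ⟨s₁ ^ (a : ℝ), hmem s₁ hs₁, s₂ ^ (a : ℝ), hmem s₂ hs₂, ?_, ?_⟩
  · rw [hval s₁ hs₁]; linarith
  · rw [hval s₂ hs₂]; linarith
end
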